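/- (Absorption theorem.) Let R = (R,T) be a minimal AF-equivalence relation on the Cantor set X, and let Y be a closed subset of X which is R-étale and R-thin. Let K = (K,S) be a compact étale equivalence relation on Y, and assume K is transverse to R|_Y. Then there is a homeomorphism h : X → X such that: (i) h × h(R ∨ K) = R, where R ∨ K is the equivalence relation on X generated by R and K — in other words, R ∨ K is orbit equivalent to R, and in particular R ∨ K is affable; (ii) h(Y) is R-étale and R-thin; (iii) h|_Y × h|_Y : (R|_Y) ∨ K → R|_{h(Y)} is a homeomorphism. -/

import Mathlib

open Set Topology MeasureTheory

universe u v

/-! ### Basic notions: étale equivalence relations -/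

/-- The set of composable pairs of an equivalence relation `R ⊆ X × X`. -/
def CompPairs {X : Type u} (R : Set (X × X)) : Set (↥R × ↥R) :=
  {q | (q.1 : X × X).2 = (q.2 : X × X).1}

/-- The topology on the set of composable pairs obtained from a topology `T` on `R`. -/
def compPairsTop {X : Type u} (R : Set (X × X)) (T : TopologicalSpace ↥R) :
    TopologicalSpace ↥(CompPairs R) :=
  letI := T; inferInstance

/-- The composition (product) map of the groupoid `R`. -/
def compMap {X : Type u} (R : Set (X × X))
    (htrans : ∀ ⦃x y z : X⦄, (x, y) ∈ R → (y, z) ∈ R → (x, z) ∈ R) :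
    ↥(CompPairs R) → ↥R := fun q =>
  ⟨((q.1.1 : X × X).1, (q.1.2 : X × X).2),
    htrans q.1.1.2 (by
      rw [show ((q.1.1 : X × X)).2 = ((q.1.2 : X × X)).1 from q.2]
      exact q.1.2.2)⟩

/-- The inverse map of the groupoid `R`. -/
def invMap {X : Type u} (R : Set (X × X))
    (hsymm : ∀ ⦃x y : X⦄, (x, y) ∈ R → (y, x) ∈ R) : ↥R → ↥R := fun p =>
  ⟨((p : X × X).2, (p : X × X).1), hsymm p.2⟩

/-- `(R, T)` is an étale equivalence relation on `X`: a countable equivalence relation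
equipped with a Hausdorff, locally compact, second countable topology `T` such that
composition of composable pairs is continuous, inversion is a homeomorphism, and the
range map `r(x,y) = x` is a local homeomorphism. -/
structure IsEtaleEquivRel {X : Type u} [TopologicalSpace X] (R : Set (X × X))
    (T : TopologicalSpace ↥R) : Prop where
  refl : ∀ x : X, (x, x) ∈ R
  symm : ∀ ⦃x y : X⦄, (x, y) ∈ R → (y, x) ∈ R
  trans : ∀ ⦃x y z : X⦄, (x, y) ∈ R → (y, z) ∈ R → (x, z) ∈ R
  countable : ∀ x : X, {y | (x, y) ∈ R}.Countable
  t2 : @T2Space ↥R T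
  locallyCompact : @LocallyCompactSpace ↥R T
  secondCountable : @SecondCountableTopology ↥R T
  continuous_comp : @Continuous _ _ (compPairsTop R T) T (compMap R trans)
  homeo_inv : @IsHomeomorph _ _ T T (invMap R symm)
  localHomeo_range : @IsLocalHomeomorph ↥R X T inferInstance fun p => (p : X × X).1

/-- A CEER: compact étale equivalence relation. -/
def IsCEER {X : Type u} [TopologicalSpace X] (R : Set (X × X))
    (T : TopologicalSpace ↥R) : Prop :=
  IsEtaleEquivRel R T ∧ @CompactSpace ↥R T

/-- `R ⊆ X × X` is an equivalence relation. -/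
def IsEquivRel {X : Type u} (R : Set (X × X)) : Prop :=
  (∀ x : X, (x, x) ∈ R) ∧ (∀ ⦃x y : X⦄, (x, y) ∈ R → (y, x) ∈ R) ∧
    (∀ ⦃x y z : X⦄, (x, y) ∈ R → (y, z) ∈ R → (x, z) ∈ R)

/-- The relative topology on `R ⊆ X × X` inherited from the product topology. -/
def relTop {X : Type u} [TopologicalSpace X] (R : Set (X × X)) : TopologicalSpace ↥R :=
  inferInstance

/-- Given a topology `T` on `R` and any `U ⊆ X × X` (intended: `U ⊆ R`), the relative
topology on `U` induced from `(R, T)`. -/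
def relSubTop {X : Type u} [TopologicalSpace X] {R : Set (X × X)}
    (T : TopologicalSpace ↥R) (U : Set (X × X)) : TopologicalSpace ↥U :=
  TopologicalSpace.induced Subtype.val
    (TopologicalSpace.coinduced (Subtype.val : ↥R → X × X) T)

/-- An equivalence relation is minimal if all equivalence classes are dense. -/
def IsMinimalRel {X : Type u} [TopologicalSpace X] (R : Set (X × X)) : Prop :=
  ∀ x : X, Dense {y | (x, y) ∈ R}

/-- `F` implements an isomorphism between the étale equivalence relations
`(R₁, T₁)` on `X` and `(R₂, T₂)` on `Z`. -/
def ImplementsIso {X : Type u} {Z : Type v} [TopologicalSpace X] [TopologicalSpace Z]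
    (R₁ : Set (X × X)) (T₁ : TopologicalSpace ↥R₁)
    (R₂ : Set (Z × Z)) (T₂ : TopologicalSpace ↥R₂) (F : X → Z) : Prop :=
  IsHomeomorph F ∧ (∀ x y : X, (x, y) ∈ R₁ ↔ (F x, F y) ∈ R₂) ∧
    ∃ G : ↥R₁ → ↥R₂, (∀ p : ↥R₁, (G p : Z × Z) = (F (p : X × X).1, F (p : X × X).2)) ∧
      @IsHomeomorph _ _ T₁ T₂ G

/-! ### Graphs, invariant measures, thin sets -/

/-- A (local) graph in `(R, T)`: a clopen subset on which both the range and source maps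
are homeomorphisms onto clopen subsets of `X`. -/
def IsGraph {X : Type u} [TopologicalSpace X] (R : Set (X × X))
    (T : TopologicalSpace ↥R) (U : Set ↥R) : Prop :=
  letI := T
  IsClopen U ∧
    IsClopen ((fun p : ↥R => (p : X × X).1) '' U) ∧
    IsClopen ((fun p : ↥R => (p : X × X).2) '' U) ∧
    Topology.IsEmbedding (fun p : ↥U => ((p : ↥R) : X × X).1) ∧
    Topology.IsEmbedding (fun p : ↥U => ((p : ↥R) : X × X).2)

/-- A probability measure is `R`-invariant when `μ(A) = μ(B)` for every graph `(A, γ, B)`. -/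
def IsInvariantMeasure {X : Type u} [TopologicalSpace X] [MeasurableSpace X]
    (R : Set (X × X)) (T : TopologicalSpace ↥R) (μ : Measure X) : Prop :=
  ∀ U : Set ↥R, IsGraph R T U →
    μ ((fun p : ↥R => (p : X × X).1) '' U) = μ ((fun p : ↥R => (p : X × X).2) '' U)

/-- `Y` is `R`-thin: `μ Y = 0` for every `R`-invariant probability measure `μ`. -/
def IsThin {X : Type u} [TopologicalSpace X] [MeasurableSpace X]
    (R : Set (X × X)) (T : TopologicalSpace ↥R) (Y : Set X) : Prop :=
  ∀ μ : Measure X, IsProbabilityMeasure μ → IsInvariantMeasure R T μ → μ Y = 0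

/-! ### AF-equivalence relations -/

/-- The inductive limit topology on `R = ⋃ n, Rseq n`, each `Rseq n` carrying its
relative topology from `X × X`. -/
def inductiveLimitTop {X : Type u} [TopologicalSpace X] (R : Set (X × X))
    (Rseq : ℕ → Set (X × X)) (hsub : ∀ n, Rseq n ⊆ R) : TopologicalSpace ↥R :=
  ⨆ n, TopologicalSpace.coinduced
    (fun p : ↥(Rseq n) => (⟨(p : X × X), hsub n p.2⟩ : ↥R)) (relTop (Rseq n))

/-- `(R, T)` is an AF-equivalence relation: the inductive limit of an ascending sequence
of CEERs `Δ_X = R₀ ⊆ R₁ ⊆ R₂ ⊆ ⋯` with each `Rₙ` open in `Rₙ₊₁`, `T` being the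
inductive limit topology. -/
def IsAFEquivRel {X : Type u} [TopologicalSpace X] (R : Set (X × X))
    (T : TopologicalSpace ↥R) : Prop :=
  ∃ (Rseq : ℕ → Set (X × X)) (hsub : ∀ n, Rseq n ⊆ R),
    Rseq 0 = Set.diagonal X ∧
    (∀ n, Rseq n ⊆ Rseq (n + 1)) ∧
    (∀ n, IsCEER (Rseq n) (relTop (Rseq n))) ∧
    (∀ n, IsOpen[relTop (Rseq (n + 1))]
      ((Subtype.val : ↥(Rseq (n + 1)) → X × X) ⁻¹' Rseq n)) ∧
    (⋃ n, Rseq n) = R ∧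
    T = inductiveLimitTop R Rseq hsub

/-! ### Clopen partitions and groupoid partitions -/

/-- `U · V` for subsets `U, V ⊆ X × X`. -/
def SetComp {X : Type u} (U V : Set (X × X)) : Set (X × X) :=
  {p | ∃ y : X, (p.1, y) ∈ U ∧ (y, p.2) ∈ V}

/-- `U⁻¹` for a subset `U ⊆ X × X`. -/
def SetInv {X : Type u} (U : Set (X × X)) : Set (X × X) :=
  {p | (p.2, p.1) ∈ U}

/-- `P` is finer than `Q` if every element of `P` is contained in some element of `Q`. -/
def FinerThan {α : Type u} (P Q : Set (Set α)) : Prop :=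
  ∀ U ∈ P, ∃ V ∈ Q, U ⊆ V

/-- A finite clopen partition of `(R, T)` by subsets of `X × X`. -/
def IsClopenPartitionRel {X : Type u} [TopologicalSpace X] (R : Set (X × X))
    (T : TopologicalSpace ↥R) (P : Set (Set (X × X))) : Prop :=
  letI := T
  P.Finite ∧ (∀ U ∈ P, U ⊆ R ∧ U.Nonempty ∧ IsClopen ((Subtype.val : ↥R → X × X) ⁻¹' U)) ∧
    P.PairwiseDisjoint id ∧ ⋃₀ P = R

/-- A finite clopen partition of a topological space `Z`. -/
def IsClopenPartitionSpace (Z : Type u) [TopologicalSpace Z] (P : Set (Set Z)) : Prop :=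
  P.Finite ∧ (∀ U ∈ P, U.Nonempty ∧ IsClopen U) ∧ P.PairwiseDisjoint id ∧ ⋃₀ P = Set.univ

/-- A groupoid partition of the CEER `(R, T)`. -/
def IsGroupoidPartition {X : Type u} [TopologicalSpace X] (R : Set (X × X))
    (T : TopologicalSpace ↥R) (P : Set (Set (X × X))) : Prop :=
  IsClopenPartitionRel R T P ∧
    (∀ U ∈ P, U ⊆ Set.diagonal X ∨ U ⊆ R \ Set.diagonal X) ∧
    (∀ U ∈ P,
      @Topology.IsEmbedding ↥U X (relSubTop T U) _ (fun p => (p : X × X).1) ∧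
      @Topology.IsEmbedding ↥U X (relSubTop T U) _ (fun p => (p : X × X).2)) ∧
    (∀ U ∈ P, U ⊆ R \ Set.diagonal X → (Prod.fst '' U) ∩ (Prod.snd '' U) = ∅) ∧
    (∀ U ∈ P, ∀ V ∈ P, SetComp U V = ∅ ∨ SetComp U V ∈ P) ∧
    (∀ U ∈ P, SetInv U ∈ P)

/-- The trace on the diagonal of a partition of `R`, viewed as a family of subsets of `X`. -/
def diagTrace {X : Type u} (P : Set (Set (X × X))) : Set (Set X) :=
  {A | ∃ U ∈ P, U ⊆ Set.diagonal X ∧ A = Prod.fst '' U}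

/-! ### Restriction to a closed subset -/

/-- The restriction `R|_Y` of `R ⊆ X × X` to `Y ⊆ X`, as a relation on `↥Y`. -/
def restrictRel {X : Type u} (R : Set (X × X)) (Y : Set X) : Set (↥Y × ↥Y) :=
  {p | ((p.1 : X), (p.2 : X)) ∈ R}

/-- The relative topology on `R|_Y` induced from `(R, T)`. -/
def restrictTop {X : Type u} [TopologicalSpace X] (R : Set (X × X))
    (T : TopologicalSpace ↥R) (Y : Set X) : TopologicalSpace ↥(restrictRel R Y) :=
  TopologicalSpace.induced
    (fun p : ↥(restrictRel R Y) => (⟨((p.1.1 : X), (p.1.2 : X)), p.2⟩ : ↥R)) T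

/-! ### Fibred products, transversality, joins -/

/-- The fibred product `R ×_X S`. -/
abbrev Fib {X : Type u} (R S : Set (X × X)) : Type u :=
  {q : ↥R × ↥S // (q.1 : X × X).2 = (q.2 : X × X).1}

/-- The range map `r((x,y),(y,z)) = x` on `R ×_X S`. -/
def fibR {X : Type u} {R S : Set (X × X)} (q : Fib R S) : X := (q.1.1 : X × X).1

/-- The source map `s((x,y),(y,z)) = z` on `R ×_X S`. -/
def fibS {X : Type u} {R S : Set (X × X)} (q : Fib R S) : X := (q.1.2 : X × X).2

/-- The relative topology on `R ×_X S` from the product of `(R, T)` and `(S, T')`. -/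
def fibTop {X : Type u} {R S : Set (X × X)} (T : TopologicalSpace ↥R)
    (T' : TopologicalSpace ↥S) : TopologicalSpace (Fib R S) :=
  letI := T; letI := T'; inferInstance

/-- `(R, T)` and `(S, T')` are transverse: `R ∩ S = Δ_X` and there is a homeomorphism
`h : R ×_X S → S ×_X R` with `r ∘ h = r` and `s ∘ h = s`. -/
def AreTransverse {X : Type u} [TopologicalSpace X] (R : Set (X × X))
    (T : TopologicalSpace ↥R) (S : Set (X × X)) (T' : TopologicalSpace ↥S) : Prop :=
  R ∩ S = Set.diagonal X ∧
    ∃ h : Fib R S → Fib S R,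
      @IsHomeomorph _ _ (fibTop T T') (fibTop T' T) h ∧
      (∀ q, fibR (h q) = fibR q) ∧ (∀ q, fibS (h q) = fibS q)

/-- The equivalence relation `R ∨ S` generated by `R` and `S`. -/
def joinRel {X : Type u} (R S : Set (X × X)) : Set (X × X) :=
  {p | Relation.EqvGen (fun a b => (a, b) ∈ R ∨ (a, b) ∈ S) p.1 p.2}

/-- The map `r × s : R ×_X S → R ∨ S`. -/
def rsFun {X : Type u} (R S : Set (X × X)) : Fib R S → ↥(joinRel R S) := fun q =>
  ⟨(fibR q, fibS q), by
    have h1 : ((q.1.1 : X × X).1, (q.1.1 : X × X).2) ∈ R := q.1.1.2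
    have h2 : ((q.1.1 : X × X).2, (q.1.2 : X × X).2) ∈ S := by
      rw [show ((q.1.1 : X × X)).2 = ((q.1.2 : X × X)).1 from q.2]
      exact q.1.2.2
    exact Relation.EqvGen.trans _ _ _ (Relation.EqvGen.rel _ _ (Or.inl h1))
      (Relation.EqvGen.rel _ _ (Or.inr h2))⟩

/-- The topology on `R ∨ S` transferred from `R ×_X S` via the bijection `r × s`. -/
def joinTop {X : Type u} [TopologicalSpace X] (R S : Set (X × X))
    (T : TopologicalSpace ↥R) (T' : TopologicalSpace ↥S) :
    TopologicalSpace ↥(joinRel R S) :=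
  TopologicalSpace.coinduced (rsFun R S) (fibTop T T')

/-- The topology on an image `f '' s` transferred from a topology on `s` via `f`. -/
def imageTop {α : Type u} {β : Type v} (s : Set α) (Ts : TopologicalSpace ↥s)
    (f : α → β) : TopologicalSpace ↥(f '' s) :=
  TopologicalSpace.coinduced (fun p : ↥s => ⟨f p.1, ⟨p.1, p.2, rfl⟩⟩) Ts
/-! ### Bratteli diagrams -/

/-- A (standard) Bratteli diagram. `V n` is the (finite, nonempty) vertex set at level `n`
(`V 0` a singleton), and `E n` is the edge set connecting level `n` to level `n + 1`
(so `E n` plays the role of `E_{n+1}` in the paper), with source map `src n : E n → V n`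
and range map `rng n : E n → V (n+1)`, both surjective. -/
structure BratteliDiagram : Type 1 where
  V : ℕ → Type
  E : ℕ → Type
  fin_V : ∀ n, Finite (V n)
  fin_E : ∀ n, Finite (E n)
  nonempty_V : ∀ n, Nonempty (V n)
  nonempty_E : ∀ n, Nonempty (E n)
  subsingleton_V0 : Subsingleton (V 0)
  src : ∀ n, E n → V n
  rng : ∀ n, E n → V (n + 1)
  src_surj : ∀ n, Function.Surjective (src n)
  rng_surj : ∀ n, Function.Surjective (rng n)

namespace BratteliDiagram

/-- The path space `X_{(V,E)}` of a Bratteli diagram. -/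
abbrev pathSpace (B : BratteliDiagram) : Type :=
  {x : ∀ n, B.E n // ∀ n, B.rng n (x n) = B.src (n + 1) (x (n + 1))}

/-- The topology on the path space: the relative topology from `∏ n, E n`
with each `E n` discrete. -/
def pathTop (B : BratteliDiagram) : TopologicalSpace B.pathSpace :=
  letI : ∀ n, TopologicalSpace (B.E n) := fun _ => ⊥
  inferInstance

/-- `AF_n(V,E)`: cofinality from level `n` on. -/
def AFn (B : BratteliDiagram) (n : ℕ) : Set (B.pathSpace × B.pathSpace) :=
  {p | ∀ m, n ≤ m → p.1.1 m = p.2.1 m}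

/-- The relative topology on `AF_n(V,E)` from `X_{(V,E)} × X_{(V,E)}`. -/
def AFnTop (B : BratteliDiagram) (n : ℕ) : TopologicalSpace ↥(B.AFn n) :=
  letI := B.pathTop
  inferInstance

/-- The cofinality relation `AF(V,E) = ⋃ n, AF_n(V,E)`. -/
def AF (B : BratteliDiagram) : Set (B.pathSpace × B.pathSpace) :=
  ⋃ n, B.AFn n

/-- The inductive limit topology on `AF(V,E)`. -/
def AFTop (B : BratteliDiagram) : TopologicalSpace ↥B.AF :=
  ⨆ n, TopologicalSpace.coinduced
    (fun p : ↥(B.AFn n) => (⟨p.1, Set.mem_iUnion.mpr ⟨n, p.2⟩⟩ : ↥B.AF)) (B.AFnTop n)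

/-- A Bratteli diagram is simple if for every level `n` there is a later level such that
every vertex at level `n` is connected by a path of edges to every vertex at that level. -/
def IsSimple (B : BratteliDiagram) : Prop :=
  ∀ n : ℕ, ∃ k : ℕ, ∀ (v : B.V n) (w : B.V (n + k + 1)),
    ∃ es : ∀ j, B.E j, B.src n (es n) = v ∧ B.rng (n + k) (es (n + k)) = w ∧
      ∀ j, n ≤ j → j + 1 ≤ n + k → B.rng j (es j) = B.src (j + 1) (es (j + 1))

end BratteliDiagram

/-- `Fs` determines an (edge) Bratteli subdiagram of `B`. -/
def IsSubdiagram (B : BratteliDiagram) (Fs : ∀ n, Set (B.E n)) : Prop :=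
  (∀ n, (Fs n).Nonempty) ∧ ∀ n, B.src (n + 1) '' Fs (n + 1) = B.rng n '' Fs n

/-- Vertex sets of the subdiagram determined by `Fs`. -/
def subVertex (B : BratteliDiagram) (Fs : ∀ n, Set (B.E n)) : ℕ → Type
  | 0 => B.V 0
  | n + 1 => ↥(B.rng n '' Fs n)

/-- The Bratteli subdiagram of `B` determined by `Fs`, as a Bratteli diagram. -/
def subdiagramB (B : BratteliDiagram) (Fs : ∀ n, Set (B.E n))
    (h : IsSubdiagram B Fs) : BratteliDiagram where
  V := subVertex B Fs
  E n := ↥(Fs n)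
  fin_V n := by
    cases n with
    | zero => exact B.fin_V 0
    | succ m => haveI := B.fin_V (m + 1); exact inferInstanceAs (Finite ↥(B.rng m '' Fs m))
  fin_E n := by haveI := B.fin_E n; exact inferInstanceAs (Finite ↥(Fs n))
  nonempty_V n := by
    cases n with
    | zero => exact B.nonempty_V 0
    | succ m =>
      obtain ⟨e, he⟩ := h.1 m
      exact ⟨⟨B.rng m e, ⟨e, he, rfl⟩⟩⟩
  nonempty_E n := by obtain ⟨e, he⟩ := h.1 n; exact ⟨⟨e, he⟩⟩
  subsingleton_V0 := B.subsingleton_V0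
  src n := match n with
    | 0 => fun e => B.src 0 e.1
    | m + 1 => fun e =>
      ⟨B.src (m + 1) e.1, by rw [← h.2 m]; exact ⟨e.1, e.2, rfl⟩⟩
  rng n := fun e => ⟨B.rng n e.1, ⟨e.1, e.2, rfl⟩⟩
  src_surj n := by
    cases n with
    | zero =>
      intro v
      haveI : Subsingleton (subVertex B Fs 0) := B.subsingleton_V0
      obtain ⟨e, he⟩ := h.1 0
      exact ⟨⟨e, he⟩, Subsingleton.elim _ _⟩
    | succ m =>
      intro v
      obtain ⟨vv, hvv⟩ := v
      rw [← h.2 m] at hvv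
      obtain ⟨e, he, hev⟩ := hvv
      exact ⟨⟨e, he⟩, Subtype.ext hev⟩
  rng_surj n := by
    intro v
    obtain ⟨vv, hv⟩ := v
    obtain ⟨e, he, hev⟩ := hv
    exact ⟨⟨e, he⟩, Subtype.ext hev⟩

/-! ### Orbit equivalence relation of a group action -/

/-- The orbit equivalence relation `R_G = {(x, g•x)}` of a group action. -/
def orbitRelSet (G : Type v) (X : Type u) [Group G] [MulAction G X] : Set (X × X) :=
  {p | ∃ g : G, p.2 = g • p.1}

/-- The topology on `R_G` transferred from the product topology on `X × G`
(`G` discrete) via the bijection `(x, g) ↦ (x, g • x)`. -/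
def orbitRelTop (G : Type v) (X : Type u) [TopologicalSpace X] [Group G] [MulAction G X] :
    TopologicalSpace ↥(orbitRelSet G X) :=
  letI : TopologicalSpace G := ⊥
  TopologicalSpace.coinduced
    (fun q : X × G => (⟨(q.1, q.2 • q.1), ⟨q.2, rfl⟩⟩ : ↥(orbitRelSet G X))) inferInstance


open Set Topology MeasureTheory

namespace Absorb
open Filter
set_option linter.all false
set_option linter.deprecated false

section Tool
variable {X : Type*} [TopologicalSpace X]

/-- A compact etale equivalence relation, in elementary terms. -/
structure IsCE (E : X → X → Prop) : Prop where
  refl : ∀ x, E x x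
  symm : ∀ {x y}, E x y → E y x
  trans : ∀ {x y z}, E x y → E y z → E x z
  clo : IsClosed {p : X × X | E p.1 p.2}
  opn : ∀ {x y} {U : Set X}, E x y → U ∈ 𝓝 y → ∀ᶠ x' in 𝓝 x, ∃ y' ∈ U, E x' y'
  inj : ∀ x, ∃ U ∈ 𝓝 x, ∀ y ∈ U, ∀ z ∈ U, E y z → y = z

theorem lc_iff {A : Type*} {f : X → A} :
    IsLocallyConstant f ↔ ∀ x, ∀ᶠ y in 𝓝 x, f y = f x := IsLocallyConstant.iff_eventually_eq f

theorem lc_clopen {A : Type*} {f : X → A} (hf : IsLocallyConstant f) (s : Set A) :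
    IsClopen (f ⁻¹' s) := ⟨⟨by
      have := hf sᶜ
      rwa [preimage_compl] at this⟩, hf s⟩

theorem lc_prod {A B : Type*} {f : X → A} {g : X → B} (hf : IsLocallyConstant f)
    (hg : IsLocallyConstant g) : IsLocallyConstant (fun x => (f x, g x)) := by
  rw [lc_iff] at *
  intro x
  filter_upwards [hf x, hg x] with y h1 h2
  rw [h1, h2]

theorem lc_comp {A B : Type*} {f : X → A} (hf : IsLocallyConstant f) (g : A → B) :
    IsLocallyConstant (fun x => g (f x)) := by
  rw [lc_iff] at *
  intro x
  filter_upwards [hf x] with y h1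
  rw [h1]

theorem lc_pre {Z A : Type*} [TopologicalSpace Z] {f : X → A} (hf : IsLocallyConstant f)
    {g : Z → X} (hg : Continuous g) : IsLocallyConstant (fun z => f (g z)) := by
  rw [lc_iff] at *
  intro x
  exact hg.continuousAt.eventually (hf (g x))

theorem lc_mem {U : Set X} (hU : IsClopen U) : IsLocallyConstant (fun x => x ∈ U) := by
  rw [lc_iff]
  intro x
  by_cases h : x ∈ U
  · filter_upwards [hU.isOpen.mem_nhds h] with y hy
    simp [h, hy]
  · filter_upwards [hU.compl.isOpen.mem_nhds h] with y hy
    simp only [mem_compl_iff] at hy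
    simp [h, hy]

theorem lc_pi {ι A : Type*} [Finite ι] {f : ι → X → A}
    (hf : ∀ i, IsLocallyConstant (f i)) : IsLocallyConstant (fun x i => f i x) := by
  rw [lc_iff]
  intro x
  have : ∀ᶠ y in 𝓝 x, ∀ i, f i y = f i x :=
    eventually_all.2 fun i => (lc_iff.1 (hf i)) x
  filter_upwards [this] with y h1
  funext i; exact h1 i

/-- indexed family of predicates supported on a finite set of indices -/
theorem lc_setOf {A : Type*} {p : A → X → Prop} {F : Set A} (hF : F.Finite)
    (hp : ∀ a x, p a x → a ∈ F) (hc : ∀ a, IsClopen {x | p a x}) :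
    IsLocallyConstant (fun x => {a | p a x}) := by
  rw [lc_iff]
  intro x
  have : ∀ᶠ y in 𝓝 x, ∀ a ∈ F, (p a y = p a x) :=
    (eventually_all_finite hF).2 fun a _ => (lc_iff.1 (lc_mem (hc a))) x
  filter_upwards [this] with y h1
  ext a
  constructor
  · intro h
    have := h1 a (hp a y h)
    exact this.mp h
  · intro h
    have := h1 a (hp a x h)
    exact this.mpr h

variable [CompactSpace X]

theorem lc_fin {A : Type*} {f : X → A} (hf : IsLocallyConstant f) : (range f).Finite :=
  hf.range_finite

theorem lc_nat {A : Type*} {f : X → A} (hf : IsLocallyConstant f) :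
    ∃ c : X → ℕ, IsLocallyConstant c ∧ ∀ x y, c x = c y ↔ f x = f y := by
  obtain ⟨g, hg⟩ := Set.countable_iff_exists_injOn.1 (lc_fin hf).countable
  refine ⟨fun x => g (f x), lc_comp hf g, fun x y => ⟨fun h => hg ⟨x, rfl⟩ ⟨y, rfl⟩ h, fun h => ?_⟩⟩
  simp [h]

variable [T2Space X] [TotallyDisconnectedSpace X]

theorem clopen_nhd {x : X} {U : Set X} (hU : U ∈ 𝓝 x) :
    ∃ W, IsClopen W ∧ x ∈ W ∧ W ⊆ U := by
  obtain ⟨O, hOU, hO, hx⟩ := mem_nhds_iff.1 hU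
  obtain ⟨W, hW, hxW, hWO⟩ := compact_exists_isClopen_in_isOpen hO hx
  exact ⟨W, hW, hxW, hWO.trans hOU⟩

theorem clopen_between {C U : Set X} (hC : IsClosed C) (hU : IsOpen U) (h : C ⊆ U) :
    ∃ W, IsClopen W ∧ C ⊆ W ∧ W ⊆ U := by
  have hc := hC.isCompact
  refine hc.induction_on (p := fun s => ∃ W, IsClopen W ∧ s ⊆ W ∧ W ⊆ U) ?_ ?_ ?_ ?_
  · exact ⟨∅, isClopen_empty, le_rfl, empty_subset _⟩
  · rintro s t hst ⟨W, h1, h2, h3⟩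
    exact ⟨W, h1, hst.trans h2, h3⟩
  · rintro s t ⟨W, h1, h2, h3⟩ ⟨W', h1', h2', h3'⟩
    exact ⟨W ∪ W', h1.union h1', union_subset_union h2 h2', union_subset h3 h3'⟩
  · intro x hx
    obtain ⟨W, h1, h2, h3⟩ := clopen_nhd (hU.mem_nhds (h hx))
    exact ⟨W, mem_nhdsWithin_of_mem_nhds (h1.isOpen.mem_nhds h2), W, h1, le_rfl, h3⟩

/-- a coloring separating any locally separated relation -/
theorem sep_of_local {E : X → X → Prop}
    (hE : ∀ x, ∃ U ∈ 𝓝 x, ∀ y ∈ U, ∀ z ∈ U, E y z → y = z) :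
    ∃ c : X → ℕ, IsLocallyConstant c ∧ ∀ x y, E x y → c x = c y → x = y := by
  have : ∀ x, ∃ W, IsClopen W ∧ x ∈ W ∧ ∀ y ∈ W, ∀ z ∈ W, E y z → y = z := by
    intro x
    obtain ⟨U, hU, h⟩ := hE x
    obtain ⟨W, h1, h2, h3⟩ := clopen_nhd hU
    exact ⟨W, h1, h2, fun y hy z hz => h y (h3 hy) z (h3 hz)⟩
  choose W h1 h2 h3 using this
  obtain ⟨t, ht⟩ := CompactSpace.elim_nhds_subcover W (fun x => (h1 x).isOpen.mem_nhds (h2 x))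
  obtain ⟨c, hc, hc'⟩ := lc_nat (lc_pi (ι := t) (f := fun i x => x ∈ W i)
    (fun i => lc_mem (h1 i)))
  refine ⟨c, hc, fun x y hxy hcxy => ?_⟩
  rw [hc'] at hcxy
  have hx : x ∈ ⋃ i ∈ t, W i := by rw [ht]; trivial
  simp only [mem_iUnion] at hx
  obtain ⟨i, hi, hxi⟩ := hx
  have := congrFun hcxy ⟨i, hi⟩
  simp only [eq_iff_iff] at this
  exact h3 i x hxi y (this.1 hxi) hxy

theorem IsCE.sep {E : X → X → Prop} (hE : IsCE E) :
    ∃ c : X → ℕ, IsLocallyConstant c ∧ ∀ x y, E x y → c x = c y → x = y := sep_of_local hE.inj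

/-- The saturation of a clopen set is clopen. -/
theorem IsCE.sat {E : X → X → Prop} (hE : IsCE E) {A : Set X} (hA : IsClopen A) :
    IsClopen {x | ∃ y ∈ A, E x y} := by
  constructor
  · have : {x | ∃ y ∈ A, E x y} = Prod.fst '' ({p : X × X | E p.1 p.2} ∩ (univ ×ˢ A)) := by
      ext x
      constructor
      · rintro ⟨y, hy, h⟩
        exact ⟨(x, y), ⟨h, trivial, hy⟩, rfl⟩
      · rintro ⟨⟨x', y⟩, ⟨h, -, hy⟩, rfl⟩
        exact ⟨y, hy, h⟩
    rw [this]
    exact ((hE.clo.inter (isClosed_univ.prod hA.isClosed)).isCompact.image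
      continuous_fst).isClosed
  · rw [isOpen_iff_mem_nhds]
    rintro x ⟨y, hy, h⟩
    exact hE.opn h (hA.isOpen.mem_nhds hy)

theorem IsCE.satClosed {E : X → X → Prop} (hE : IsCE E) {A : Set X} (hA : IsClosed A) :
    IsClosed {x | ∃ y ∈ A, E x y} := by
  have : {x | ∃ y ∈ A, E x y} = Prod.fst '' ({p : X × X | E p.1 p.2} ∩ (univ ×ˢ A)) := by
    ext x
    constructor
    · rintro ⟨y, hy, h⟩
      exact ⟨(x, y), ⟨h, trivial, hy⟩, rfl⟩
    · rintro ⟨⟨x', y⟩, ⟨h, -, hy⟩, rfl⟩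
      exact ⟨y, hy, h⟩
  rw [this]
  exact ((hE.clo.inter (isClosed_univ.prod hA)).isCompact.image
    continuous_fst).isClosed

theorem IsCE.finite {E : X → X → Prop} (hE : IsCE E) : ∃ D : ℕ, ∀ x, {y | E x y}.Finite ∧
    {y | E x y}.ncard ≤ D := by
  obtain ⟨c, hc, hs⟩ := hE.sep
  refine ⟨(range c).ncard, fun x => ?_⟩
  have hi : InjOn c {y | E x y} := fun y hy z hz h => hs y z (hE.trans (hE.symm hy) hz) h
  have hm : MapsTo c {y | E x y} (range c) := fun y _ => ⟨y, rfl⟩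
  exact ⟨Set.Finite.of_injOn hm hi (lc_fin hc), ncard_le_ncard_of_injOn c hm hi (lc_fin hc)⟩

theorem IsCE.fin {E : X → X → Prop} (hE : IsCE E) (x : X) : {y | E x y}.Finite :=
  (hE.finite.choose_spec x).1

theorem IsCE.cls {E : X → X → Prop} (hE : IsCE E) {x y : X} (h : E x y) (z : X) :
    E x z ↔ E y z := ⟨fun h' => hE.trans (hE.symm h) h', fun h' => hE.trans h h'⟩

/-- Continuity of selections. -/
theorem IsCE.sel {E : X → X → Prop} (hE : IsCE E) {A : Type*} {c : X → A}
    (hc : IsLocallyConstant c) (hs : ∀ x y, E x y → c x = c y → x = y)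
    {Z : Type*} [TopologicalSpace Z] {g φ : Z → X} {S : Set Z} {z : Z} (hz : z ∈ S)
    (hg : ContinuousWithinAt g S z) (hgφ : ∀ z ∈ S, E (g z) (φ z))
    (hφ : ∀ᶠ z' in 𝓝[S] z, c (φ z') = c (φ z)) : ContinuousWithinAt φ S z := by
  intro U hU
  have h1 : U ∩ {y | c y = c (φ z)} ∈ 𝓝 (φ z) := inter_mem hU (lc_iff.1 hc _)
  have h2 := hg.eventually (hE.opn (hgφ z hz) h1)
  rw [mem_map]
  filter_upwards [h2, hφ, self_mem_nhdsWithin] with z' h3 h4 h5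
  obtain ⟨y', ⟨hy1, hy2⟩, hy3⟩ := h3
  have : φ z' = y' := hs _ _ (hE.trans (hE.symm (hgφ z' h5)) hy3) (by rw [h4]; exact hy2.symm)
  simp only [mem_preimage, this, hy1]

/-- Color sub-relation. -/
theorem IsCE.color {E : X → X → Prop} (hE : IsCE E) {A : Type*} {c : X → A}
    (hc : IsLocallyConstant c) (J : A → A → Prop) (hr : ∀ x, J (c x) (c x))
    (hsy : ∀ x y, E x y → J (c x) (c y) → J (c y) (c x))
    (htr : ∀ x y z, E x y → E y z → J (c x) (c y) → J (c y) (c z) → J (c x) (c z)) :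
    IsCE (fun x y => E x y ∧ J (c x) (c y)) where
  refl x := ⟨hE.refl x, hr x⟩
  symm h := ⟨hE.symm h.1, hsy _ _ h.1 h.2⟩
  trans h h' := ⟨hE.trans h.1 h'.1, htr _ _ _ h.1 h'.1 h.2 h'.2⟩
  clo := by
    have h1 : IsLocallyConstant (fun p : X × X => (c p.1, c p.2)) :=
      lc_prod (lc_pre hc continuous_fst) (lc_pre hc continuous_snd)
    exact hE.clo.inter (lc_clopen h1 {q | J q.1 q.2}).isClosed
  opn := by
    intro x y U h hU
    filter_upwards [hE.opn h.1 (inter_mem hU (lc_iff.1 hc y)), lc_iff.1 hc x] with x' h1 h2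
    obtain ⟨y', ⟨h3, h4⟩, h5⟩ := h1
    refine ⟨y', h3, h5, ?_⟩
    simp only [mem_setOf_eq] at h4
    rw [h4, h2]; exact h.2
  inj x := by
    obtain ⟨U, hU, h⟩ := hE.inj x
    exact ⟨U, hU, fun y hy z hz hyz => h y hy z hz hyz.1⟩

theorem IsCE.colorEq {E : X → X → Prop} (hE : IsCE E) {A : Type*} {c : X → A}
    (hc : IsLocallyConstant c) : IsCE (fun x y => E x y ∧ c x = c y) :=
  hE.color hc (fun a b => a = b) (fun _ => rfl) (fun _ _ _ h => h.symm)
    (fun _ _ _ _ _ h h' => h.trans h')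

theorem isCE_eq : IsCE (fun x y : X => x = y) where
  refl _ := rfl
  symm h := h.symm
  trans h h' := h.trans h'
  clo := isClosed_eq continuous_fst continuous_snd
  opn := by
    intro x y U h hU
    subst h
    filter_upwards [hU] with x' hx'
    exact ⟨x', hx', rfl⟩
  inj x := ⟨univ, univ_mem, fun _ _ _ _ h => h⟩

/-- Extending a locally constant function from the image of an injective continuous map. -/
theorem lc_extend {V : Type*} [TopologicalSpace V] [CompactSpace V] {s : V → X}
    (hs : Continuous s) (hsi : Function.Injective s) {f : V → ℕ} (hf : IsLocallyConstant f) :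
    ∃ κ : X → ℕ, IsLocallyConstant κ ∧ ∀ v, κ (s v) = f v := by
  have key : ∀ i : ℕ, ∃ W : Set X, IsClopen W ∧ s '' (f ⁻¹' {i}) ⊆ W ∧
      W ⊆ (s '' (f ⁻¹' {i}ᶜ))ᶜ := by
    intro i
    have h1 : IsClosed (s '' (f ⁻¹' {i})) :=
      ((lc_clopen hf _).isClosed.isCompact.image hs).isClosed
    have h2 : IsClosed (s '' (f ⁻¹' {i}ᶜ)) :=
      ((lc_clopen hf _).isClosed.isCompact.image hs).isClosed
    refine clopen_between h1 h2.isOpen_compl ?_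
    rintro _ ⟨v, hv, rfl⟩ ⟨w, hw, hvw⟩
    rw [hsi hvw] at hw
    exact hw hv
  choose W h1 h2 h3 using key
  have hl : IsLocallyConstant (fun x => {i | i ∈ range f ∧ x ∈ W i}) := by
    refine lc_setOf (lc_fin hf) (fun a x h => h.1) (fun a => ?_)
    by_cases ha : a ∈ range f
    · simpa [ha] using h1 a
    · have : {x | a ∈ range f ∧ x ∈ W a} = ∅ := by
        ext x; simp only [mem_setOf_eq, mem_empty_iff_false, iff_false]; tauto
      rw [this]; exact isClopen_empty
  refine ⟨fun x => sInf {i | i ∈ range f ∧ x ∈ W i}, lc_comp hl sInf, fun v => ?_⟩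
  have : {i | i ∈ range f ∧ s v ∈ W i} = {f v} := by
    ext i
    constructor
    · rintro ⟨-, hi⟩
      by_contra hne
      exact h3 i hi ⟨v, fun h => hne h.symm, rfl⟩
    · rintro rfl
      exact ⟨⟨v, rfl⟩, h2 _ ⟨v, rfl, rfl⟩⟩
  show sInf {i | i ∈ range f ∧ s v ∈ W i} = f v
  rw [this, csInf_singleton]

/-- Homogeneous colorings. -/
theorem IsCE.homog {E : X → X → Prop} (hE : IsCE E) {I : Type*} [Finite I]
    {F : I → X → X → Prop} (hF : ∀ i, IsCE (F i)) (hFE : ∀ i x y, F i x y → E x y)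
    {A : Type*} {a : X → A} (ha : IsLocallyConstant a) :
    ∃ c : X → ℕ, IsLocallyConstant c ∧ (∀ x y, c x = c y → a x = a y) ∧
      (∀ x y, E x y → c x = c y → x = y) ∧
      ∀ x x' y, c x = c x' → E x y → ∃ y', E x' y' ∧ c y' = c y ∧ ∀ i, F i x y ↔ F i x' y' := by
  obtain ⟨c1, hc1, hs1⟩ := hE.sep
  obtain ⟨c0, hc0, h0⟩ := lc_nat (lc_prod hc1 ha)
  have hs0 : ∀ x y, E x y → c0 x = c0 y → x = y := by
    intro x y hxy h
    have := (h0 x y).1 h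
    exact hs1 x y hxy (congrArg Prod.fst this)
  have ha0 : ∀ x y, c0 x = c0 y → a x = a y := fun x y h => congrArg Prod.snd ((h0 x y).1 h)
  let f1 : X → Set ℕ := fun x => {i | ∃ y ∈ c0 ⁻¹' {i}, E x y}
  have hf1 : IsLocallyConstant f1 := by
    refine lc_setOf (lc_fin hc0) ?_ (fun i => hE.sat (lc_clopen hc0 _))
    rintro i x ⟨y, rfl, -⟩
    exact ⟨y, rfl⟩
  let f2 : I → X → Set (ℕ × ℕ) := fun i x =>
    {p | ∃ y ∈ (c0 ⁻¹' {p.1} ∩ {y | ∃ z ∈ c0 ⁻¹' {p.2}, F i y z}), E x y}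
  have hf2 : ∀ i, IsLocallyConstant (f2 i) := by
    intro i
    refine lc_setOf ((lc_fin hc0).prod (lc_fin hc0)) ?_ (fun p => hE.sat ?_)
    · rintro p x ⟨y, ⟨h1, z, h2, -⟩, -⟩
      exact ⟨⟨y, h1⟩, ⟨z, h2⟩⟩
    · refine (lc_clopen hc0 _).inter ?_
      exact (hF i).sat (lc_clopen hc0 _)
  obtain ⟨c, hc, h⟩ := lc_nat (lc_prod hc0 (lc_prod hf1 (lc_pi hf2)))
  have hf1E : ∀ x y, E x y → f1 x = f1 y := by
    intro x y hxy
    ext i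
    constructor <;> rintro ⟨z, hz, h⟩
    · exact ⟨z, hz, hE.trans (hE.symm hxy) h⟩
    · exact ⟨z, hz, hE.trans hxy h⟩
  have hf2E : ∀ i x y, E x y → f2 i x = f2 i y := by
    intro i x y hxy
    ext p
    constructor <;> rintro ⟨z, hz, h⟩
    · exact ⟨z, hz, hE.trans (hE.symm hxy) h⟩
    · exact ⟨z, hz, hE.trans hxy h⟩
  have hcc : ∀ x y, c x = c y → c0 x = c0 y ∧ f1 x = f1 y ∧ ∀ i, f2 i x = f2 i y := by
    intro x y hxy
    have := (h x y).1 hxy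
    simp only [Prod.mk.injEq] at this
    exact ⟨this.1, this.2.1, fun i => congrFun this.2.2 i⟩
  refine ⟨c, hc, fun x y hxy => ha0 x y (hcc x y hxy).1,
    fun x y hE hxy => hs0 x y hE (hcc x y hxy).1, ?_⟩
  intro x x' y hxx' hxy
  obtain ⟨h1, h2, h3⟩ := hcc x x' hxx'
  have hy : c0 y ∈ f1 x := ⟨y, rfl, hxy⟩
  rw [h2] at hy
  obtain ⟨y', hy1, hy2⟩ := hy
  refine ⟨y', hy2, ?_, ?_⟩
  · rw [h]
    simp only [Prod.mk.injEq]
    refine ⟨hy1, ?_, ?_⟩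
    · rw [← hf1E _ _ hy2, ← hf1E _ _ hxy, h2]
    · funext i
      rw [← hf2E i _ _ hy2, ← hf2E i _ _ hxy, h3]
  · intro i
    have e : ∀ u w, E u w → (F i u w ↔ (c0 u, c0 w) ∈ f2 i u) := by
      intro u w huw
      constructor
      · intro hF
        exact ⟨u, ⟨rfl, w, rfl, hF⟩, hE.refl u⟩
      · rintro ⟨u', ⟨h4, w', h5, h6⟩, h7⟩
        have e1 : u' = u := hs0 _ _ (hE.symm h7) h4
        subst e1
        have e2 : w' = w := hs0 _ _ (hE.trans (hE.symm (hFE i _ _ h6)) huw) h5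
        subst e2
        exact h6
    rw [e x y hxy, e x' y' hy2, h3 i, h1]
    have : c0 y' = c0 y := hy1
    rw [this]

/-- Matching. -/
theorem IsCE.match' {E : X → X → Prop} (hE : IsCE E) {A B : Set X} (hA : IsClopen A)
    (hB : IsClopen B)
    (h : ∀ x, ({y | E x y} ∩ A).ncard ≤ ({y | E x y} ∩ B).ncard) :
    ∃ φ : X → X, ContinuousOn φ A ∧ InjOn φ A ∧ MapsTo φ A B ∧ ∀ x ∈ A, E x (φ x) := by
  obtain ⟨c, hc, hAB, hs, hh⟩ := hE.homog (I := Empty) (F := fun i => i.elim)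
    (fun i => i.elim) (fun i => i.elim) (lc_prod (lc_mem hA) (lc_mem hB))
  let C : X → Set ℕ := fun x => {i | ∃ y ∈ c ⁻¹' {i}, E x y}
  have hC : IsLocallyConstant C := by
    refine lc_setOf (lc_fin hc) ?_ (fun i => hE.sat (lc_clopen hc _))
    rintro i x ⟨y, rfl, -⟩
    exact ⟨y, rfl⟩
  have hCE : ∀ x y, E x y → C x = C y := by
    intro x y hxy
    ext i
    constructor <;> rintro ⟨z, hz, h⟩
    · exact ⟨z, hz, hE.trans (hE.symm hxy) h⟩
    · exact ⟨z, hz, hE.trans hxy h⟩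
  have hmA : ∀ x y, c x = c y → x ∈ A → y ∈ A := by
    intro x y hxy hx
    have := congrArg Prod.fst (hAB x y hxy)
    exact this.mp hx
  have hmB : ∀ x y, c x = c y → x ∈ B → y ∈ B := by
    intro x y hxy hx
    have := congrArg Prod.snd (hAB x y hxy)
    exact this.mp hx
  have hinj : ∀ x, InjOn c {y | E x y} :=
    fun x y hy z hz h => hs y z (hE.trans (hE.symm hy) hz) h
  have hCA : ∀ x, C x ∩ c '' A = c '' ({y | E x y} ∩ A) := by
    intro x
    ext i
    constructor
    · rintro ⟨⟨y, hy, hxy⟩, z, hz, hzi⟩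
      exact ⟨y, ⟨hxy, hmA z y (hzi.trans hy.symm) hz⟩, hy⟩
    · rintro ⟨y, ⟨hy, hyA⟩, rfl⟩
      exact ⟨⟨y, rfl, hy⟩, y, hyA, rfl⟩
  have hCB : ∀ x, C x ∩ c '' B = c '' ({y | E x y} ∩ B) := by
    intro x
    ext i
    constructor
    · rintro ⟨⟨y, hy, hxy⟩, z, hz, hzi⟩
      exact ⟨y, ⟨hxy, hmB z y (hzi.trans hy.symm) hz⟩, hy⟩
    · rintro ⟨y, ⟨hy, hyA⟩, rfl⟩
      exact ⟨⟨y, rfl, hy⟩, y, hyA, rfl⟩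
  have key : ∀ s : Set ℕ, ∃ g : ℕ → ℕ, (∃ x, C x = s) →
      MapsTo g (s ∩ c '' A) (s ∩ c '' B) ∧ InjOn g (s ∩ c '' A) := by
    intro s
    by_cases hx : ∃ x, C x = s
    · obtain ⟨x, rfl⟩ := hx
      have hfA : (C x ∩ c '' A).Finite := by
        rw [hCA]; exact ((hE.fin x).inter_of_left _).image _
      have hfB : (C x ∩ c '' B).Finite := by
        rw [hCB]; exact ((hE.fin x).inter_of_left _).image _
      have hle : (C x ∩ c '' A).encard ≤ (C x ∩ c '' B).encard := by
        rw [hCA, hCB, InjOn.encard_image ((hinj x).mono inter_subset_left),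
          InjOn.encard_image ((hinj x).mono inter_subset_left),
          ← ((hE.fin x).inter_of_left A).cast_ncard_eq, ← ((hE.fin x).inter_of_left B).cast_ncard_eq]
        exact_mod_cast h x
      obtain ⟨g, hg1, hg2⟩ := hfA.exists_injOn_of_encard_le hle
      exact ⟨g, fun _ => ⟨fun y hy => hg1 hy, hg2⟩⟩
    · exact ⟨id, fun h => absurd h hx⟩
  choose g hg using key
  have hφ : ∀ x, ∃ y, x ∈ A → (E x y ∧ c y = g (C x) (c x) ∧ y ∈ B) := by
    intro x
    by_cases hx : x ∈ A
    · have := (hg (C x) ⟨x, rfl⟩).1 (x := c x) ⟨⟨x, rfl, hE.refl x⟩, x, hx, rfl⟩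
      rw [hCB] at this
      obtain ⟨y, ⟨h1, h2⟩, h3⟩ := this
      exact ⟨y, fun _ => ⟨h1, h3, h2⟩⟩
    · exact ⟨x, fun h => absurd h hx⟩
  choose φ hφ using hφ
  refine ⟨φ, ?_, ?_, fun x hx => (hφ x hx).2.2, fun x hx => (hφ x hx).1⟩
  · intro x hx
    refine hE.sel hc hs hx continuousWithinAt_id (fun z hz => (hφ z hz).1) ?_
    have h1 := (lc_iff.1 hC x).filter_mono (nhdsWithin_le_nhds (s := A))
    have h2 := (lc_iff.1 hc x).filter_mono (nhdsWithin_le_nhds (s := A))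
    filter_upwards [h1, h2, self_mem_nhdsWithin] with z h3 h4 h5
    rw [(hφ z h5).2.1, (hφ x hx).2.1]
    rw [h3, h4]
  · intro x hx y hy hxy
    obtain ⟨h1, h2, -⟩ := hφ x hx
    obtain ⟨h3, h4, -⟩ := hφ y hy
    have hE' : E x y := hE.trans h1 (by rw [hxy]; exact hE.symm h3)
    have hCxy := hCE x y hE'
    refine hs x y hE' ?_
    refine (hg (C x) ⟨x, rfl⟩).2 ⟨⟨x, rfl, hE.refl x⟩, x, hx, rfl⟩
      ⟨⟨y, rfl, hE'⟩, y, hy, rfl⟩ ?_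
    rw [← h2, hxy, h4, hCxy]

/-- homeomorphism from fibrewise injective continuous map -/
theorem IsCE.homeo {E : X → X → Prop} (hE : IsCE E) {η : X → X} (h1 : Continuous η)
    (h2 : Function.Injective η) (h3 : ∀ x, E x (η x)) :
    ∃ η' : X ≃ₜ X, ∀ x, η' x = η x := by
  have hsurj : Function.Surjective η := by
    intro y
    have hm : MapsTo η {z | E y z} {z | E y z} := fun z hz => hE.trans hz (h3 z)
    have := (hE.fin y)
    have hs := (this.injOn_iff_bijOn_of_mapsTo hm).1 h2.injOn
    obtain ⟨x, -, hx⟩ := hs.surjOn (hE.refl y)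
    exact ⟨x, hx⟩
  let e := Equiv.ofBijective η ⟨h2, hsurj⟩
  exact ⟨Continuous.homeoOfEquivCompactToT2 (f := e) h1, fun x => rfl⟩

theorem IsCE.lemmaC {E : X → X → Prop} (hE : IsCE E) {V : Type*} [TopologicalSpace V]
    [CompactSpace V] {s t : V → X} (hs : Continuous s) (hsi : Function.Injective s)
    (ht : Continuous t) (hti : Function.Injective t) (hst : ∀ v, E (s v) (t v)) :
    ∃ η : X ≃ₜ X, (∀ v, η (s v) = t v) ∧ ∀ x, E x (η x) := by
  obtain ⟨c, hc, hsep⟩ := hE.sep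
  obtain ⟨κ, hκ, hκs⟩ := lc_extend hs hsi (lc_pre hc ht)
  have hW : ∃ W : Set X, IsClopen W ∧ ∀ x, x ∈ W ↔ ∃ y, E x y ∧ c y = κ x := by
    have h1 : IsLocallyConstant (fun x => {i | ∃ y ∈ c ⁻¹' {i}, E x y}) := by
      refine lc_setOf (lc_fin hc) ?_ (fun i => hE.sat (lc_clopen hc _))
      rintro i x ⟨y, rfl, -⟩
      exact ⟨y, rfl⟩
    have h2 := lc_clopen (lc_prod hκ h1) {p | p.1 ∈ p.2}
    refine ⟨_, h2, fun x => ?_⟩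
    constructor
    · rintro ⟨y, h3, h4⟩
      exact ⟨y, h4, h3⟩
    · rintro ⟨y, h3, h4⟩
      exact ⟨y, h4, h3⟩
  obtain ⟨W, hWc, hW⟩ := hW
  have hψ : ∀ x, ∃ y, x ∈ W → (E x y ∧ c y = κ x) := by
    intro x
    by_cases hx : x ∈ W
    · obtain ⟨y, hy⟩ := (hW x).1 hx
      exact ⟨y, fun _ => hy⟩
    · exact ⟨x, fun h => absurd h hx⟩
  choose ψ hψ using hψ
  have hψc : ContinuousOn ψ W := by
    intro x hx
    refine hE.sel hc hsep hx continuousWithinAt_id (fun z hz => (hψ z hz).1) ?_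
    filter_upwards [(lc_iff.1 hκ x).filter_mono nhdsWithin_le_nhds, self_mem_nhdsWithin] with z h3 h5
    rw [(hψ z h5).2, (hψ x hx).2, h3]
  have hsW : ∀ v, s v ∈ W := fun v => (hW _).2 ⟨t v, hst v, (hκs v).symm⟩
  have hψs : ∀ v, ψ (s v) = t v := by
    intro v
    obtain ⟨h1, h2⟩ := hψ (s v) (hsW v)
    exact hsep _ _ (hE.trans (hE.symm h1) (hst v)) (by rw [h2, hκs])
  -- injectivity nbhd
  have hO : ∃ O : Set X, IsClopen O ∧ range s ⊆ O ∧ O ⊆ W ∧ InjOn ψ O := by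
    have hcs : IsCompact (range s) := isCompact_range hs
    have hop : IsOpen ((W ×ˢ W) ∩ {p : X × X | ψ p.1 ≠ ψ p.2 ∨ c p.1 = c p.2}) := by
      have h1 : IsOpen (W ×ˢ W) := hWc.isOpen.prod hWc.isOpen
      have hcc : IsClopen {p : X × X | c p.1 = c p.2} :=
        lc_clopen (lc_prod (lc_pre hc continuous_fst) (lc_pre hc continuous_snd)) {q | q.1 = q.2}
      have h2 : IsOpen ((W ×ˢ W) ∩ (fun p : X × X => (ψ p.1, ψ p.2)) ⁻¹' {q | q.1 ≠ q.2}) := by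
        refine ContinuousOn.isOpen_inter_preimage ?_ h1
          (isClosed_eq continuous_fst continuous_snd).isOpen_compl
        exact (hψc.comp continuousOn_fst (fun p hp => hp.1)).prodMk
          (hψc.comp continuousOn_snd (fun p hp => hp.2))
      have : ((W ×ˢ W) ∩ {p : X × X | ψ p.1 ≠ ψ p.2 ∨ c p.1 = c p.2}) =
        ((W ×ˢ W) ∩ (fun p : X × X => (ψ p.1, ψ p.2)) ⁻¹' {q | q.1 ≠ q.2}) ∪
        ((W ×ˢ W) ∩ {p : X × X | c p.1 = c p.2}) := by
        rw [← inter_union_distrib_left]; rfl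
      rw [this]
      exact h2.union (h1.inter hcc.isOpen)
    have hsub : range s ×ˢ range s ⊆
        ((W ×ˢ W) ∩ {p : X × X | ψ p.1 ≠ ψ p.2 ∨ c p.1 = c p.2}) := by
      rintro ⟨_, _⟩ ⟨⟨v, rfl⟩, ⟨w, rfl⟩⟩
      refine ⟨⟨hsW v, hsW w⟩, ?_⟩
      by_cases h : v = w
      · right; simp [h]
      · left
        simp only [hψs]
        exact fun h' => h (hti h')
    obtain ⟨u, u', hu, hu', hsu, hsu', hsub'⟩ := generalized_tube_lemma hcs hcs hop hsub
    obtain ⟨O, hO1, hO2, hO3⟩ := clopen_between hcs.isClosed (hu.inter hu')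
      (subset_inter hsu hsu')
    refine ⟨O, hO1, hO2, fun x hx => (hsub' (a := (x, x)) ⟨(hO3 hx).1, (hO3 hx).2⟩).1.1, ?_⟩
    intro x hx y hy hxy
    have h1 := hsub' (a := (x, y)) ⟨(hO3 hx).1, (hO3 hy).2⟩
    have h2 := h1.2.resolve_left (fun h => h hxy)
    have e1 := (hψ x h1.1.1).1
    have e2 := (hψ y h1.1.2).1
    exact hsep x y (hE.trans e1 (by rw [hxy]; exact hE.symm e2)) h2
  obtain ⟨O, hOc, hsO, hOW, hOi⟩ := hO
  have hψO : IsClopen (ψ '' O) := by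
    have : ψ '' O = ⋃ i ∈ range κ, (c ⁻¹' {i} ∩ {y | ∃ x ∈ O ∩ κ ⁻¹' {i}, E y x}) := by
      ext y
      simp only [mem_iUnion, mem_image]
      constructor
      · rintro ⟨x, hx, rfl⟩
        exact ⟨κ x, ⟨x, rfl⟩, (hψ x (hOW hx)).2, x, ⟨hx, rfl⟩, hE.symm (hψ x (hOW hx)).1⟩
      · rintro ⟨i, -, hy, x, ⟨hx, hxi⟩, hyx⟩
        refine ⟨x, hx, ?_⟩
        obtain ⟨h1, h2⟩ := hψ x (hOW hx)
        refine hsep _ _ (hE.trans (hE.symm h1) (hE.symm hyx)) ?_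
        rw [h2, hxi, hy]
    rw [this]
    exact (lc_fin hκ).isClopen_biUnion fun i _ => (lc_clopen hc _).inter
      (hE.sat (hOc.inter (lc_clopen hκ _)))
  have hcount : ∀ x, ({y | E x y} ∩ Oᶜ).ncard ≤ ({y | E x y} ∩ (ψ '' O)ᶜ).ncard := by
    intro x
    have e : {y | E x y} ∩ ψ '' O = ψ '' ({y | E x y} ∩ O) := by
      ext y
      constructor
      · rintro ⟨h1, z, hz, rfl⟩
        exact ⟨z, ⟨hE.trans h1 (hE.symm (hψ z (hOW hz)).1), hz⟩, rfl⟩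
      · rintro ⟨z, ⟨h1, hz⟩, rfl⟩
        exact ⟨hE.trans h1 (hψ z (hOW hz)).1, z, hz, rfl⟩
    have h1 := ncard_inter_add_ncard_diff_eq_ncard {y | E x y} O (hE.fin x)
    have h2 := ncard_inter_add_ncard_diff_eq_ncard {y | E x y} (ψ '' O) (hE.fin x)
    rw [e, ncard_image_of_injOn (hOi.mono inter_subset_right)] at h2
    rw [← diff_eq, ← diff_eq]
    omega
  obtain ⟨φ, hφ1, hφ2, hφ3, hφ4⟩ := hE.match' hOc.compl hψO.compl hcount
  classical
  let η : X → X := O.piecewise ψ φ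
  have hηO : ∀ x ∈ O, η x = ψ x := fun x hx => piecewise_eq_of_mem _ _ _ hx
  have hηO' : ∀ x ∉ O, η x = φ x := fun x hx => piecewise_eq_of_notMem _ _ _ hx
  have hη1 : Continuous η := by
    rw [continuous_iff_continuousAt]
    intro x
    by_cases hx : x ∈ O
    · have h1 : ContinuousAt ψ x := (hψc.mono hOW).continuousAt (hOc.isOpen.mem_nhds hx)
      refine h1.congr ?_
      filter_upwards [hOc.isOpen.mem_nhds hx] with z hz using (hηO z hz).symm
    · have h1 : ContinuousAt φ x := hφ1.continuousAt (hOc.compl.isOpen.mem_nhds hx)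
      refine h1.congr ?_
      filter_upwards [hOc.compl.isOpen.mem_nhds hx] with z hz using (hηO' z hz).symm
  have hη2 : Function.Injective η := by
    intro x y hxy
    by_cases hx : x ∈ O <;> by_cases hy : y ∈ O
    · rw [hηO x hx, hηO y hy] at hxy; exact hOi hx hy hxy
    · rw [hηO x hx, hηO' y hy] at hxy
      exact absurd ⟨x, hx, hxy⟩ (hφ3 hy)
    · rw [hηO' x hx, hηO y hy] at hxy
      exact absurd ⟨y, hy, hxy.symm⟩ (hφ3 hx)
    · rw [hηO' x hx, hηO' y hy] at hxy; exact hφ2 hx hy hxy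
  have hη3 : ∀ x, E x (η x) := by
    intro x
    by_cases hx : x ∈ O
    · rw [hηO x hx]; exact (hψ x (hOW hx)).1
    · rw [hηO' x hx]; exact hφ4 x hx
  obtain ⟨η', hη'⟩ := hE.homeo hη1 hη2 hη3
  refine ⟨η', fun v => ?_, fun x => by rw [hη']; exact hη3 x⟩
  rw [hη', hηO _ (hsO ⟨v, rfl⟩), hψs]

end Tool

section Comb
variable {X : Type*}

/-- summing a per-class inequality over a finite invariant set -/
theorem sum_classes {E : X → X → Prop} (hE : Equivalence E) {S U B : Set X} (hS : S.Finite)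
    (hinv : ∀ x ∈ S, ∀ y, E x y → y ∈ S) {N : ℕ}
    (h : ∀ x ∈ S, N * ({y | E x y} ∩ U).ncard ≤ ({y | E x y} ∩ B).ncard) :
    N * (S ∩ U).ncard ≤ (S ∩ B).ncard := by
  classical
  have hcl : ∀ x y, E x y ↔ {z | E x z} = {z | E y z} := by
    intro x y
    constructor
    · intro h; ext z
      exact ⟨fun h' => hE.trans (hE.symm h) h', fun h' => hE.trans h h'⟩
    · intro h
      have : y ∈ {z | E y z} := hE.refl y
      rw [← h] at this; exact this
  have key : ∀ A : Set X, (S ∩ A).ncard =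
      ∑ C ∈ hS.toFinset.image (fun x => {z | E x z}), (C ∩ A).ncard := by
    intro A
    have hf : (S ∩ A).Finite := hS.inter_of_left A
    rw [ncard_eq_toFinset_card _ hf]
    rw [Finset.card_eq_sum_card_fiberwise (f := fun x => {z | E x z})
      (t := hS.toFinset.image (fun x => {z | E x z}))]
    · refine Finset.sum_congr rfl fun C hC => ?_
      simp only [Finset.mem_image, Finite.mem_toFinset] at hC
      obtain ⟨x, hx, rfl⟩ := hC
      rw [← ncard_coe_finset]
      congr 1
      ext y
      simp only [Finset.coe_filter, Finite.mem_toFinset, mem_setOf_eq, mem_inter_iff]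
      constructor
      · rintro ⟨⟨h1, h2⟩, h3⟩
        exact ⟨(hcl _ _).2 h3.symm, h2⟩
      · rintro ⟨h1, h2⟩
        exact ⟨⟨hinv x hx y h1, h2⟩, ((hcl _ _).1 h1).symm⟩
    · intro x hx
      simp only [Finite.coe_toFinset, mem_inter_iff] at hx
      simp only [Finset.coe_image, Finite.coe_toFinset, mem_image]
      exact ⟨x, hx.1, rfl⟩
  rw [key U, key B, Finset.mul_sum]
  refine Finset.sum_le_sum fun C hC => ?_
  simp only [Finset.mem_image, Finite.mem_toFinset] at hC
  obtain ⟨x, hx, rfl⟩ := hC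
  exact h x hx

theorem pick {E : X → X → Prop} (hE : Equivalence E) (hf : ∀ x, {y | E x y}.Finite)
    {ι : Type*} [Finite ι] {S : ι → Set X} (hS : ∀ i, (S i).Infinite) :
    ∃ g : ι → X, (∀ i, g i ∈ S i) ∧ ∀ i j, i ≠ j → ¬ E (g i) (g j) := by
  classical
  haveI := Fintype.ofFinite ι
  have key : ∀ t : Finset ι, ∃ g : ι → X, (∀ i, g i ∈ S i) ∧
      ∀ i ∈ t, ∀ j ∈ t, i ≠ j → ¬ E (g i) (g j) := by
    intro t
    induction t using Finset.induction_on with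
    | empty =>
      refine ⟨fun i => (hS i).nonempty.choose, fun i => (hS i).nonempty.choose_spec, ?_⟩
      simp
    | insert a t ha ih =>
      obtain ⟨g, h1, h2⟩ := ih
      have hfin : (⋃ i ∈ t, {y | E (g i) y}).Finite :=
        t.finite_toSet.biUnion fun i _ => hf _
      obtain ⟨x, hx, hx'⟩ := (hS a).exists_notMem_finite hfin
      simp only [mem_iUnion, not_exists] at hx'
      refine ⟨Function.update g a x, ?_, ?_⟩
      · intro i
        by_cases h : i = a
        · subst h; simpa using hx
        · simpa [h] using h1 i
      · intro i hi j hj hij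
        simp only [Finset.mem_insert] at hi hj
        rcases hi with rfl | hi <;> rcases hj with rfl | hj
        · exact absurd rfl hij
        · have hji : j ≠ i := fun h => ha (h ▸ hj)
          simp only [Function.update_self, Function.update_of_ne hji]
          exact fun h => hx' j hj (hE.symm h)
        · have hji : i ≠ j := fun h => ha (h ▸ hi)
          simp only [Function.update_self, Function.update_of_ne hji]
          exact fun h => hx' i hi h
        · have h3 : i ≠ a := fun h => ha (h ▸ hi)
          have h4 : j ≠ a := fun h => ha (h ▸ hj)
          simp only [Function.update_of_ne h3, Function.update_of_ne h4]
          exact h2 i hi j hj hij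
  obtain ⟨g, h1, h2⟩ := key Finset.univ
  exact ⟨g, h1, fun i j => h2 i (Finset.mem_univ _) j (Finset.mem_univ _)⟩

end Comb

section Tool2
variable {X : Type*} [TopologicalSpace X] [CompactSpace X] [T2Space X] [TotallyDisconnectedSpace X]

theorem lc_inj_finite {Ω : Set X} (hΩ : Ω.Finite) :
    ∃ c : X → ℕ, IsLocallyConstant c ∧ InjOn c Ω := by
  haveI := hΩ.to_subtype
  obtain ⟨f, hf⟩ := Set.countable_iff_exists_injective.1 hΩ.countable
  obtain ⟨κ, h1, h2⟩ := lc_extend (X := X) (V := Ω) (s := Subtype.val) continuous_subtype_val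
    Subtype.val_injective (f := f) (IsLocallyConstant.of_discrete f)
  refine ⟨κ, h1, fun x hx y hy h => ?_⟩
  have e1 := h2 ⟨x, hx⟩
  have e2 := h2 ⟨y, hy⟩
  simp only at e1 e2
  rw [e1, e2] at h
  exact congrArg Subtype.val (hf h)

/-- Pulling back a finite invariant set. -/
theorem IsCE.pull {E : X → X → Prop} (hE : IsCE E) {I : Type*} [Finite I]
    {F : I → X → X → Prop} (hF : ∀ i, IsCE (F i)) (hFE : ∀ i x y, F i x y → E x y)
    {A : Type*} {a : X → A} (ha : IsLocallyConstant a) {Ω : Set X} (hΩ : Ω.Finite)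
    (hinv : ∀ x ∈ Ω, ∀ y, E x y → y ∈ Ω) :
    ∃ (D : Set X) (ω : X → X), IsClopen D ∧ Ω ⊆ D ∧ (∀ x ∈ D, ∀ y, E x y → y ∈ D) ∧
      (∀ x ∈ D, ω x ∈ Ω) ∧ (∀ x ∈ Ω, ω x = x) ∧ IsLocallyConstant ω ∧
      (∀ x ∈ D, a (ω x) = a x) ∧
      (∀ x ∈ D, ∀ y, E x y → E (ω x) (ω y) ∧ (ω x = ω y → x = y) ∧
         ∀ i, F i x y ↔ F i (ω x) (ω y)) ∧
      (∀ x ∈ D, ∀ y, E (ω x) y → ∃ z, E x z ∧ ω z = y) := by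
  obtain ⟨c1, hc1, hi1⟩ := lc_inj_finite hΩ
  obtain ⟨c, hc, hca, hs, hh⟩ := hE.homog hF hFE (lc_prod hc1 ha)
  have hci : InjOn c Ω := fun x hx y hy h => hi1 hx hy (congrArg Prod.fst (hca x y h))
  let ω0 : ℕ → Option X := fun _ => none
  have : ∀ i : ℕ, ∃ y : Option X, (∀ z, z ∈ Ω → c z = i → y = some z) := by
    intro i
    by_cases h : ∃ z ∈ Ω, c z = i
    · obtain ⟨z, hz, hzi⟩ := h
      refine ⟨some z, fun z' hz' hzi' => ?_⟩
      rw [hci hz hz' (hzi.trans hzi'.symm)]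
    · push Not at h
      exact ⟨none, fun z hz hzi => absurd hzi (h z hz)⟩
  choose w hw using this
  by_cases hX : Nonempty X
  swap
  · exact ⟨∅, id, isClopen_empty, fun x => absurd ⟨x⟩ hX, by simp, by simp, by simp,
      lc_iff.2 (fun x => absurd ⟨x⟩ hX), by simp, by simp, by simp⟩
  let ω : X → X := fun x => (w (c x)).getD hX.some
  have hω : ∀ x, ∀ z ∈ Ω, c z = c x → ω x = z := by
    intro x z hz h
    simp only [ω, hw (c x) z hz h, Option.getD_some]
  let D : Set X := c ⁻¹' (c '' Ω)
  have hcω : ∀ x ∈ D, c (ω x) = c x ∧ ω x ∈ Ω := by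
    rintro x ⟨z, hz, h⟩
    rw [hω x z hz h]; exact ⟨h, hz⟩
  have hDinv : ∀ x ∈ D, ∀ y, E x y → y ∈ D := by
    rintro x ⟨z, hz, h⟩ y hxy
    obtain ⟨y', h1, h2, -⟩ := hh x z y h.symm hxy
    exact ⟨y', hinv z hz y' h1, h2⟩
  have hloc : ∀ x ∈ D, ∀ y, E x y → E (ω x) (ω y) ∧ ∀ i, F i x y ↔ F i (ω x) (ω y) := by
    intro x hx y hxy
    obtain ⟨y', h1, h2, h3⟩ := hh x (ω x) y (hcω x hx).1.symm hxy
    have : ω y = y' := hω y y' (hinv _ (hcω x hx).2 _ h1) h2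
    rw [this]; exact ⟨h1, h3⟩
  refine ⟨D, ω, lc_clopen hc _, fun x hx => ⟨x, hx, rfl⟩, hDinv, fun x hx => (hcω x hx).2,
    fun x hx => hω x x hx rfl, lc_comp hc (fun i => (w i).getD hX.some), ?_, ?_, ?_⟩
  · intro x hx
    exact congrArg Prod.snd (hca _ _ (hcω x hx).1)
  · intro x hx y hxy
    refine ⟨(hloc x hx y hxy).1, fun h => ?_, (hloc x hx y hxy).2⟩
    refine hs x y hxy ?_
    rw [← (hcω x hx).1, h, (hcω y (hDinv x hx y hxy)).1]
  · intro x hx y hy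
    obtain ⟨z, h1, h2, -⟩ := hh (ω x) x y (hcω x hx).1 hy
    exact ⟨z, h1, hω z y (hinv _ (hcω x hx).2 y hy) h2.symm⟩

end Tool2
end Absorb

open Set Topology MeasureTheory

namespace Absorb
open Filter
set_option linter.all false
set_option linter.deprecated false

section Ext
variable {X : Type*} [TopologicalSpace X] [CompactSpace X] [T2Space X] [TotallyDisconnectedSpace X]
variable {V : Type*} [TopologicalSpace V] [CompactSpace V] [T2Space V] [TotallyDisconnectedSpace V]

theorem isCE_pull {E : X → X → Prop} (hE : IsCE E) {j : V → X} (hj : Continuous j)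
    (hji : Function.Injective j)
    (hopn : ∀ v w (W : Set V), E (j v) (j w) → W ∈ 𝓝 w → ∀ᶠ v' in 𝓝 v, ∃ w' ∈ W, E (j v') (j w')) :
    IsCE (fun v w => E (j v) (j w)) where
  refl v := hE.refl _
  symm h := hE.symm h
  trans h h' := hE.trans h h'
  clo := hE.clo.preimage ((hj.comp continuous_fst).prodMk (hj.comp continuous_snd))
  opn h hU := hopn _ _ _ h hU
  inj v := by
    obtain ⟨U, hU, h⟩ := hE.inj (j v)
    exact ⟨j ⁻¹' U, hj.continuousAt hU, fun y hy z hz hyz => hji (h _ hy _ hz hyz)⟩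

/-- a clopen neighbourhood of the image which meets the saturation only in the image -/
theorem nbhd_image {E : X → X → Prop} (hE : IsCE E) {j : V → X} (hj : Continuous j)
    (hji : Function.Injective j)
    (hopn : ∀ v w (W : Set V), E (j v) (j w) → W ∈ 𝓝 w → ∀ᶠ v' in 𝓝 v, ∃ w' ∈ W, E (j v') (j w')) :
    ∃ N : Set X, IsClopen N ∧ (∀ v, j v ∈ N) ∧ ∀ v x, E (j v) x → x ∈ N → ∃ w, x = j w := by
  have hV := isCE_pull hE hj hji hopn
  obtain ⟨c, hc, hs⟩ := hE.sep
  let B : Set X := ⋃ i ∈ range c, (c ⁻¹' {i} ∩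
    {x | ∃ y ∈ j '' {v | ¬ ∃ w ∈ (fun w => c (j w)) ⁻¹' {i}, E (j v) (j w)}, E x y})
  have hB : IsClosed B := by
    refine (lc_fin hc).isClosed_biUnion fun i _ => (lc_clopen hc _).isClosed.inter
      (hE.satClosed ?_)
    have h1 : IsClopen {v | ∃ w ∈ (fun w => c (j w)) ⁻¹' {i}, E (j v) (j w)} :=
      hV.sat (lc_clopen (lc_pre hc hj) _)
    exact (h1.compl.isClosed.isCompact.image hj).isClosed
  have hBx : ∀ v x, E (j v) x → x ∉ B → ∃ w, x = j w := by
    intro v x hvx hx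
    by_contra hne
    push Not at hne
    refine hx ?_
    simp only [B, mem_iUnion]
    refine ⟨c x, ⟨x, rfl⟩, rfl, j v, ⟨v, ?_, rfl⟩, hE.symm hvx⟩
    rintro ⟨w, hw1, hw2⟩
    exact hne w (hs _ _ (hE.trans (hE.symm hvx) hw2) hw1.symm)
  have hjB : range j ⊆ Bᶜ := by
    rintro _ ⟨v, rfl⟩ hv
    simp only [B, mem_iUnion] at hv
    obtain ⟨i, -, h1, _, ⟨w, hw, rfl⟩, h3⟩ := hv
    exact hw ⟨v, h1, hE.symm h3⟩
  obtain ⟨N, h1, h2, h3⟩ := clopen_between (isCompact_range hj).isClosed hB.isOpen_compl hjB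
  exact ⟨N, h1, fun v => h2 ⟨v, rfl⟩, fun v x hvx hx => hBx v x hvx (h3 hx)⟩

theorem forthA {E : X → X → Prop} (hE : IsCE E) {j : V → X} (hj : Continuous j)
    (hji : Function.Injective j)
    (hopn : ∀ v w (W : Set V), E (j v) (j w) → W ∈ 𝓝 w → ∀ᶠ v' in 𝓝 v, ∃ w' ∈ W, E (j v') (j w'))
    {π : X → X} {α : X → ℕ} (hππ : ∀ x, π (π x) = π x) (hkce : IsCE (fun x y => π x = π y))
    (hkE : ∀ x y, π x = π y → E x y) (hα : IsLocallyConstant α)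
    (hL : ∀ x y, π y = y → α y = α (π x) → ∃! x', α x' = α x ∧ π x' = y)
    {A : Type*} {γ : X → A} (hγ : IsLocallyConstant γ) :
    ∃ (π1 : X → X) (α1 : X → ℕ) (q1 : V → V), Continuous π1 ∧ (∀ x, π1 (π1 x) = π1 x) ∧
      (∀ x y, π1 x = π1 y ↔ E x y) ∧ IsLocallyConstant α1 ∧
      (∀ x y, α1 x = α1 y → α x = α y ∧ γ x = γ y) ∧
      (∀ x y, α1 x = α1 y → α1 (π1 x) = α1 (π1 y)) ∧
      (∀ x y, π1 y = y → α1 y = α1 (π1 x) → ∃! x', α1 x' = α1 x ∧ π1 x' = y) ∧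
      (∀ v, π1 (j v) = j (q1 v)) ∧ Continuous q1 ∧
      (∀ x y, E x y → α1 x = α1 y → x = y) ∧
      (∀ ϖ : X → X, (∀ x, π (ϖ x) = π x) → (∀ x y, α x = α y → α (ϖ x) = α (ϖ y)) →
        (∀ x, π1 (ϖ x) = π1 x) ∧ ∀ x y, α1 x = α1 y → α1 (ϖ x) = α1 (ϖ y)) := by
  obtain ⟨N, hN, hjN, hNj⟩ := nbhd_image hE hj hji hopn
  obtain ⟨c, hc, hs⟩ := hE.sep
  obtain ⟨M, hM⟩ := (lc_fin hc).bddAbove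
  classical
  let pr : X → ℕ := fun x => (if x ∈ N then 0 else M + 1) + c x
  have hcM : ∀ x, c x ≤ M := fun x => hM ⟨x, rfl⟩
  have hpr : IsLocallyConstant pr := by
    have := lc_comp (lc_prod (lc_mem hN) hc) (fun p => (if p.1 then 0 else M + 1) + p.2)
    exact this
  have hprs : ∀ x y, E x y → pr x = pr y → x = y := by
    intro x y hxy h
    refine hs x y hxy ?_
    have h1 := hcM x
    have h2 := hcM y
    simp only [pr] at h
    split_ifs at h <;> omega
  let Pr : X → Set ℕ := fun x => {i | ∃ y ∈ pr ⁻¹' {i}, E x y}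
  have hPr : IsLocallyConstant Pr := by
    refine lc_setOf (lc_fin hpr) ?_ (fun i => hE.sat (lc_clopen hpr _))
    rintro i x ⟨y, rfl, -⟩
    exact ⟨y, rfl⟩
  have hf : ∀ x, ∃ y, E x y ∧ pr y = sInf (Pr x) := by
    intro x
    have : (Pr x).Nonempty := ⟨pr x, x, rfl, hE.refl x⟩
    obtain ⟨y, h1, h2⟩ := Nat.sInf_mem this
    exact ⟨y, h2, h1⟩
  choose f hfE hfp using hf
  have hfmin : ∀ x y, E x y → pr (f x) ≤ pr y := by
    intro x y hxy
    rw [hfp]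
    exact Nat.sInf_le ⟨y, rfl, hxy⟩
  have hfu : ∀ x z, E x z → (∀ y, E x y → pr z ≤ pr y) → f x = z := by
    intro x z hxz h
    refine hprs _ _ (hE.trans (hE.symm (hfE x)) hxz) ?_
    exact le_antisymm (hfmin x z hxz) (h _ (hfE x))
  have hfc : Continuous f := by
    rw [← continuousOn_univ]
    intro x hx
    refine hE.sel hpr hprs hx continuousWithinAt_id (fun z _ => hfE z) ?_
    filter_upwards [(lc_iff.1 hPr x).filter_mono nhdsWithin_le_nhds] with z hz
    rw [hfp, hfp, hz]
  have hker : ∀ x y, f x = f y ↔ E x y := by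
    intro x y
    constructor
    · intro h
      exact hE.trans (hfE x) (by rw [h]; exact hE.symm (hfE y))
    · intro h
      exact hfu x (f y) (hE.trans h (hfE y)) (fun z hz => hfmin y z (hE.trans (hE.symm h) hz))
  have hff : ∀ x, f (f x) = f x := fun x => (hker _ _).2 (hE.symm (hfE x))
  obtain ⟨α1, hα1, href, hsep, hh⟩ := hE.homog (I := Unit) (F := fun _ x y => π x = π y)
    (fun _ => hkce) (fun _ x y h => hkE x y h) (lc_prod (lc_prod hα hγ) hpr)
  have href' : ∀ x y, α1 x = α1 y → α x = α y ∧ γ x = γ y ∧ pr x = pr y := by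
    intro x y h
    have := href x y h
    simp only [Prod.mk.injEq] at this
    exact ⟨this.1.1, this.1.2, this.2⟩
  have hD : ∀ x y, α1 x = α1 y → α1 (f x) = α1 (f y) := by
    intro x x' h
    obtain ⟨y', h1, h2, -⟩ := hh x x' (f x) h (hfE x)
    have : f x' = y' := by
      refine hfu x' y' h1 fun z hz => ?_
      obtain ⟨z', h3, h4, -⟩ := hh x' x z h.symm hz
      rw [(href' _ _ h2).2.2, ← (href' _ _ h4).2.2]
      exact hfmin x z' h3
    rw [this, h2]
  have hfj : ∀ v, ∃ w, f (j v) = j w := by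
    intro v
    have h1 : pr (f (j v)) ≤ pr (j v) := hfmin _ _ (hE.refl _)
    have h2 : f (j v) ∈ N := by
      by_contra hne
      have h3 := hcM (j v)
      simp only [pr, hjN v, hne, if_true, if_false] at h1
      omega
    exact hNj v _ (hfE _) h2
  choose q1 hq1 using hfj
  refine ⟨f, α1, q1, hfc, hff, hker, hα1, fun x y h => ⟨(href' x y h).1, (href' x y h).2.1⟩,
    hD, ?_, hq1, ?_, hsep, ?_⟩
  · intro x y hy hxy
    obtain ⟨x', h1, h2, -⟩ := hh (f x) y x hxy.symm (hE.symm (hfE x))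
    have e : f x' = y := by rw [← (hker y x').2 h1, hy]
    refine ⟨x', ⟨h2, e⟩, ?_⟩
    rintro z ⟨h3, h4⟩
    refine hsep z x' ((hker _ _).1 (by rw [h4, e])) (by rw [h3, h2])
  · have hemb : IsClosedEmbedding j := hj.isClosedEmbedding hji
    rw [hemb.isInducing.continuous_iff]
    have : j ∘ q1 = f ∘ j := by funext v; exact (hq1 v).symm
    rw [this]; exact hfc.comp hj
  · intro ϖ h1 h2
    refine ⟨fun x => (hker _ _).2 (hkE _ _ (h1 x)), ?_⟩
    intro x x' hx
    obtain ⟨y', h3, h4, h5⟩ := hh x x' (ϖ x) hx (hkE _ _ (h1 x).symm)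
    have h6 : π x' = π y' := (h5 ()).1 (h1 x).symm
    obtain ⟨u, -, hu⟩ := hL (ϖ x') (π x') (hππ _) (by rw [h1])
    have e1 : y' = u := hu y' ⟨by
      rw [(href' _ _ h4).1]; exact h2 _ _ (href' _ _ hx).1, h6.symm⟩
    have e2 : ϖ x' = u := hu _ ⟨rfl, h1 x'⟩
    rw [e2, ← e1, h4]

theorem forth {E : ℕ → X → X → Prop} (hE : ∀ n, IsCE (E n))
    (hmono : ∀ m n, m ≤ n → ∀ x y, E m x y → E n x y)
    {j ι : V → X} (hj : Continuous j) (hji : Function.Injective j)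
    (hι : Continuous ι) (hιi : Function.Injective ι) {N : ℕ}
    (hopn : ∀ v w (W : Set V), E N (j v) (j w) → W ∈ 𝓝 w →
      ∀ᶠ v' in 𝓝 v, ∃ w' ∈ W, E N (j v') (j w'))
    (htrans : ∃ m, ∀ v w, E N (j v) (j w) → E m (ι v) (ι w))
    (hcomp : ∀ B : Set X, IsClopen B → B.Nonempty → ∃ n, ∃ φ : V → X, Continuous φ ∧
      Function.Injective φ ∧ ∀ v, φ v ∈ B ∧ E n (ι v) (φ v))
    {π : X → X} {α : X → ℕ} {q : V → V} (hπc : Continuous π) (hππ : ∀ x, π (π x) = π x)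
    (hkce : IsCE (fun x y => π x = π y))
    (hkE : ∀ x y, π x = π y → E N x y) (hα : IsLocallyConstant α)
    (hD : ∀ x y, α x = α y → α (π x) = α (π y))
    (hL : ∀ x y, π y = y → α y = α (π x) → ∃! x', α x' = α x ∧ π x' = y)
    (hqj : ∀ v, π (j v) = j (q v)) (hqι : ∀ v, π (ι v) = ι (q v))
    (hαj : ∀ v, α (j v) = α (ι v))
    {A : Type*} {γ : X → A} (hγ : IsLocallyConstant γ) :
    ∃ (k1 : ℕ) (η : X ≃ₜ X) (π1 : X → X) (α1 : X → ℕ) (q1 : V → V), N ≤ k1 ∧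
      (∀ x, E k1 x (η x)) ∧ (∀ x, α (η x) = α x) ∧
      Continuous π1 ∧ (∀ x, π1 (π1 x) = π1 x) ∧
      (∀ x y, π1 x = π1 y ↔ E N x y) ∧ IsLocallyConstant α1 ∧
      (∀ x y, α1 x = α1 y → α x = α y ∧ γ x = γ y) ∧
      (∀ x y, α1 x = α1 y → α1 (π1 x) = α1 (π1 y)) ∧
      (∀ x y, π1 y = y → α1 y = α1 (π1 x) → ∃! x', α1 x' = α1 x ∧ π1 x' = y) ∧
      (∀ v, π1 (j v) = j (q1 v)) ∧ (∀ v, π1 (η (ι v)) = η (ι (q1 v))) ∧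
      (∀ v, α1 (j v) = α1 (η (ι v))) ∧
      (∀ ϖ : X → X, (∀ x, π (ϖ x) = π x) → (∀ x y, α x = α y → α (ϖ x) = α (ϖ y)) →
        (∀ x, π1 (ϖ x) = π1 x) ∧ (∀ x y, α1 x = α1 y → α1 (ϖ x) = α1 (ϖ y)) ∧
        ∀ x, η (ϖ x) = ϖ (η x)) := by
  obtain ⟨f, α1, q1, hfc, hff, hker, hα1, href, hD1, hL1, hq1, hq1c, hsep, hϖ⟩ :=
    forthA (hE N) hj hji hopn hππ hkce hkE hα hL hγ
  have hEf : ∀ x, E N x (f x) := fun x => (hker _ _).1 (hff x).symm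
  have hq1q1 : ∀ v, q1 (q1 v) = q1 v := by
    intro v; apply hji; rw [← hq1, ← hq1, hff]
  have hαs : ∀ x y, π x = π y → α x = α y → x = y := by
    intro x y h1 h2
    obtain ⟨u, -, hu⟩ := hL x (π x) (hππ x) rfl
    rw [hu x ⟨rfl, rfl⟩, hu y ⟨h2.symm, h1.symm⟩]
  -- choose the maps into the color classes
  have hch : ∀ i : ℕ, ∃ n, ∃ φ : V → X, (∃ v, α1 (j v) = i) → Continuous φ ∧
      Function.Injective φ ∧ ∀ v, α1 (φ v) = i ∧ E n (ι v) (φ v) := by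
    intro i
    by_cases hi : ∃ v, α1 (j v) = i
    · obtain ⟨v, hv⟩ := hi
      obtain ⟨n, φ, h1, h2, h3⟩ := hcomp (α1 ⁻¹' {i}) (lc_clopen hα1 _) ⟨j v, hv⟩
      exact ⟨n, φ, fun _ => ⟨h1, h2, h3⟩⟩
    · exact ⟨0, ι, fun h => absurd h hi⟩
  choose nn φ hφ using hch
  have hbd : ∃ M, ∀ v, nn (α1 (j v)) ≤ M := by
    obtain ⟨M, hM⟩ := (lc_fin (lc_comp (lc_pre hα1 hj) nn)).bddAbove
    exact ⟨M, fun v => hM ⟨v, rfl⟩⟩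
  obtain ⟨M, hM⟩ := hbd
  obtain ⟨m0, hm0⟩ := htrans
  let base : V → X := fun v => φ (α1 (j (q1 v))) (q1 v)
  have hbase : ∀ v, α1 (base v) = α1 (j (q1 v)) ∧ E M (ι (q1 v)) (base v) := by
    intro v
    obtain ⟨-, -, h3⟩ := hφ (α1 (j (q1 v))) ⟨q1 v, rfl⟩
    exact ⟨(h3 (q1 v)).1, hmono _ _ (hM (q1 v)) _ _ (h3 (q1 v)).2⟩
  have hfix : ∀ x y, α1 x = α1 y → f x = x → f y = y := by
    intro x y h hx
    refine (hsep y (f y) (hEf y) ?_).symm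
    rw [← hD1 x y h, hx, h]
  have hfbase : ∀ v, f (base v) = base v := by
    intro v
    refine hfix (j (q1 v)) _ (hbase v).1.symm ?_
    rw [hq1, hq1q1]
  have hbasec : Continuous base := by
    rw [continuous_iff_continuousAt]
    intro v
    obtain ⟨h1, -, -⟩ := hφ (α1 (j (q1 v))) ⟨q1 v, rfl⟩
    have h2 : ContinuousAt (fun w => φ (α1 (j (q1 v))) (q1 w)) v := (h1.comp hq1c).continuousAt
    refine h2.congr ?_
    filter_upwards [lc_iff.1 (lc_pre hα1 (hj.comp hq1c)) v] with w hw
    simp only [Function.comp] at hw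
    simp only [base, hw]
  have hbasei : ∀ v w, base v = base w → q1 v = q1 w := by
    intro v w h
    have h1 : α1 (j (q1 v)) = α1 (j (q1 w)) := by rw [← (hbase v).1, h, (hbase w).1]
    obtain ⟨-, h2, -⟩ := hφ (α1 (j (q1 v))) ⟨q1 v, rfl⟩
    apply h2
    have : base w = φ (α1 (j (q1 v))) (q1 w) := by simp only [base, h1]
    rw [← this, ← h]
  have hbq : ∀ v w, q1 v = q1 w → base v = base w := by
    intro v w h; simp only [base, h]
  have hι1 : ∀ v, ∃! x', α1 x' = α1 (j v) ∧ f x' = base v := by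
    intro v
    refine hL1 (j v) (base v) (hfbase v) ?_
    rw [(hbase v).1, hq1]
  choose ι1 hι1' hι1u using hι1
  have hι1a : ∀ v, α1 (ι1 v) = α1 (j v) := fun v => (hι1' v).1
  have hι1f : ∀ v, f (ι1 v) = base v := fun v => (hι1' v).2
  have hι1q : ∀ v, ι1 (q1 v) = base v := by
    intro v
    symm
    apply hι1u (q1 v)
    refine ⟨(hbase v).1, ?_⟩
    rw [hfbase]
    exact hbq _ _ (hq1q1 v).symm
  have hι1i : Function.Injective ι1 := by
    intro v w h
    have h1 : q1 v = q1 w := hbasei v w (by rw [← hι1f, h, hι1f])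
    apply hji
    refine hsep _ _ ((hker _ _).1 (by rw [hq1, hq1, h1])) (by rw [← hι1a, h, hι1a])
  have hι1c : Continuous ι1 := by
    rw [← continuousOn_univ]
    intro v hv
    refine (hE N).sel hα1 hsep (g := base) hv hbasec.continuousWithinAt (fun z _ => ?_) ?_
    · rw [← hι1f]; exact (hE N).symm (hEf _)
    · filter_upwards [(lc_iff.1 (lc_pre hα1 hj) v).filter_mono nhdsWithin_le_nhds] with w hw
      rw [hι1a, hι1a, hw]
  let k1 := max N (max m0 M)
  have hN1 : N ≤ k1 := le_max_left _ _
  have hm1 : m0 ≤ k1 := (le_max_left _ _).trans (le_max_right _ _)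
  have hM1 : M ≤ k1 := (le_max_right _ _).trans (le_max_right _ _)
  have hιE : ∀ v, E k1 (ι v) (ι1 v) := by
    intro v
    have h1 : E k1 (ι v) (ι (q1 v)) :=
      hmono _ _ hm1 _ _ (hm0 _ _ (by rw [← hq1]; exact hEf _))
    have h2 : E k1 (ι (q1 v)) (base v) := hmono _ _ hM1 _ _ (hbase v).2
    have h3 : E k1 (base v) (ι1 v) := by
      rw [← hι1f]; exact hmono _ _ hN1 _ _ ((hE N).symm (hEf _))
    exact (hE k1).trans ((hE k1).trans h1 h2) h3
  obtain ⟨hfπ, hDπ1⟩ := hϖ π hππ hD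
  have hπι1 : ∀ v, π (ι1 v) = ι1 (q v) := by
    intro v
    apply hι1u (q v)
    constructor
    · rw [hDπ1 _ _ (hι1a v), hqj]
    · rw [hfπ, hι1f]
      apply hbq
      apply hji
      rw [← hq1, ← hq1, ← hqj, hfπ]
  have hαι1 : ∀ v, α (ι1 v) = α (ι v) := by
    intro v
    rw [(href _ _ (hι1a v)).1, hαj]
  -- the clopen set of fixed points
  have hAc : IsClopen {x | π x = x} := by
    have h1 : IsLocallyConstant (fun x => (α (π x), α x)) := lc_prod (lc_pre hα hπc) hα
    have h2 := lc_clopen h1 {p | p.1 = p.2}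
    have : {x | π x = x} = (fun x => (α (π x), α x)) ⁻¹' {p | p.1 = p.2} := by
      ext x
      constructor
      · intro h
        show α (π x) = α x
        rw [show π x = x from h]
      · intro h
        exact hαs _ _ (hππ x) h
    rw [this]; exact h2
  have hE1 : IsCE (fun x y => E k1 x y ∧ (α x, (π x = x)) = (α y, (π y = y))) :=
    (hE k1).colorEq (lc_prod hα (lc_mem hAc))
  let V0 : Set V := {v | q v = v}
  have hV0 : IsClosed V0 := by
    have : V0 = ι ⁻¹' {x | π x = x} := by
      ext v
      show q v = v ↔ π (ι v) = ι v
      rw [hqι]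
      exact ⟨fun h => by rw [h], fun h => hιi h⟩
    rw [this]; exact hAc.isClosed.preimage hι
  haveI : CompactSpace V0 := isCompact_iff_compactSpace.1 hV0.isCompact
  obtain ⟨ηA, hηA1, hηA2⟩ := hE1.lemmaC (V := V0) (s := fun v => ι v) (t := fun v => ι1 v)
    (hι.comp continuous_subtype_val) (hιi.comp Subtype.val_injective)
    (hι1c.comp continuous_subtype_val) (hι1i.comp Subtype.val_injective) (by
      rintro ⟨v, hv⟩
      refine ⟨hιE v, ?_⟩
      have e : q v = v := hv
      simp only [Prod.mk.injEq]
      refine ⟨(hαι1 v).symm, ?_⟩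
      simp only [hqι, hπι1, e])
  have hηAα : ∀ x, α (ηA x) = α x := fun x => (congrArg Prod.fst (hηA2 x).2).symm
  have hηAfix : ∀ x, π x = x → π (ηA x) = ηA x := fun x hx =>
    (congrArg Prod.snd (hηA2 x).2).mp hx
  have hη : ∀ x, ∃! x', α x' = α x ∧ π x' = ηA (π x) := fun x =>
    hL x _ (hηAfix _ (hππ x)) (hηAα _)
  choose η0 hη0 hη0u using hη
  have hη0c : Continuous η0 := by
    rw [← continuousOn_univ]
    intro x hx
    refine hkce.sel hα hαs (g := fun x => ηA (π x)) hx
      ((ηA.continuous.comp hπc).continuousWithinAt) (fun z _ => ?_) ?_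
    · rw [(hη0 z).2]; exact hηAfix _ (hππ z)
    · filter_upwards [(lc_iff.1 hα x).filter_mono nhdsWithin_le_nhds] with w hw
      rw [(hη0 w).1, (hη0 x).1, hw]
  have hη0i : Function.Injective η0 := by
    intro x y h
    refine hαs x y ?_ ?_
    · apply ηA.injective
      rw [← (hη0 x).2, h, (hη0 y).2]
    · rw [← (hη0 x).1, h, (hη0 y).1]
  have hη0E : ∀ x, E k1 x (η0 x) := by
    intro x
    have h1 : E k1 x (π x) := hmono _ _ hN1 _ _ (hkE _ _ (hππ x).symm)
    have h2 : E k1 (π x) (ηA (π x)) := (hηA2 _).1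
    have h3 : E k1 (η0 x) (ηA (π x)) := by
      rw [← (hη0 x).2]; exact hmono _ _ hN1 _ _ (hkE _ _ (hππ _).symm)
    exact (hE k1).trans ((hE k1).trans h1 h2) ((hE k1).symm h3)
  obtain ⟨η, hηη⟩ := (hE k1).homeo hη0c hη0i hη0E
  have hηα : ∀ x, α (η x) = α x := fun x => by rw [hηη]; exact (hη0 x).1
  have hηι : ∀ v, η (ι v) = ι1 v := by
    intro v
    rw [hηη]
    symm
    apply hη0u
    refine ⟨hαι1 v, ?_⟩
    rw [hqι, hπι1]
    have hqq : q (q v) = q v := by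
      apply hιi; rw [← hqι, ← hqι, hππ]
    exact (hηA1 ⟨q v, hqq⟩).symm
  have hηπ : ∀ x, η (π x) = π (η x) := by
    intro x
    rw [hηη, hηη, (hη0 x).2]
    symm
    apply hη0u
    rw [hππ]
    exact ⟨hηAα _, hηAfix _ (hππ x)⟩
  refine ⟨k1, η, f, α1, q1, hN1, fun x => by rw [hηη]; exact hη0E x, hηα, hfc, hff, hker, hα1, href,
    hD1, hL1, hq1, ?_, ?_, ?_⟩
  · intro v
    rw [hηι, hηι, hι1f, hι1q]
  · intro v
    rw [hηι, hι1a]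
  · intro ϖ h1 h2
    refine ⟨(hϖ ϖ h1 h2).1, (hϖ ϖ h1 h2).2, fun x => ?_⟩
    refine hαs _ _ ?_ ?_
    · rw [← hηπ, h1, h1, hηπ]
    · rw [hηα, h2 (η x) x (hηα x)]

end Ext
end Absorb

open Set Topology MeasureTheory

namespace Absorb
open Filter
set_option linter.all false
set_option linter.deprecated false

section Lim
variable {X : Type*} [TopologicalSpace X] [CompactSpace X] [T2Space X] [TotallyDisconnectedSpace X]

/-- A refining separating sequence of colorings. -/
structure SepSeq (d : ℕ → X → Set ℕ) : Prop where
  lc : ∀ n, IsLocallyConstant (d n)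
  ref : ∀ m n, m ≤ n → ∀ x y, d n x = d n y → d m x = d m y
  sep : ∀ x y, (∀ n, d n x = d n y) → x = y

theorem exists_sepSeq [SecondCountableTopology X] : ∃ d : ℕ → X → Set ℕ, SepSeq d := by
  have h1 : TopologicalSpace.IsTopologicalBasis {s : Set X | IsClopen s} := isTopologicalBasis_isClopen
  obtain ⟨b, hb, hbc, hbb⟩ := h1.exists_countable
  have hne : (insert ∅ b).Nonempty := ⟨∅, mem_insert _ _⟩
  obtain ⟨f, hf⟩ := (hbc.insert ∅).exists_eq_range hne
  have hfc : ∀ i, IsClopen (f i) := by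
    intro i
    have : f i ∈ insert ∅ b := by rw [hf]; exact ⟨i, rfl⟩
    rcases this with h | h
    · rw [h]; exact isClopen_empty
    · exact hb h
  refine ⟨fun n x => {i | i < n ∧ x ∈ f i}, ?_, ?_, ?_⟩
  · intro n
    refine lc_setOf (finite_lt_nat n) (fun a x h => h.1) (fun a => ?_)
    by_cases ha : a < n
    · simpa [ha] using hfc a
    · have : {x | a < n ∧ x ∈ f a} = ∅ := by
        ext x; simp [ha]
      rw [this]; exact isClopen_empty
  · intro m n hmn x y h
    ext i
    have h2 := Set.ext_iff.1 h i
    simp only [mem_setOf_eq] at h2 ⊢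
    constructor
    · rintro ⟨h3, h4⟩
      exact ⟨h3, (h2.1 ⟨by omega, h4⟩).2⟩
    · rintro ⟨h3, h4⟩
      exact ⟨h3, (h2.2 ⟨by omega, h4⟩).2⟩
  · intro x y h
    by_contra hne
    obtain ⟨U, hU, hxU, hyU⟩ := hbb.exists_subset_of_mem_open (a := x) (u := {y}ᶜ)
      hne isOpen_compl_singleton
    have : U ∈ range f := by rw [← hf]; exact mem_insert_of_mem _ hU
    obtain ⟨i, rfl⟩ := this
    have h2 := Set.ext_iff.1 (h (i + 1)) i
    simp only [mem_setOf_eq] at h2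
    exact hyU (h2.1 ⟨by omega, hxU⟩).2 rfl

theorem SepSeq.nhd {d : ℕ → X → Set ℕ} (hd : SepSeq d) {x : X} {U : Set X} (hU : U ∈ 𝓝 x) :
    ∃ n, ∀ y, d n y = d n x → y ∈ U := by
  have := exists_subset_nhds_of_isCompact (ι := ℕ) (V := fun n => {y | d n y = d n x})
    ?_ (fun n => ((lc_clopen (hd.lc n) {d n x}).isClosed.isCompact)) (U := U) ?_
  · obtain ⟨n, hn⟩ := this
    exact ⟨n, fun y hy => hn hy⟩
  · refine directed_of_isDirected_le ?_
    intro m n hmn y hy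
    exact hd.ref m n hmn _ _ hy
  · intro y hy
    simp only [mem_iInter, mem_setOf_eq] at hy
    rw [hd.sep y x hy]; exact hU

theorem SepSeq.cont {d : ℕ → X → Set ℕ} (hd : SepSeq d) {Z : Type*} [TopologicalSpace Z]
    {f : Z → X} (hf : ∀ n, IsLocallyConstant (fun z => d n (f z))) : Continuous f := by
  rw [continuous_iff_continuousAt]
  intro z U hU
  obtain ⟨n, hn⟩ := hd.nhd hU
  rw [mem_map]
  filter_upwards [lc_iff.1 (hf n) z] with w hw
  exact hn _ hw

theorem SepSeq.lim {d : ℕ → X → Set ℕ} (hd : SepSeq d) {g : ℕ → X}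
    (hg : ∀ n, d n (g (n + 1)) = d n (g n)) : ∃ x, ∀ m n, m ≤ n → d m x = d m (g n) := by
  have hst : ∀ m n, m ≤ n → d m (g n) = d m (g m) := by
    intro m n hmn
    induction n, hmn using Nat.le_induction with
    | base => rfl
    | succ n hmn ih => rw [hd.ref m n hmn _ _ (hg n), ih]
  obtain ⟨x, hx⟩ := IsCompact.nonempty_iInter_of_sequence_nonempty_isCompact_isClosed
    (fun n => {y | d n y = d n (g n)}) (by
      intro n y hy
      have hy' : d (n + 1) y = d (n + 1) (g (n + 1)) := hy
      show d n y = d n (g n)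
      rw [hd.ref n (n + 1) (by omega) _ _ hy', hg])
    (fun n => ⟨g n, rfl⟩) ((lc_clopen (hd.lc 0) {d 0 (g 0)}).isClosed.isCompact)
    (fun n => (lc_clopen (hd.lc n) {d n (g n)}).isClosed)
  refine ⟨x, fun m n hmn => ?_⟩
  rw [hst m n hmn]
  exact mem_iInter.1 hx m

end Lim

section BF
variable {X : Type*} [TopologicalSpace X] [CompactSpace X] [T2Space X] [TotallyDisconnectedSpace X]
variable {V : Type*} [TopologicalSpace V] [CompactSpace V] [T2Space V] [TotallyDisconnectedSpace V]

structure ExtHalf (E : ℕ → X → X → Prop) (j ι : V → X) : Prop where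
  hj : Continuous j
  hji : Function.Injective j
  hopn : ∀ n v w (W : Set V), E n (j v) (j w) → W ∈ 𝓝 w →
      ∀ᶠ v' in 𝓝 v, ∃ w' ∈ W, E n (j v') (j w')
  htrans : ∀ n, ∃ m, ∀ v w, E n (j v) (j w) → E m (ι v) (ι w)
  hcomp : ∀ B : Set X, IsClopen B → B.Nonempty → ∃ n, ∃ φ : V → X, Continuous φ ∧
      Function.Injective φ ∧ ∀ v, φ v ∈ B ∧ E n (ι v) (φ v)

structure St (E : ℕ → X → X → Prop) (j ι : V → X) where
  k : ℕ
  a : X ≃ₜ X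
  b : X ≃ₜ X
  π : X → X
  α : X → ℕ
  q : V → V
  ak : ∀ x, E k x (a x)
  bk : ∀ x, E k x (b x)
  πc : Continuous π
  ππ : ∀ x, π (π x) = π x
  kce : IsCE (fun x y => π x = π y)
  kk : ∀ x y, π x = π y → E k x y
  αl : IsLocallyConstant α
  D : ∀ x y, α x = α y → α (π x) = α (π y)
  L : ∀ x y, π y = y → α y = α (π x) → ∃! x', α x' = α x ∧ π x' = y
  qj : ∀ v, π (a.symm (j v)) = a.symm (j (q v))
  qι : ∀ v, π (b.symm (ι v)) = b.symm (ι (q v))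
  αj : ∀ v, α (a.symm (j v)) = α (b.symm (ι v))

def St.swap {E : ℕ → X → X → Prop} {j ι : V → X} (s : St E j ι) : St E ι j where
  k := s.k
  a := s.b
  b := s.a
  π := s.π
  α := s.α
  q := s.q
  ak := s.bk
  bk := s.ak
  πc := s.πc
  ππ := s.ππ
  kce := s.kce
  kk := s.kk
  αl := s.αl
  D := s.D
  L := s.L
  qj := s.qι
  qι := s.qj
  αj v := (s.αj v).symm

structure Nxt {E : ℕ → X → X → Prop} {j ι : V → X} (s s' : St E j ι) : Prop where
  ra : ∀ x, s.α (s'.a.symm x) = s.α (s.a.symm x)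
  rb : ∀ x, s.α (s'.b.symm x) = s.α (s.b.symm x)
  ref : ∀ x y, s'.α x = s'.α y → s.α x = s.α y
  w : ∀ ϖ : X → X, (∀ x, s.π (ϖ x) = s.π x) → (∀ x y, s.α x = s.α y → s.α (ϖ x) = s.α (ϖ y)) →
    (∀ x, s'.π (ϖ x) = s'.π x) ∧ (∀ x y, s'.α x = s'.α y → s'.α (ϖ x) = s'.α (ϖ y)) ∧
    (∀ x, s'.a (ϖ (s'.a.symm x)) = s.a (ϖ (s.a.symm x))) ∧
    (∀ x, s'.b (ϖ (s'.b.symm x)) = s.b (ϖ (s.b.symm x)))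

variable {E : ℕ → X → X → Prop} {j ι : V → X}

theorem Nxt.trans {s s' s'' : St E j ι} (h : Nxt s s') (h' : Nxt s' s'') : Nxt s s'' where
  ra x := by rw [h.ref _ _ (h'.ra x), h.ra]
  rb x := by rw [h.ref _ _ (h'.rb x), h.rb]
  ref x y e := h.ref _ _ (h'.ref _ _ e)
  w ϖ h1 h2 := by
    obtain ⟨e1, e2, e3, e4⟩ := h.w ϖ h1 h2
    obtain ⟨f1, f2, f3, f4⟩ := h'.w ϖ e1 e2
    exact ⟨f1, f2, fun x => by rw [f3, e3], fun x => by rw [f4, e4]⟩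

theorem Nxt.swap {s s' : St E j ι} (h : Nxt s s') : Nxt s.swap s'.swap where
  ra := h.rb
  rb := h.ra
  ref := h.ref
  w ϖ h1 h2 := by
    obtain ⟨e1, e2, e3, e4⟩ := h.w ϖ h1 h2
    exact ⟨e1, e2, e4, e3⟩

def St.K (s : St E j ι) (N : ℕ) : Prop :=
  ∀ x y, E N x y → s.π (s.a.symm x) = s.π (s.a.symm y)

def St.G {A : Type*} (s : St E j ι) (δ : X → A) : Prop :=
  ∀ u w, s.α u = s.α w → δ (s.a u) = δ (s.a w)

theorem Nxt.K {s s' : St E j ι} (h : Nxt s s') {N : ℕ} (hK : s.K N) : s'.K N := by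
  intro x y hxy
  obtain ⟨e1, e2, e3, e4⟩ := h.w s.π s.ππ s.D
  have h1 := e3 x
  rw [hK x y hxy, ← e3 y] at h1
  have h2 := s'.a.injective h1
  rw [← e1, h2, e1]

theorem Nxt.G {A : Type*} {s s' : St E j ι} (h : Nxt s s') {δ : X → A} (hG : s.G δ) : s'.G δ := by
  intro u w huw
  have h1 := h.ref _ _ huw
  have h2 : ∀ u, s.α u = s.α (s.a.symm (s'.a u)) := by
    intro u
    have := h.ra (s'.a u)
    rwa [s'.a.symm_apply_apply] at this
  rw [h2 u, h2 w] at h1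
  have := hG _ _ h1
  simpa using this

theorem St.step (hE : ∀ n, IsCE (E n))
    (hmono : ∀ m n, m ≤ n → ∀ x y, E m x y → E n x y) (H1 : ExtHalf E j ι) (H2 : ExtHalf E ι j)
    (s : St E j ι) (N0 : ℕ) {A : Type*} {δ : X → A} (hδ : IsLocallyConstant δ) :
    ∃ s' : St E j ι, Nxt s s' ∧ s'.K N0 ∧ s'.G δ := by
  let N := max N0 s.k
  have hkN : s.k ≤ N := le_max_right _ _
  have ha : ∀ m, s.k ≤ m → ∀ x, E m (s.a.symm x) x := by
    intro m hm x
    have := hmono _ _ hm _ _ (s.ak (s.a.symm x))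
    rwa [s.a.apply_symm_apply] at this
  have hb : ∀ m, s.k ≤ m → ∀ x, E m (s.b.symm x) x := by
    intro m hm x
    have := hmono _ _ hm _ _ (s.bk (s.b.symm x))
    rwa [s.b.apply_symm_apply] at this
  have haE : ∀ m, s.k ≤ m → ∀ x y, E m (s.a.symm x) (s.a.symm y) ↔ E m x y := by
    intro m hm x y
    constructor
    · intro h
      exact (hE m).trans ((hE m).symm (ha m hm x)) ((hE m).trans h (ha m hm y))
    · intro h
      exact (hE m).trans (ha m hm x) ((hE m).trans h ((hE m).symm (ha m hm y)))
  have hbE : ∀ m, s.k ≤ m → ∀ x y, E m (s.b.symm x) (s.b.symm y) ↔ E m x y := by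
    intro m hm x y
    constructor
    · intro h
      exact (hE m).trans ((hE m).symm (hb m hm x)) ((hE m).trans h (hb m hm y))
    · intro h
      exact (hE m).trans (hb m hm x) ((hE m).trans h ((hE m).symm (hb m hm y)))
  obtain ⟨k1, η, π1, α1, q1, hk1, c1, c2, c3, c4, c5, c6, c7, c8, c9, c10, c11, c12, c13⟩ :=
    Absorb.forth hE hmono (j := fun v => s.a.symm (j v)) (ι := fun v => s.b.symm (ι v))
    (s.a.symm.continuous.comp H1.hj) (s.a.symm.injective.comp H1.hji)
    (s.b.symm.continuous.comp H2.hj) (s.b.symm.injective.comp H2.hji) (N := N)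
    (by
      intro v w W h hW
      rw [haE N hkN] at h
      filter_upwards [H1.hopn N v w W h hW] with v' h'
      obtain ⟨w', h1, h2⟩ := h'
      exact ⟨w', h1, (haE N hkN _ _).2 h2⟩)
    (by
      obtain ⟨m, hm⟩ := H1.htrans N
      refine ⟨max m s.k, fun v w h => ?_⟩
      rw [haE N hkN] at h
      rw [hbE _ (le_max_right _ _)]
      exact hmono _ _ (le_max_left _ _) _ _ (hm v w h))
    (by
      intro B hB hBn
      obtain ⟨n, φ, h1, h2, h3⟩ := H1.hcomp B hB hBn
      refine ⟨max n s.k, φ, h1, h2, fun v => ⟨(h3 v).1, ?_⟩⟩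
      exact (hE _).trans (hb _ (le_max_right _ _) _) (hmono _ _ (le_max_left _ _) _ _ (h3 v).2))
    s.πc s.ππ s.kce (fun x y h => hmono _ _ hkN _ _ (s.kk x y h)) s.αl s.D s.L s.qj s.qι s.αj
    (lc_pre hδ s.a.continuous)
  have hE' : (fun x y => π1 x = π1 y) = E N := by
    funext x y; exact propext (c5 x y)
  let s' : St E j ι :=
    { k := k1
      a := s.a
      b := η.symm.trans s.b
      π := π1
      α := α1
      q := q1
      ak := fun x => hmono _ _ (hkN.trans hk1) _ _ (s.ak x)
      bk := fun x => by
        have h1 := c1 (η.symm x)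
        rw [η.apply_symm_apply] at h1
        exact (hE k1).trans ((hE k1).symm h1) (hmono _ _ (hkN.trans hk1) _ _ (s.bk _))
      πc := c3
      ππ := c4
      kce := by rw [hE']; exact hE N
      kk := fun x y h => hmono _ _ hk1 _ _ ((c5 x y).1 h)
      αl := c6
      D := c8
      L := c9
      qj := c10
      qι := c11
      αj := c12 }
  refine ⟨s', ⟨fun x => rfl, fun x => c2 _, fun x y h => (c7 x y h).1, ?_⟩, ?_, ?_⟩
  · intro ϖ h1 h2
    obtain ⟨e1, e2, e3⟩ := c13 ϖ h1 h2
    refine ⟨e1, e2, fun x => rfl, fun x => ?_⟩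
    show s.b (η.symm (ϖ (η (s.b.symm x)))) = _
    rw [← e3, η.symm_apply_apply]
  · intro x y hxy
    show π1 (s.a.symm x) = π1 (s.a.symm y)
    rw [c5, haE N hkN]
    exact hmono _ _ (le_max_left _ _) _ _ hxy
  · intro u w h
    exact (c7 u w h).2

theorem St.double (hE : ∀ n, IsCE (E n))
    (hmono : ∀ m n, m ≤ n → ∀ x y, E m x y → E n x y) (H1 : ExtHalf E j ι) (H2 : ExtHalf E ι j)
    (s : St E j ι) (N : ℕ) {A : Type*} {δ : X → A} (hδ : IsLocallyConstant δ) :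
    ∃ s' : St E j ι, Nxt s s' ∧ s'.K N ∧ s'.G δ ∧ s'.swap.K N ∧ s'.swap.G δ := by
  obtain ⟨s1, h1, h2, h3⟩ := s.step hE hmono H1 H2 N hδ
  obtain ⟨s2, h4, h5, h6⟩ := s1.swap.step hE hmono H2 H1 N hδ
  have h7 : Nxt s1 s2.swap := h4.swap
  exact ⟨s2.swap, h1.trans h7, h7.K h2, h7.G h3, h5, h6⟩

theorem St.hstep {s s' : St E j ι} (h : Nxt s s') {A : Type*} {δ : X → A} (hG : s.swap.G δ)
    (x : X) : δ (s'.b (s'.a.symm x)) = δ (s.b (s.a.symm x)) := by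
  have h1 := h.ra x
  have h2 := h.rb (s'.b (s'.a.symm x))
  rw [s'.b.symm_apply_apply, h1] at h2
  have := hG _ _ h2
  have h3 : δ (s.b (s.a.symm x)) = δ (s.b (s.b.symm (s'.b (s'.a.symm x)))) := this
  rw [h3, s.b.apply_symm_apply]

/-- The extension theorem. -/
theorem extension [SecondCountableTopology X] (hE : ∀ n, IsCE (E n))
    (hmono : ∀ m n, m ≤ n → ∀ x y, E m x y → E n x y) (H1 : ExtHalf E j ι) (H2 : ExtHalf E ι j) :
    ∃ h : X ≃ₜ X, (∀ v, h (j v) = ι v) ∧ ∀ x y, (∃ n, E n x y) ↔ ∃ n, E n (h x) (h y) := by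
  obtain ⟨d, hd⟩ := exists_sepSeq (X := X)
  have hstep : ∀ (s : St E j ι) (n : ℕ), ∃ s' : St E j ι, Nxt s s' ∧ s'.K n ∧ s'.G (d n) ∧
      s'.swap.K n ∧ s'.swap.G (d n) := fun s n => s.double hE hmono H1 H2 n (hd.lc n)
  choose F hF using hstep
  let s0 : St E j ι :=
    { k := 0
      a := Homeomorph.refl X
      b := Homeomorph.refl X
      π := id
      α := fun _ => 0
      q := id
      ak := fun x => (hE 0).refl x
      bk := fun x => (hE 0).refl x
      πc := continuous_id
      ππ := fun x => rfl
      kce := isCE_eq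
      kk := fun x y h => by
        have : x = y := h
        rw [this]; exact (hE 0).refl y
      αl := lc_iff.2 fun x => Eventually.of_forall fun _ => rfl
      D := fun _ _ _ => rfl
      L := fun x y _ _ => ⟨y, ⟨rfl, rfl⟩, fun z hz => hz.2⟩
      qj := fun v => rfl
      qι := fun v => rfl
      αj := fun v => rfl }
  let t : ℕ → St E j ι := fun n => Nat.rec (F s0 0) (fun n s => F s (n + 1)) n
  have ht0 : t 0 = F s0 0 := rfl
  have htS : ∀ n, t (n + 1) = F (t n) (n + 1) := fun n => rfl
  have hgood : ∀ n, (t n).K n ∧ (t n).G (d n) ∧ (t n).swap.K n ∧ (t n).swap.G (d n) := by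
    intro n
    cases n with
    | zero => rw [ht0]; exact (hF s0 0).2
    | succ n => rw [htS]; exact (hF _ _).2
  have hnxt : ∀ n, Nxt (t n) (t (n + 1)) := fun n => by rw [htS]; exact (hF _ _).1
  have hnxt' : ∀ m n, m < n → Nxt (t m) (t n) := by
    intro m n hmn
    induction n, hmn using Nat.le_induction with
    | base => exact hnxt m
    | succ n hmn ih => exact ih.trans (hnxt n)
  have hpst : ∀ m n, m ≤ n → (∀ x, (t n).a ((t m).π ((t n).a.symm x)) =
      (t m).a ((t m).π ((t m).a.symm x))) ∧ (∀ x, (t n).b ((t m).π ((t n).b.symm x)) =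
      (t m).b ((t m).π ((t m).b.symm x))) := by
    intro m n hmn
    rcases hmn.eq_or_lt with rfl | hlt
    · exact ⟨fun _ => rfl, fun _ => rfl⟩
    · have := (hnxt' m n hlt).w _ (t m).ππ (t m).D
      exact this.2.2
  let g : ℕ → X → X := fun n x => (t n).b ((t n).a.symm x)
  let g' : ℕ → X → X := fun n x => (t n).a ((t n).b.symm x)
  have hgg' : ∀ n x, g n (g' n x) = x := fun n x => by simp [g, g']
  have hg'g : ∀ n x, g' n (g n x) = x := fun n x => by simp [g, g']
  have hg : ∀ x, ∃ y, ∀ m n, m ≤ n → d m y = d m (g n x) := fun x =>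
    hd.lim (g := fun n => g n x) fun n => St.hstep (hnxt n) (hgood n).2.2.2 x
  have hg' : ∀ x, ∃ y, ∀ m n, m ≤ n → d m y = d m (g' n x) := fun x =>
    hd.lim (g := fun n => g' n x) fun n => St.hstep (hnxt n).swap (hgood n).2.1 x
  choose h hh using hg
  choose h' hh' using hg'
  have hgc : ∀ n, Continuous (g n) := fun n => (t n).b.continuous.comp (t n).a.symm.continuous
  have hgc' : ∀ n, Continuous (g' n) := fun n => (t n).a.continuous.comp (t n).b.symm.continuous
  have hc : Continuous h := hd.cont fun n => by
    have := lc_pre (hd.lc n) (hgc n)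
    have e : (fun z => d n (h z)) = fun z => d n (g n z) := by
      funext z; exact hh z n n le_rfl
    rw [e]; exact this
  have hc' : Continuous h' := hd.cont fun n => by
    have := lc_pre (hd.lc n) (hgc' n)
    have e : (fun z => d n (h' z)) = fun z => d n (g' n z) := by
      funext z; exact hh' z n n le_rfl
    rw [e]; exact this
  -- eventual closeness
  have hev : ∀ x (U : Set X), U ∈ 𝓝 (h x) → ∃ n0, ∀ n, n0 ≤ n → g n x ∈ U := by
    intro x U hU
    obtain ⟨m, hm⟩ := hd.nhd hU
    exact ⟨m, fun n hn => hm _ (hh x m n hn).symm⟩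
  have hev' : ∀ x (U : Set X), U ∈ 𝓝 (h' x) → ∃ n0, ∀ n, n0 ≤ n → g' n x ∈ U := by
    intro x U hU
    obtain ⟨m, hm⟩ := hd.nhd hU
    exact ⟨m, fun n hn => hm _ (hh' x m n hn).symm⟩
  have hinv1 : ∀ x, h (h' x) = x := by
    intro x
    apply hd.sep
    intro m
    obtain ⟨n0, hn0⟩ := hev' x _ (lc_iff.1 (lc_pre (hd.lc m) hc) (h' x))
    have h1 : d m (h (g' (max m n0) x)) = d m (h (h' x)) := hn0 _ (le_max_right _ _)
    rw [← h1, hh _ m (max m n0) (le_max_left _ _), hgg']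
  have hinv2 : ∀ x, h' (h x) = x := by
    intro x
    apply hd.sep
    intro m
    obtain ⟨n0, hn0⟩ := hev x _ (lc_iff.1 (lc_pre (hd.lc m) hc') (h x))
    have h1 : d m (h' (g (max m n0) x)) = d m (h' (h x)) := hn0 _ (le_max_right _ _)
    rw [← h1, hh' _ m (max m n0) (le_max_left _ _), hg'g]
  let H : X ≃ₜ X := ⟨⟨h, h', hinv2, hinv1⟩, hc, hc'⟩
  have hp : ∀ n x, h ((t n).a ((t n).π ((t n).a.symm x))) =
      (t n).b ((t n).π ((t n).b.symm (h x))) := by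
    intro n x
    apply hd.sep
    intro m
    have hpc : Continuous (fun x => (t n).b ((t n).π ((t n).b.symm x))) :=
      (t n).b.continuous.comp ((t n).πc.comp (t n).b.symm.continuous)
    obtain ⟨n0, hn0⟩ := hev x _ (lc_iff.1 (lc_pre (hd.lc m) hpc) (h x))
    let l := max m (max n n0)
    have hl1 : m ≤ l := le_max_left _ _
    have hl2 : n ≤ l := (le_max_left _ _).trans (le_max_right _ _)
    have hl3 : n0 ≤ l := (le_max_right _ _).trans (le_max_right _ _)
    have h1 : d m ((t n).b ((t n).π ((t n).b.symm (g l x)))) =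
      d m ((t n).b ((t n).π ((t n).b.symm (h x)))) := hn0 l hl3
    rw [← h1, hh _ m l hl1, ← (hpst n l hl2).1, ← (hpst n l hl2).2]
    simp only [g, Homeomorph.symm_apply_apply]
  refine ⟨H, ?_, ?_⟩
  · intro v
    apply hd.sep
    intro m
    show d m (h (j v)) = _
    rw [hh _ m m le_rfl]
    have h1 := (t m).αj v
    have h2 := (hgood m).2.2.2 _ _ h1
    have h3 : d m ((t m).b ((t m).a.symm (j v))) = d m ((t m).b ((t m).b.symm (ι v))) := h2
    rw [(t m).b.apply_symm_apply] at h3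
    exact h3
  · intro x y
    constructor
    · rintro ⟨n, hn⟩
      have h1 := (hgood n).1 x y hn
      have h2 : (t n).b ((t n).π ((t n).b.symm (h x))) = (t n).b ((t n).π ((t n).b.symm (h y))) := by
        rw [← hp, ← hp, h1]
      have h3 := (t n).kk _ _ ((t n).b.injective h2)
      have h4 := (t n).bk ((t n).b.symm (h x))
      have h5 := (t n).bk ((t n).b.symm (h y))
      rw [(t n).b.apply_symm_apply] at h4 h5
      exact ⟨(t n).k, (hE _).trans ((hE _).symm h4) ((hE _).trans h3 h5)⟩
    · rintro ⟨n, hn⟩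
      have h1 : (t n).π ((t n).b.symm (h x)) = (t n).π ((t n).b.symm (h y)) :=
        (hgood n).2.2.1 _ _ hn
      have h2 : (t n).a ((t n).π ((t n).a.symm x)) = (t n).a ((t n).π ((t n).a.symm y)) := by
        apply H.injective
        show h _ = h _
        rw [hp, hp, h1]
      have h3 := (t n).kk _ _ ((t n).a.injective h2)
      have h4 := (t n).ak ((t n).a.symm x)
      have h5 := (t n).ak ((t n).a.symm y)
      rw [(t n).a.apply_symm_apply] at h4 h5
      exact ⟨(t n).k, (hE _).trans ((hE _).symm h4) ((hE _).trans h3 h5)⟩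

end BF
end Absorb

open Set Topology MeasureTheory

namespace Absorb
open Filter
set_option linter.all false
set_option linter.deprecated false

section Stage
variable {X : Type*} [TopologicalSpace X] [CompactSpace X] [T2Space X] [TotallyDisconnectedSpace X]
variable {V : Type*} [TopologicalSpace V] [CompactSpace V] [T2Space V] [TotallyDisconnectedSpace V]

def Bis (Q : V → V → Prop) (E : X → X → Prop) (β : V → ℕ) (b : X → ℕ) : Prop :=
  (∀ v v' x, Q v v' → b x = β v → ∃ x', E x x' ∧ b x' = β v') ∧
  (∀ v x x', E x x' → b x = β v → b x' ≠ 0 → ∃ v', Q v v' ∧ β v' = b x')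

structure Stg (E : ℕ → X → X → Prop) (Q : ℕ → V → V → Prop) (P : V → V → Prop) (n : ℕ) where
  k : ℕ
  β : V → ℕ
  b : X → ℕ
  l : X → ℕ
  βl : IsLocallyConstant β
  bl : IsLocallyConstant b
  ll : IsLocallyConstant l
  β0 : ∀ v, β v ≠ 0
  s1a : ∀ v, ∃ x, b x = β v
  s1b : ∀ x, b x ≠ 0 → ∃ v, β v = b x
  bis : Bis (Q n) (E k) β b
  s4x : ∀ x x', E k x x' → b x ≠ 0 → b x = b x' → x = x'
  s4v : ∀ v v', Q n v v' → β v = β v' → v = v'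
  s6 : ∀ v v' w w', Q n v v' → Q n w w' → β v = β w → β v' = β w' → P v v' → P w w'
  l1 : ∀ x, b x ≠ 0 → l x = b x
  l2 : ∀ x, l x ≠ 0 → ∃ u, E k x u ∧ b u = l x
  l3 : ∀ x u, E k x u → b u ≠ 0 → l x ≠ 0

variable {E : ℕ → X → X → Prop} {Q : ℕ → V → V → Prop} {P : V → V → Prop}

structure Stp (Y : Set X) {A B : Type*} (γ : X → A) (δ : V → B) {n : ℕ}
    (s : Stg E Q P n) (s' : Stg E Q P (n + 1)) : Prop where
  kk : s.k < s'.k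
  R : ∀ v x, s'.β v = s'.b x → s.β v = s.b x
  pres : ∀ i l, i ≤ n → l ≤ s.k → Bis (Q i) (E l) s.β s.b → Bis (Q i) (E l) s'.β s'.b
  meshX : ∀ x y, s'.b x ≠ 0 → s'.b x = s'.b y → γ x = γ y
  meshV : ∀ v w, s'.β v = s'.β w → δ v = δ w
  inv : ∀ x x', E s.k x x' → s'.b x ≠ 0 → s.b x' ≠ 0 → s'.b x' ≠ 0
  lab : ∀ x y, (∀ u, E s.k x u → s'.b u = 0) → E s.k x y → s'.l x = s'.l y
  coh : ∀ x u, E s.k x u → s'.b u ≠ 0 → ∃ w, E s.k x w ∧ s.b w = s.l x ∧ s'.b w = s'.l x ∧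
    s'.b w ≠ 0
  Yz : ∀ y ∈ Y, ∀ x, E s'.k y x → s'.b x = 0
  cnt : ∃ M C D : ℕ, (∀ x, {y | E s.k x y}.ncard ≤ D) ∧
    (∀ x, ({y | E s'.k x y} ∩ {y | s'.b y ≠ 0}).ncard ≤ C) ∧ (n + 2) * (C * D + 1) ≤ M ∧
    ∀ u, s'.b u ≠ 0 → ∃ f : Fin M → X, (∀ i, E s'.k u (f i) ∧ s'.l (f i) = s'.b u ∧
      ∀ z, E s.k (f i) z → s'.b z = 0) ∧ ∀ i j, i ≠ j → ¬ E s.k (f i) (f j)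

theorem exists_rep {A : Type*} {S : A → A → Prop} (hS : Equivalence S) :
    ∃ ρ : A → A, (∀ v, S v (ρ v)) ∧ ∀ v w, S v w → ρ v = ρ w := by
  let st : Setoid A := ⟨S, hS⟩
  refine ⟨fun v => (Quotient.mk st v).out, fun v => ?_, fun v w h => ?_⟩
  · exact hS.symm (Quotient.exact (Quotient.out_eq (Quotient.mk st v)))
  · have : Quotient.mk st v = Quotient.mk st w := Quotient.sound h
    simp only [this]

theorem stg_step (hE : ∀ n, IsCE (E n)) (hmono : ∀ m n, m ≤ n → ∀ x y, E m x y → E n x y)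
    (hmin : ∀ B : Set X, IsClopen B → B.Nonempty → ∃ n, ∀ x, ∃ y ∈ B, E n x y)
    (hperf : ∀ B : Set X, IsClopen B → B.Nonempty → B.Infinite)
    {Y : Set X} (hY : IsClosed Y) (hYm : ∀ k, ∃ x, ∀ y ∈ Y, ¬ E k x y)
    (hQ : ∀ n, IsCE (Q n)) (hQmono : ∀ m n, m ≤ n → ∀ x y, Q m x y → Q n x y)
    (hPQ : ∀ n, IsCE (fun v w => P v w ∧ Q n v w))
    {n : ℕ} (s : Stg E Q P n) {A B : Type*} {γ : X → A} (hγ : IsLocallyConstant γ)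
    {δ : V → B} (hδ : IsLocallyConstant δ) : ∃ s' : Stg E Q P (n + 1), Stp Y γ δ s s' := by
  classical
  -- the coloring β'
  obtain ⟨β0, hβ0l, hβ0a, hβ0s, hβ0h⟩ := (hQ (n + 1)).homog (I := Option (Fin (n + 1)))
    (F := fun i => match i with
      | none => fun v w => P v w ∧ Q (n + 1) v w
      | some i => Q i) (by
        intro i; cases i with
        | none => exact hPQ _
        | some i => exact hQ _) (by
        intro i; cases i with
        | none => exact fun x y h => h.2
        | some i => exact fun x y h => hQmono _ _ (by omega) x y h) (lc_prod s.βl hδ)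
  obtain ⟨β', hβ'⟩ : ∃ β' : V → ℕ, β' = fun v => β0 v + 1 := ⟨_, rfl⟩
  have hββ : ∀ v w, β' v = β' w ↔ β0 v = β0 w := by intro v w; simp [hβ']
  have hβ'0 : ∀ v, β' v ≠ 0 := by intro v; simp [hβ']
  have hβ'l : IsLocallyConstant β' := by rw [hβ']; exact lc_comp hβ0l (fun i => i + 1)
  have hβa : ∀ v w, β' v = β' w → s.β v = s.β w ∧ δ v = δ w := by
    intro v w h
    have := hβ0a v w ((hββ _ _).1 h)
    exact ⟨congrArg Prod.fst this, congrArg Prod.snd this⟩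
  have hβs : ∀ v w, Q (n + 1) v w → β' v = β' w → v = w := fun v w h h' =>
    hβ0s v w h ((hββ _ _).1 h')
  have hβh : ∀ v w v', β' v = β' w → Q (n + 1) v v' → ∃ w', Q (n + 1) w w' ∧ β' w' = β' v' ∧
      (∀ i, i ≤ n + 1 → (Q i v v' ↔ Q i w w')) ∧ (P v v' → P w w') := by
    intro v w v' h h'
    obtain ⟨w', h1, h2, h3⟩ := hβ0h v w v' ((hββ _ _).1 h) h'
    refine ⟨w', h1, (hββ _ _).2 h2, ?_, ?_⟩
    · intro i hi
      rcases Nat.lt_or_ge i (n + 1) with hi' | hi'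
      · exact h3 (some ⟨i, hi'⟩)
      · have : i = n + 1 := by omega
        subst this
        exact ⟨fun _ => h1, fun _ => h'⟩
    · intro hp
      exact ((h3 none).1 ⟨hp, h'⟩).1
  -- the equivalence relations S
  have hS : ∀ i, i ≤ n + 1 → Equivalence (fun v w => ∃ w', Q i v w' ∧ β' w' = β' w) := by
    intro i hi
    refine ⟨fun v => ⟨v, (hQ i).refl v, rfl⟩, ?_, ?_⟩
    · rintro v w ⟨w', h1, h2⟩
      obtain ⟨v', e1, e2, e3, -⟩ := hβh w' w v h2 (hQmono _ _ hi _ _ ((hQ i).symm h1))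
      exact ⟨v', (e3 i hi).1 ((hQ i).symm h1), e2⟩
    · rintro u v w ⟨v', h1, h2⟩ ⟨w', h3, h4⟩
      obtain ⟨w'', e1, e2, e3, -⟩ := hβh v v' w' h2.symm (hQmono _ _ hi _ _ h3)
      exact ⟨w'', (hQ i).trans h1 ((e3 i hi).1 h3), e2.trans h4⟩
  obtain ⟨S, hSdef⟩ : ∃ S : ℕ → V → V → Prop, ∀ i v w, S i v w ↔ ∃ w', Q i v w' ∧ β' w' = β' w :=
    ⟨_, fun _ _ _ => Iff.rfl⟩
  have hSe : ∀ i, i ≤ n + 1 → Equivalence (S i) := by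
    intro i hi
    have : S i = (fun v w => ∃ w', Q i v w' ∧ β' w' = β' w) := by
      funext v w; exact propext (hSdef i v w)
    rw [this]; exact hS i hi
  have hSQ : ∀ i v w, Q i v w → S i v w := fun i v w h => (hSdef i v w).2 ⟨w, h, rfl⟩
  have hSβ : ∀ i v w, β' v = β' w → S i v w := fun i v w h => (hSdef i v w).2 ⟨v, (hQ i).refl v, h⟩
  have hSS : ∀ v w, S n v w → S (n + 1) v w := by
    intro v w h
    obtain ⟨w', h1, h2⟩ := (hSdef _ _ _).1 h
    exact (hSdef _ _ _).2 ⟨w', hQmono _ _ (by omega) _ _ h1, h2⟩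
  obtain ⟨ρ, hρ1, hρ2⟩ := exists_rep (hSe n (by omega))
  obtain ⟨τ, hτ1, hτ2⟩ := exists_rep (hSe (n + 1) le_rfl)
  -- numbers
  obtain ⟨D0, hD0⟩ := (hE s.k).finite
  have hJf : (range β').Finite := lc_fin hβ'l
  haveI : Finite (range β') := hJf
  let C := (range β').ncard
  let M := (n + 2) * (C * D0 + 1)
  let J := range β'
  have hvv : ∀ j : J, ∃ v, β' v = j := fun j => j.2
  choose vv hvv using hvv
  let jj : V → J := fun v => ⟨β' v, v, rfl⟩
  have hjj : ∀ v, s.β (vv (jj v)) = s.β v := fun v => (hβa _ _ (hvv (jj v))).1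
  -- the points g_a and clopen sets G_a
  have hSa : ∀ a : J × Fin (M + 1), {x | s.b x = s.β (vv a.1)}.Infinite := by
    intro a
    obtain ⟨x, hx⟩ := s.s1a (vv a.1)
    exact hperf _ (lc_clopen s.bl {s.β (vv a.1)}) ⟨x, hx⟩
  have hEk : ∀ k, Equivalence (E k) := fun k => ⟨(hE k).refl, (hE k).symm, (hE k).trans⟩
  obtain ⟨g, hg1, hg2⟩ := pick (hEk s.k) (fun x => (hD0 x).1) hSa
  obtain ⟨D1, ω1, p1, p2, p3, p4, p5, p6, p7, p8, p9⟩ := (hE s.k).pull (I := Empty)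
    (F := fun i => i.elim) (fun i => i.elim) (fun i => i.elim) s.bl
    (Ω := ⋃ a, {y | E s.k (g a) y}) (finite_iUnion fun a => (hD0 _).1) (by
      intro x hx y hxy
      simp only [mem_iUnion, mem_setOf_eq] at hx ⊢
      obtain ⟨a, ha⟩ := hx
      exact ⟨a, (hE s.k).trans ha hxy⟩)
  have hgΩ : ∀ a, g a ∈ ⋃ a, {y | E s.k (g a) y} := fun a => mem_iUnion.2 ⟨a, (hE s.k).refl _⟩
  let G : J × Fin (M + 1) → Set X := fun a => D1 ∩ ω1 ⁻¹' {g a}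
  have hGc : ∀ a, IsClopen (G a) := fun a => p1.inter (lc_clopen p6 _)
  have hGn : ∀ a, (G a).Nonempty := fun a => ⟨g a, p2 (hgΩ a), p5 _ (hgΩ a)⟩
  have hGb : ∀ a, ∀ x ∈ G a, s.b x = s.β (vv a.1) := by
    rintro a x ⟨h1, h2⟩
    have h3 : ω1 x = g a := h2
    rw [← p7 x h1, h3]; exact hg1 a
  have hGE : ∀ a a' x y, x ∈ G a → y ∈ G a' → E s.k x y → a = a' := by
    rintro a a' x y ⟨h1, h2⟩ ⟨h3, h4⟩ hxy
    by_contra hne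
    have h5 := (p8 x h1 y hxy).1
    have e1 : ω1 x = g a := h2
    have e2 : ω1 y = g a' := h4
    rw [e1, e2] at h5
    exact hg2 a a' hne h5
  -- level k'
  obtain ⟨k', hkk', hk'⟩ : ∃ k', s.k < k' ∧ ∀ a x, ∃ y ∈ G a, E k' x y := by
    have : ∀ a, ∃ n, ∀ x, ∃ y ∈ G a, E n x y := fun a => hmin _ (hGc a) (hGn a)
    choose N hN using this
    obtain ⟨m, hm⟩ := (finite_range N).bddAbove
    refine ⟨max m (s.k + 1), by omega, fun a x => ?_⟩
    obtain ⟨y, h1, h2⟩ := hN a x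
    exact ⟨y, h1, hmono _ _ ((hm ⟨a, rfl⟩).trans (le_max_left _ _)) _ _ h2⟩
  have hkE : ∀ x y, E s.k x y → E k' x y := fun x y => hmono _ _ hkk'.le x y
  -- points o_t
  have hoff : {x | ∀ y ∈ Y, ¬ E k' x y}.Infinite := by
    obtain ⟨x, hx⟩ := hYm k'
    have ho : IsOpen {x | ∀ y ∈ Y, ¬ E k' x y} := by
      have := ((hE k').satClosed hY).isOpen_compl
      convert this using 1
      ext x; simp
    obtain ⟨W, h1, h2, h3⟩ := clopen_nhd (ho.mem_nhds hx)
    exact (hperf W h1 ⟨x, h2⟩).mono h3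
  obtain ⟨o, ho1, ho2⟩ := pick (hEk k') (fun x => (hE k').fin x) (ι := J) (fun _ => hoff)
  have hY0 : ∀ (t r : J), ∃ y ∈ G (r, 0), E k' (o t) y := fun t r => hk' (r, 0) (o t)
  choose Y0 hY0G hY0E using hY0
  let y0 : V → X := fun v => Y0 (jj (τ v)) (jj (ρ v))
  have hx : ∀ v, ∃ x, E s.k (y0 v) x ∧ s.b x = s.β v := by
    intro v
    obtain ⟨w', h1, h2⟩ := (hSdef _ _ _).1 (hρ1 v)
    have h3 : s.b (y0 v) = s.β w' := by
      rw [hGb _ _ (hY0G (jj (τ v)) (jj (ρ v)))]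
      show s.β (vv (jj (ρ v))) = _
      rw [hjj, (hβa _ _ h2).1]
    exact s.bis.1 w' v _ ((hQ n).symm h1) h3
  choose x hx1 hx2 using hx
  have hxb : ∀ v, s.b (x v) ≠ 0 := fun v => by rw [hx2]; exact s.β0 v
  have hjje : ∀ v w, β' v = β' w → jj v = jj w := fun v w h => Subtype.ext h
  have hjje' : ∀ v w, jj v = jj w → β' v = β' w := fun v w h => congrArg Subtype.val h
  have hy0 : ∀ v w, S n v w → y0 v = y0 w := by
    intro v w h
    show Y0 _ _ = Y0 _ _
    rw [hρ2 v w h, hτ2 v w (hSS v w h)]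
  have hx5 : ∀ v w, S n v w → E s.k (x v) (x w) := by
    intro v w h
    have := hx1 v
    rw [hy0 v w h] at this
    exact (hE _).trans ((hE _).symm this) (hx1 w)
  have hx5' : ∀ v w, E s.k (x v) (x w) → S n v w := by
    intro v w h
    have h1 : E s.k (y0 v) (y0 w) :=
      (hE _).trans (hx1 v) ((hE _).trans h ((hE _).symm (hx1 w)))
    have h2 := hGE _ _ _ _ (hY0G _ _) (hY0G _ _) h1
    have h3 : β' (ρ v) = β' (ρ w) := hjje' _ _ (congrArg Prod.fst h2)
    have e := hSe n (by omega)
    exact e.trans (hρ1 v) (e.trans (hSβ n _ _ h3) (e.symm (hρ1 w)))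
  have hox : ∀ v, E k' (o (jj (τ v))) (x v) := fun v =>
    (hE k').trans (hY0E _ _) (hkE _ _ (hx1 v))
  have hx4 : ∀ v w, S (n + 1) v w → E k' (x v) (x w) := by
    intro v w h
    have := hox v
    rw [hτ2 v w h] at this
    exact (hE _).trans ((hE _).symm this) (hox w)
  have hx4' : ∀ v w, E k' (x v) (x w) → S (n + 1) v w := by
    intro v w h
    have h1 : E k' (o (jj (τ v))) (o (jj (τ w))) :=
      (hE _).trans (hox v) ((hE _).trans h ((hE _).symm (hox w)))
    have h2 : jj (τ v) = jj (τ w) := by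
      by_contra hne
      exact ho2 _ _ hne h1
    have e := hSe (n + 1) le_rfl
    exact e.trans (hτ1 v) (e.trans (hSβ _ _ _ (hjje' _ _ h2)) (e.symm (hτ1 w)))
  have hx3 : ∀ v w, β' v = β' w → x v = x w := by
    intro v w h
    refine s.s4x _ _ (hx5 v w (hSβ n v w h)) (hxb v) ?_
    rw [hx2, hx2, (hβa _ _ h).1]
  have hx6 : ∀ v w, x v = x w → β' v = β' w := by
    intro v w h
    have h1 := hx5' v w (by rw [h]; exact (hE _).refl _)
    obtain ⟨w', h2, h3⟩ := (hSdef _ _ _).1 h1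
    have h4 : s.β v = s.β w' := by
      rw [(hβa _ _ h3).1, ← hx2, ← hx2, h]
    rw [s.s4v _ _ h2 h4, h3]
  have hx7 : ∀ i l, i ≤ n → l ≤ s.k → Bis (Q i) (E l) s.β s.b →
      (∀ v v', Q i v v' → E l (x v) (x v')) ∧
      ∀ v v', E l (x v) (x v') → ∃ v'', Q i v v'' ∧ β' v'' = β' v' := by
    intro i l hi hl hb
    constructor
    · intro v v' h
      obtain ⟨x'', e1, e2⟩ := hb.1 v v' (x v) h (hx2 v)
      have e3 := hx5 v v' (hSQ n v v' (hQmono _ _ hi _ _ h))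
      have e4 := hmono _ _ hl _ _ e1
      have e5 : x'' = x v' := s.s4x _ _ ((hE _).trans ((hE _).symm e4) e3)
        (by rw [e2]; exact s.β0 _) (by rw [e2, hx2])
      rw [← e5]; exact e1
    · intro v v' h
      obtain ⟨w', e1, e2⟩ := (hSdef _ _ _).1 (hx5' v v' (hmono _ _ hl _ _ h))
      obtain ⟨v'', f1, f2⟩ := hb.2 v (x v) (x v') h (hx2 v) (hxb v')
      have e3 : v'' = w' := by
        refine s.s4v _ _ ((hQ n).trans ((hQ n).symm (hQmono _ _ hi _ _ f1)) e1) ?_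
        rw [f2, hx2, (hβa _ _ e2).1]
      exact ⟨v'', f1, by rw [e3, e2]⟩
  have hinv : ∀ v u, E s.k (x v) u → s.b u ≠ 0 → ∃ v', Q n v v' ∧ u = x v' := by
    intro v u h hu
    obtain ⟨v', h1, h2⟩ := s.bis.2 v (x v) u h (hx2 v) hu
    refine ⟨v', h1, s.s4x _ _ ?_ hu ?_⟩
    · exact (hE _).trans ((hE _).symm h) (hx5 v v' (hSQ n v v' h1))
    · rw [hx2, h2]
  -- Ω
  let Ω : Set X := {y | ∃ v, E k' (x v) y}
  have hΩf : Ω.Finite := by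
    have : Ω ⊆ ⋃ j : J, {y | E k' (x (vv j)) y} := by
      rintro y ⟨v, hv⟩
      refine mem_iUnion.2 ⟨jj v, ?_⟩
      show E k' (x (vv (jj v))) y
      rw [hx3 _ v (hvv (jj v))]; exact hv
    exact (finite_iUnion fun j => (hE k').fin _).subset this
  have hΩinv : ∀ x ∈ Ω, ∀ y, E k' x y → y ∈ Ω := by
    rintro z ⟨v, hv⟩ y hy
    exact ⟨v, (hE _).trans hv hy⟩
  have hxΩ : ∀ v, x v ∈ Ω := fun v => ⟨v, (hE _).refl _⟩
  have hΩY : ∀ y ∈ Ω, y ∉ Y := by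
    rintro y ⟨v, hv⟩ hy
    exact ho1 _ y hy ((hE _).trans (hox v) hv)
  obtain ⟨W, hWc, hYW, hWΩ⟩ := clopen_between hY hΩf.isClosed.isOpen_compl
    (fun y hy hyΩ => hΩY y hyΩ hy)
  obtain ⟨D, ω, d1, d2, d3, d4, d5, d6, d7, d8, d9⟩ := (hE k').pull (I := Fin (s.k + 1))
    (F := fun i => E i) (fun i => hE _) (fun i => hmono _ _ (by omega))
    (lc_prod (lc_prod hγ s.bl) (lc_prod s.ll (lc_mem hWc))) hΩf hΩinv
  have dγ : ∀ z ∈ D, γ (ω z) = γ z := fun z hz => congrArg (fun p => p.1.1) (d7 z hz)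
  have db : ∀ z ∈ D, s.b (ω z) = s.b z := fun z hz => congrArg (fun p => p.1.2) (d7 z hz)
  have dl : ∀ z ∈ D, s.l (ω z) = s.l z := fun z hz => congrArg (fun p => p.2.1) (d7 z hz)
  have dW : ∀ z ∈ D, (ω z ∈ W) = (z ∈ W) := fun z hz => congrArg (fun p => p.2.2) (d7 z hz)
  have dE : ∀ l, l ≤ s.k → ∀ z ∈ D, ∀ y, E k' z y → (E l z y ↔ E l (ω z) (ω y)) := by
    intro l hl z hz y h
    exact (d8 z hz y h).2.2 ⟨l, by omega⟩
  have dY : ∀ y ∈ Y, y ∉ D := by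
    intro y hy hyD
    have : ω y ∈ W := by rw [dW y hyD]; exact hYW hy
    exact hWΩ this (d4 y hyD)
  -- bΩ
  obtain ⟨bΩ, hbΩ1, hbΩ2⟩ : ∃ bΩ : X → ℕ, (∀ v, bΩ (x v) = β' v) ∧
      ∀ y, bΩ y ≠ 0 → ∃ v, y = x v := by
    refine ⟨fun y => if h : ∃ v, y = x v then β' h.choose else 0, fun v => ?_, fun y hy => ?_⟩
    · have h : ∃ w, x v = x w := ⟨v, rfl⟩
      simp only [dif_pos h]
      exact (hx6 _ _ h.choose_spec).symm
    · by_contra h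
      simp only [dif_neg h] at hy
      exact hy rfl
  obtain ⟨b', hb'⟩ : ∃ b' : X → ℕ, ∀ z, b' z = if z ∈ D then bΩ (ω z) else 0 := ⟨_, fun _ => rfl⟩
  have hb'l : IsLocallyConstant b' := by
    have : b' = fun z => (fun p : Prop × X => if p.1 then bΩ p.2 else 0) (z ∈ D, ω z) := by
      funext z; exact hb' z
    rw [this]; exact lc_comp (lc_prod (lc_mem d1) d6) (fun p : Prop × X => if p.1 then bΩ p.2 else 0)
  have hb1 : ∀ z v, z ∈ D → ω z = x v → b' z = β' v := by
    intro z v h1 h2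
    rw [hb', if_pos h1, h2, hbΩ1]
  have hb2 : ∀ z, b' z ≠ 0 → z ∈ D ∧ ∃ v, ω z = x v ∧ b' z = β' v := by
    intro z h
    have h1 : z ∈ D := by
      by_contra h1; rw [hb', if_neg h1] at h; exact h rfl
    have h2 := h
    rw [hb', if_pos h1] at h2
    obtain ⟨v, hv⟩ := hbΩ2 _ h2
    exact ⟨h1, v, hv, hb1 z v h1 hv⟩
  have hb3 : ∀ z v, b' z = β' v → z ∈ D ∧ ω z = x v := by
    intro z v h
    obtain ⟨h1, w, h2, h3⟩ := hb2 z (by rw [h]; exact hβ'0 v)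
    exact ⟨h1, by rw [h2]; exact hx3 _ _ (h3.symm.trans h)⟩
  -- labels on Ω
  let A1 : X → Set ℕ := fun y => {j | ∃ w, E s.k y (x w) ∧ s.b (x w) = s.l y ∧ j = β' w}
  let A2 : X → Set ℕ := fun y => {j | ∃ v, j = β' v ∧ E k' (x v) y ∧
    ∃ m : Fin M, ∃ z ∈ G (jj v, m.succ), E s.k y z}
  let A3 : X → Set ℕ := fun y => {j | ∃ v, j = β' v ∧ E k' (x v) y}
  obtain ⟨lΩ, hlΩ⟩ : ∃ lΩ : X → ℕ, ∀ y, lΩ y = if ∃ v, E s.k y (x v) then sInf (A1 y) else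
      if (A2 y).Nonempty then sInf (A2 y) else sInf (A3 y) := ⟨_, fun _ => rfl⟩
  have hl1' : ∀ y v, E s.k y (x v) → ∃ w, E s.k y (x w) ∧ s.b (x w) = s.l y ∧ lΩ y = β' w := by
    intro y v h
    have hne : (A1 y).Nonempty := by
      obtain ⟨u, h1, h2⟩ := s.l2 y (s.l3 y (x v) h (hxb v))
      obtain ⟨v', h3, h4⟩ := hinv v u ((hE _).trans ((hE _).symm h) h1)
        (by rw [h2]; exact s.l3 y (x v) h (hxb v))
      exact ⟨β' v', v', by rw [← h4]; exact h1, by rw [← h4]; exact h2, rfl⟩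
    have h5 : lΩ y = sInf (A1 y) := by rw [hlΩ, if_pos ⟨v, h⟩]
    obtain ⟨w, h1, h2, h3⟩ := Nat.sInf_mem hne
    exact ⟨w, h1, h2, by rw [h5, h3]⟩
  have hl1 : ∀ v, lΩ (x v) = β' v := by
    intro v
    obtain ⟨w, h1, h2, h3⟩ := hl1' (x v) v ((hE _).refl _)
    rw [h3]
    rw [s.l1 _ (hxb v)] at h2
    exact hx6 _ _ (s.s4x _ _ h1 (hxb v) h2.symm).symm
  have hl2 : ∀ y ∈ Ω, ∃ w, E k' y (x w) ∧ lΩ y = β' w := by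
    rintro y ⟨v, hv⟩
    by_cases h : ∃ v, E s.k y (x v)
    · obtain ⟨v', h'⟩ := h
      obtain ⟨w, h1, h2, h3⟩ := hl1' y v' h'
      exact ⟨w, hkE _ _ h1, h3⟩
    · rw [hlΩ, if_neg h]
      by_cases h2 : (A2 y).Nonempty
      · rw [if_pos h2]
        obtain ⟨w, h3, h4, -⟩ := Nat.sInf_mem h2
        exact ⟨w, (hE _).symm h4, h3⟩
      · rw [if_neg h2]
        have h3 : (A3 y).Nonempty := ⟨β' v, v, rfl, hv⟩
        obtain ⟨w, h3, h4⟩ := Nat.sInf_mem h3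
        exact ⟨w, (hE _).symm h4, h3⟩
  have hl4 : ∀ y y', (¬ ∃ v, E s.k y (x v)) → E s.k y y' → lΩ y = lΩ y' := by
    intro y y' h hyy
    have h' : ¬ ∃ v, E s.k y' (x v) := fun ⟨v, hv⟩ => h ⟨v, (hE _).trans hyy hv⟩
    have e2 : A2 y = A2 y' := by
      ext j
      constructor
      · rintro ⟨v, h1, h2, m, z, h3, h4⟩
        exact ⟨v, h1, (hE _).trans h2 (hkE _ _ hyy), m, z, h3, (hE _).trans ((hE _).symm hyy) h4⟩
      · rintro ⟨v, h1, h2, m, z, h3, h4⟩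
        exact ⟨v, h1, (hE _).trans h2 (hkE _ _ ((hE _).symm hyy)), m, z, h3, (hE _).trans hyy h4⟩
    have e3 : A3 y = A3 y' := by
      ext j
      constructor
      · rintro ⟨v, h1, h2⟩
        exact ⟨v, h1, (hE _).trans h2 (hkE _ _ hyy)⟩
      · rintro ⟨v, h1, h2⟩
        exact ⟨v, h1, (hE _).trans h2 (hkE _ _ ((hE _).symm hyy))⟩
    rw [hlΩ, hlΩ, if_neg h, if_neg h', e2, e3]
  have hgx : ∀ (j : J) (m : Fin M) z w, z ∈ G (j, m.succ) → ¬ E s.k z (x w) := by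
    intro j m z w hz h
    have h1 : E s.k z (y0 w) := (hE _).trans h ((hE _).symm (hx1 w))
    have h2 := hGE _ _ _ _ hz (hY0G _ _) h1
    have h3 : m.succ = 0 := congrArg Prod.snd h2
    exact Fin.succ_ne_zero m h3
  have hl5 : ∀ v (m : Fin M) z, z ∈ G (jj v, m.succ) → E k' (x v) z → lΩ z = β' v := by
    intro v m z hz hvz
    have h : ¬ ∃ w, E s.k z (x w) := fun ⟨w, hw⟩ => hgx _ m z w hz hw
    have h2 : (A2 z).Nonempty := ⟨β' v, v, rfl, hvz, m, z, hz, (hE _).refl _⟩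
    rw [hlΩ, if_neg h, if_pos h2]
    obtain ⟨w, h3, h4, m', z', h5, h6⟩ := Nat.sInf_mem h2
    have h7 := hGE _ _ _ _ hz h5 h6
    rw [h3]
    exact (hjje' _ _ (congrArg Prod.fst h7)).symm
  obtain ⟨l', hl'⟩ : ∃ l' : X → ℕ, ∀ z, l' z = if z ∈ D then lΩ (ω z) else 0 := ⟨_, fun _ => rfl⟩
  have hl'l : IsLocallyConstant l' := by
    have : l' = fun z => (fun p : Prop × X => if p.1 then lΩ p.2 else 0) (z ∈ D, ω z) := by
      funext z; exact hl' z
    rw [this]; exact lc_comp (lc_prod (lc_mem d1) d6) (fun p : Prop × X => if p.1 then lΩ p.2 else 0)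
  -- transfer of Bis
  have hbis : ∀ (Qi : V → V → Prop) (F : X → X → Prop), (∀ z y, F z y → E k' z y) →
      (∀ z ∈ D, ∀ y, E k' z y → (F z y ↔ F (ω z) (ω y))) →
      (∀ v v', Qi v v' → F (x v) (x v')) →
      (∀ v v', F (x v) (x v') → ∃ v'', Qi v v'' ∧ β' v'' = β' v') → Bis Qi F β' b' := by
    intro Qi F hF1 hF2 h1 h2
    constructor
    · intro v v' z hq hz
      obtain ⟨hzD, hzx⟩ := hb3 z v hz
      have h3 := h1 v v' hq
      rw [← hzx] at h3
      obtain ⟨u, h4, h5⟩ := d9 z hzD _ (hF1 _ _ h3)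
      refine ⟨u, ?_, hb1 u v' (d3 z hzD u h4) h5⟩
      rw [hF2 z hzD u h4, h5]; exact h3
    · intro v z z' hzz hz hz'
      obtain ⟨hzD, hzx⟩ := hb3 z v hz
      obtain ⟨hzD', v', hzx', hb''⟩ := hb2 z' hz'
      have h3 := (hF2 z hzD z' (hF1 _ _ hzz)).1 hzz
      rw [hzx, hzx'] at h3
      obtain ⟨v'', h4, h5⟩ := h2 v v' h3
      exact ⟨v'', h4, by rw [h5, hb'']⟩
  have hDinv : ∀ z y, E k' z y → (z ∈ D ↔ y ∈ D) := fun z y h =>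
    ⟨fun hz => d3 z hz y h, fun hy => d3 y hy z ((hE _).symm h)⟩
  have c4x : ∀ z z', E k' z z' → b' z ≠ 0 → b' z = b' z' → z = z' := by
    intro z z' h h1 h2
    obtain ⟨h3, v, h4, h5⟩ := hb2 z h1
    obtain ⟨h6, h7⟩ := hb3 z' v (by rw [← h2, h5])
    exact (d8 z h3 z' h).2.1 (by rw [h4, h7])
  let s' : Stg E Q P (n + 1) :=
    { k := k'
      β := β'
      b := b'
      l := l'
      βl := hβ'l
      bl := hb'l
      ll := hl'l
      β0 := hβ'0
      s1a := fun v => ⟨x v, hb1 _ v (d2 (hxΩ v)) (d5 _ (hxΩ v))⟩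
      s1b := fun z hz => by
        obtain ⟨-, v, -, h⟩ := hb2 z hz
        exact ⟨v, h.symm⟩
      bis := by
        refine hbis _ _ (fun _ _ h => h) ?_ ?_ ?_
        · intro z hz y h
          exact ⟨fun _ => (d8 z hz y h).1, fun _ => h⟩
        · intro v v' h
          exact hx4 v v' (hSQ _ _ _ h)
        · intro v v' h
          exact (hSdef _ _ _).1 (hx4' v v' h)
      s4x := c4x
      s4v := hβs
      s6 := by
        intro v v' w w' h1 h2 h3 h4 hp
        obtain ⟨w'', e1, e2, -, e3⟩ := hβh v w v' h3 h1
        have : w'' = w' := hβs _ _ ((hQ _).trans ((hQ _).symm e1) h2) (e2.trans h4)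
        rw [← this]; exact e3 hp
      l1 := by
        intro z hz
        obtain ⟨h1, v, h2, h3⟩ := hb2 z hz
        rw [hl', if_pos h1, h2, hl1, h3]
      l2 := by
        intro z hz
        have h1 : z ∈ D := by
          by_contra h1; rw [hl', if_neg h1] at hz; exact hz rfl
        obtain ⟨w, h2, h3⟩ := hl2 _ (d4 z h1)
        obtain ⟨u, h4, h5⟩ := d9 z h1 _ h2
        refine ⟨u, h4, ?_⟩
        rw [hl', if_pos h1, h3]
        exact hb1 u w (d3 z h1 u h4) h5
      l3 := by
        intro z u h hu
        have h1 : z ∈ D := (hDinv z u h).2 (hb2 u hu).1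
        obtain ⟨w, h2, h3⟩ := hl2 _ (d4 z h1)
        rw [hl', if_pos h1, h3]
        exact hβ'0 w }
  refine ⟨s', hkk', ?_, ?_, ?_, ?_, ?_, ?_, ?_, ?_, ?_⟩
  · intro v z h
    obtain ⟨h1, h2⟩ := hb3 z v h.symm
    rw [← db z h1, h2, hx2]
  · intro i l hi hl hb
    obtain ⟨e1, e2⟩ := hx7 i l hi hl hb
    exact hbis _ _ (fun z y => hmono _ _ (hl.trans hkk'.le) z y) (dE l hl) e1 e2
  · intro z y h1 h2
    obtain ⟨h3, v, h4, h5⟩ := hb2 z h1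
    have h2' : b' z = b' y := h2
    obtain ⟨h6, h7⟩ := hb3 y v (by rw [← h2', h5])
    rw [← dγ z h3, ← dγ y h6, h4, h7]
  · intro v w h
    exact (hβa v w h).2
  · intro z z' h h1 h2
    obtain ⟨h3, v, h4, h5⟩ := hb2 z h1
    have h6 := (dE s.k le_rfl z h3 z' (hkE _ _ h)).1 h
    have h7 := d3 z h3 z' (hkE _ _ h)
    rw [h4] at h6
    obtain ⟨v', -, h8⟩ := hinv v _ h6 (by rw [db z' h7]; exact h2)
    show b' z' ≠ 0
    rw [hb1 z' v' h7 h8]; exact hβ'0 v'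
  · intro z y h hzy
    show l' z = l' y
    by_cases hz : z ∈ D
    · have hy := d3 z hz y (hkE _ _ hzy)
      rw [hl', hl', if_pos hz, if_pos hy]
      refine hl4 _ _ ?_ ((dE s.k le_rfl z hz y (hkE _ _ hzy)).1 hzy)
      rintro ⟨v, hv⟩
      obtain ⟨u, h1, h2⟩ := d9 z hz _ (hkE _ _ hv)
      have h3 : E s.k z u := by
        rw [dE s.k le_rfl z hz u h1, h2]; exact hv
      have h4 : b' u = 0 := h u h3
      rw [hb1 u v (d3 z hz u h1) h2] at h4
      exact hβ'0 v h4
    · have hy : y ∉ D := fun hy => hz ((hDinv z y (hkE _ _ hzy)).2 hy)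
      rw [hl', hl', if_neg hz, if_neg hy]
  · intro z u h hu
    obtain ⟨h1, v, h2, h3⟩ := hb2 u hu
    have hz : z ∈ D := (hDinv z u (hkE _ _ h)).2 h1
    have h4 := (dE s.k le_rfl z hz u (hkE _ _ h)).1 h
    rw [h2] at h4
    obtain ⟨w, e1, e2, e3⟩ := hl1' _ v h4
    obtain ⟨y, f1, f2⟩ := d9 z hz _ (hkE _ _ e1)
    have hy := d3 z hz y f1
    have f3 : b' y = β' w := hb1 y w hy f2
    refine ⟨y, ?_, ?_, ?_, ?_⟩
    · rw [dE s.k le_rfl z hz y f1, f2]; exact e1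
    · rw [← db y hy, f2, e2, dl z hz]
    · show b' y = l' z
      rw [f3, hl', if_pos hz, e3]
    · show b' y ≠ 0
      rw [f3]; exact hβ'0 w
  · intro y hy z h
    show b' z = 0
    by_contra hne
    exact dY y hy ((hDinv y z h).2 (hb2 z hne).1)
  · refine ⟨M, C, D0, fun z => (hD0 z).2, ?_, le_rfl, ?_⟩
    · intro z
      refine ncard_le_ncard_of_injOn b' ?_ ?_ hJf
      · rintro y ⟨-, hy⟩
        obtain ⟨-, v, -, h⟩ := hb2 y hy
        exact ⟨v, h.symm⟩
      · rintro y ⟨h1, h2⟩ y' ⟨h3, h4⟩ h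
        exact c4x y y' ((hE _).trans ((hE _).symm h1) h3) h2 h
    · intro u hu
      obtain ⟨h1, v, h2, h3⟩ := hb2 u hu
      have : ∀ i : Fin M, ∃ f, E k' u f ∧ ω f ∈ G (jj v, i.succ) ∧ E k' (x v) (ω f) := by
        intro i
        obtain ⟨y, e1, e2⟩ := hk' (jj v, i.succ) (x v)
        rw [← h2] at e2
        obtain ⟨f, e3, e4⟩ := d9 u h1 y e2
        rw [h2] at e2
        exact ⟨f, e3, by rw [e4]; exact e1, by rw [e4]; exact e2⟩
      choose f hf1 hf2 hf3 using this
      have hfD : ∀ i, f i ∈ D := fun i => d3 u h1 _ (hf1 i)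
      refine ⟨f, fun i => ⟨hf1 i, ?_, ?_⟩, ?_⟩
      · show l' (f i) = b' u
        rw [hl', if_pos (hfD i), hl5 v i _ (hf2 i) (hf3 i), h3]
      · intro z hz
        by_contra hne
        obtain ⟨-, w, e1, -⟩ := hb2 z hne
        have e2 := (dE s.k le_rfl _ (hfD i) z (hkE _ _ hz)).1 hz
        rw [e1] at e2
        exact hgx _ i _ w (hf2 i) e2
      · intro i i' hne h
        have e2 := (dE s.k le_rfl _ (hfD i) _ (hkE _ _ h)).1 h
        have e3 := hGE _ _ _ _ (hf2 i) (hf2 i') e2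
        exact hne (Fin.succ_injective _ (congrArg Prod.snd e3))

end Stage
end Absorb

open Set Topology MeasureTheory

namespace Absorb
open Filter
set_option linter.all false
set_option linter.deprecated false

section Emb
variable {X : Type*} [TopologicalSpace X] [CompactSpace X] [T2Space X] [TotallyDisconnectedSpace X]
variable {V : Type*} [TopologicalSpace V] [CompactSpace V] [T2Space V] [TotallyDisconnectedSpace V]
variable {E : ℕ → X → X → Prop} {Q : ℕ → V → V → Prop} {P : V → V → Prop}

/-- Thinness in terms of counting. -/
def ThinCount (E : ℕ → X → X → Prop) (Y : Set X) : Prop :=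
  ∀ B : Set X, IsClopen B → B.Nonempty → ∀ N : ℕ, ∃ U, IsClopen U ∧ Y ⊆ U ∧ ∃ n0, ∀ n, n0 ≤ n →
    ∀ x, N * ({y | E n x y} ∩ U).ncard ≤ ({y | E n x y} ∩ B).ncard

theorem thin_off [Nonempty X] (hE : ∀ n, IsCE (E n))
    (hmono : ∀ m n, m ≤ n → ∀ x y, E m x y → E n x y)
    {Y : Set X} (hth : ThinCount E Y) (k : ℕ) : ∃ x, ∀ y ∈ Y, ¬ E k x y := by
  classical
  by_contra hcon
  push Not at hcon
  choose f hfY hf using hcon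
  obtain ⟨D, hD⟩ := (hE k).finite
  obtain ⟨U, hU, hYU, n0, h⟩ := hth univ isClopen_univ univ_nonempty (D + 1)
  obtain ⟨x⟩ := ‹Nonempty X›
  let n := max n0 k
  have h1 := h n (le_max_left _ _) x
  have hfin := (hE n).fin x
  rw [inter_univ] at h1
  have hfU : ({y | E n x y} ∩ U).Finite := hfin.inter_of_left U
  have h2 : hfin.toFinset.card ≤ D * hfU.toFinset.card := by
    refine Finset.card_le_mul_card_image_of_maps_to (f := f) ?_ D ?_
    · intro y hy
      simp only [Finite.mem_toFinset, mem_setOf_eq, mem_inter_iff] at hy ⊢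
      exact ⟨(hE n).trans hy (hmono _ _ (le_max_right _ _) _ _ (hf y)), hYU (hfY y)⟩
    · intro b hb
      rw [← ncard_coe_finset]
      refine (ncard_le_ncard ?_ (hD b).1).trans (hD b).2
      intro z hz
      simp only [Finset.coe_filter, mem_setOf_eq] at hz
      show E k b z
      rw [← hz.2]; exact (hE k).symm (hf z)
  rw [← ncard_eq_toFinset_card _ hfin, ← ncard_eq_toFinset_card _ hfU] at h2
  have h3 : 0 < ({y | E n x y} ∩ U).ncard := by
    rw [ncard_pos hfU]
    exact ⟨f x, hmono _ _ (le_max_right _ _) _ _ (hf x), hYU (hfY x)⟩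
  nlinarith

structure EmbData (E : ℕ → X → X → Prop) (Q : ℕ → V → V → Prop) (P : V → V → Prop) (Y : Set X)
    (k : ℕ → ℕ) (ι : V → X) (E' : ℕ → X → X → Prop) : Prop where
  hk : ∀ n, n ≤ k n
  hkm : Monotone k
  ιc : Continuous ι
  ιi : Function.Injective ι
  ce : ∀ n, IsCE (E' n)
  mono : ∀ m n, m ≤ n → ∀ x y, E' m x y → E' n x y
  sub : ∀ n x y, E' n x y → E (k n) x y
  A : ∀ n v w, E (k n) (ι v) (ι w) ↔ Q n v w
  C : ∀ n v w, E' n (ι v) (ι w) ↔ Q n v w ∧ P v w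
  D : ∀ n x y, E n x y → ∃ m, E' m x y ∨ ∃ v w, E' m x (ι v) ∧ Q m v w ∧ E' m (ι w) y
  F1 : ∀ n x, ∀ y ∈ Y, E (k n) y x → E' n y x
  F2 : ∀ n v, ∀ y ∈ Y, ¬ E n y (ι v)
  Th : ∀ N, ∃ n O, IsClopen O ∧ range ι ⊆ O ∧
    ∀ x, N * ({y | E n x y} ∩ O).ncard ≤ {y | E n x y}.ncard
  Comp : ∀ B : Set X, IsClopen B → B.Nonempty → ∃ n U, IsClopen U ∧ Y ⊆ U ∧ range ι ⊆ U ∧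
    ∀ x, ({y | E' n x y} ∩ U).ncard ≤ ({y | E' n x y} ∩ B).ncard

theorem embed [Nonempty X] [SecondCountableTopology X] [SecondCountableTopology V]
    (hE : ∀ n, IsCE (E n)) (hmono : ∀ m n, m ≤ n → ∀ x y, E m x y → E n x y)
    (hE0 : ∀ x y, E 0 x y → x = y)
    (hmin : ∀ B : Set X, IsClopen B → B.Nonempty → ∃ n, ∀ x, ∃ y ∈ B, E n x y)
    (hperf : ∀ B : Set X, IsClopen B → B.Nonempty → B.Infinite)
    {Y : Set X} (hY : IsClosed Y) (hth : ThinCount E Y)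
    (hQ : ∀ n, IsCE (Q n)) (hQmono : ∀ m n, m ≤ n → ∀ x y, Q m x y → Q n x y)
    (hQ0 : ∀ x y, Q 0 x y → x = y)
    (hP : Equivalence P) (hPQ : ∀ n, IsCE (fun v w => P v w ∧ Q n v w)) :
    ∃ k ι E', EmbData E Q P Y k ι E' := by
  classical
  obtain ⟨d, hd⟩ := exists_sepSeq (X := X)
  obtain ⟨dV, hdV⟩ := exists_sepSeq (X := V)
  have hYm := thin_off hE hmono hth
  have hst : ∀ n (s : Stg E Q P n), ∃ s' : Stg E Q P (n + 1), Stp Y (d n) (dV n) s s' :=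
    fun n s => stg_step hE hmono hmin hperf hY hYm hQ hQmono hPQ s (hd.lc n) (hdV.lc n)
  choose F hF using hst
  let c0 : ℕ := if Nonempty V then 1 else 0
  have hc0 : V → c0 = 1 := fun v => if_pos ⟨v⟩
  let s0 : Stg E Q P 0 :=
    { k := 0
      β := fun _ => 1
      b := fun _ => c0
      l := fun _ => c0
      βl := IsLocallyConstant.const _
      bl := IsLocallyConstant.const _
      ll := IsLocallyConstant.const _
      β0 := fun _ => one_ne_zero
      s1a := fun v => ⟨Classical.arbitrary X, hc0 v⟩
      s1b := fun x hx => by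
        by_cases h : Nonempty V
        · exact ⟨h.some, (hc0 h.some).symm⟩
        · exact absurd (if_neg h) hx
      bis := ⟨fun v v' x _ h => ⟨x, (hE 0).refl x, h⟩, fun v x x' _ h _ => ⟨v, (hQ 0).refl v, h.symm⟩⟩
      s4x := fun x x' h _ _ => hE0 _ _ h
      s4v := fun v v' h _ => hQ0 _ _ h
      s6 := fun v v' w w' h h' _ _ _ => by rw [hQ0 _ _ h']; exact hP.refl _
      l1 := fun _ _ => rfl
      l2 := fun x _ => ⟨x, (hE 0).refl x, rfl⟩
      l3 := fun x u _ h => h }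
  let t : (n : ℕ) → Stg E Q P n := fun n => Nat.rec s0 (fun n s => F n s) n
  have ht0 : t 0 = s0 := rfl
  have hstp : ∀ n, Stp Y (d n) (dV n) (t n) (t (n + 1)) := fun n => hF n (t n)
  clear_value t
  let k : ℕ → ℕ := fun n => (t n).k
  have hkS : StrictMono k := strictMono_nat_of_lt_succ fun n => (hstp n).kk
  have hkm : Monotone k := hkS.monotone
  have hk : ∀ n, n ≤ k n := hkS.id_le
  have hbz : ∀ n x, (t (n + 1)).b x ≠ 0 → (t n).b x ≠ 0 := by
    intro n x h
    obtain ⟨v, hv⟩ := (t (n + 1)).s1b x h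
    rw [← (hstp n).R v x hv]; exact (t n).β0 v
  have hbz' : ∀ m n, m ≤ n → ∀ x, (t n).b x ≠ 0 → (t m).b x ≠ 0 := by
    intro m n hmn x
    induction n, hmn using Nat.le_induction with
    | base => exact id
    | succ n hmn ih => exact fun h => ih (hbz n x h)
  -- ι
  have hι : ∀ v, ∃ x, ∀ n, (t n).b x = (t n).β v := by
    intro v
    obtain ⟨x, hx⟩ := IsCompact.nonempty_iInter_of_sequence_nonempty_isCompact_isClosed
      (fun n => {x | (t n).b x = (t n).β v})
      (fun n x hx => ((hstp n).R v x (Eq.symm hx)).symm)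
      (fun n => (t n).s1a v) ((lc_clopen (t 0).bl {(t 0).β v}).isClosed.isCompact)
      (fun n => (lc_clopen (t n).bl {(t n).β v}).isClosed)
    exact ⟨x, fun n => mem_iInter.1 hx n⟩
  choose ι hι using hι
  have hιb : ∀ n v, (t n).b (ι v) ≠ 0 := fun n v => by rw [hι]; exact (t n).β0 v
  have hmX : ∀ m n, m < n → ∀ x y, (t n).b x ≠ 0 → (t n).b x = (t n).b y → d m x = d m y := by
    intro m n hmn x y h1 h2
    obtain ⟨n, rfl⟩ : ∃ n', n = n' + 1 := ⟨n - 1, by omega⟩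
    exact hd.ref m n (by omega) _ _ ((hstp n).meshX x y h1 h2)
  have hmV : ∀ m n, m < n → ∀ v w, (t n).β v = (t n).β w → dV m v = dV m w := by
    intro m n hmn x y h1
    obtain ⟨n, rfl⟩ : ∃ n', n = n' + 1 := ⟨n - 1, by omega⟩
    exact hdV.ref m n (by omega) _ _ ((hstp n).meshV x y h1)
  have hιu : ∀ v x, (∀ n, (t n).b x = (t n).β v) → x = ι v := by
    intro v x h
    apply hd.sep
    intro n
    exact hmX n (n + 1) (by omega) x (ι v) (by rw [h]; exact (t _).β0 v) (by rw [h, hι])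
  have hιc : Continuous ι := hd.cont fun n => by
    rw [lc_iff]
    intro v
    filter_upwards [lc_iff.1 (t (n + 1)).βl v] with w hw
    exact hmX n (n + 1) (by omega) _ _ (hιb _ _) (by rw [hι, hι, hw])
  have hιi : Function.Injective ι := by
    intro v w h
    apply hdV.sep
    intro n
    exact hmV n (n + 1) (by omega) _ _ (by rw [← hι, ← hι, h])
  have hιO : ∀ x, (∀ n, (t n).b x ≠ 0) → ∃ v, x = ι v := by
    intro x hx
    obtain ⟨v, hv⟩ := IsCompact.nonempty_iInter_of_sequence_nonempty_isCompact_isClosed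
      (fun n => {v | (t n).β v = (t n).b x})
      (fun n v hv => (hstp n).R v x hv)
      (fun n => (t n).s1b x (hx n)) ((lc_clopen (t 0).βl {(t 0).b x}).isClosed.isCompact)
      (fun n => (lc_clopen (t n).βl {(t n).b x}).isClosed)
    exact ⟨v, hιu v x fun n => (mem_iInter.1 hv n).symm⟩
  -- Bis at all later stages
  have hbis : ∀ i n, i ≤ n → Bis (Q i) (E (k i)) (t n).β (t n).b := by
    intro i n hin
    induction n, hin using Nat.le_induction with
    | base => exact (t i).bis
    | succ n hin ih => exact (hstp n).pres i (k i) hin (hkm hin) ih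
  -- (A)
  have hA : ∀ n v w, E (k n) (ι v) (ι w) ↔ Q n v w := by
    intro n v w
    constructor
    · intro h
      by_contra hq
      have ho : {w' | ¬ Q n v w'} ∈ 𝓝 w := by
        have : IsClosed {w' | Q n v w'} :=
          (hQ n).clo.preimage (Continuous.prodMk_right v)
        exact this.isOpen_compl.mem_nhds hq
      obtain ⟨m, hm⟩ := hdV.nhd ho
      let l := max n (m + 1)
      obtain ⟨w', h1, h2⟩ := (hbis n l (le_max_left _ _)).2 v _ _ h (hι v l) (hιb l w)
      rw [hι] at h2
      exact hm w' (hmV m l (Nat.lt_of_lt_of_le (Nat.lt_succ_self m) (le_max_right n (m+1))) _ _ h2) h1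
    · intro h
      by_contra hq
      have ho : {x' | ¬ E (k n) (ι v) x'} ∈ 𝓝 (ι w) := by
        have : IsClosed {x' | E (k n) (ι v) x'} :=
          (hE (k n)).clo.preimage (Continuous.prodMk_right (ι v))
        exact this.isOpen_compl.mem_nhds hq
      obtain ⟨m, hm⟩ := hd.nhd ho
      let l := max n (m + 1)
      obtain ⟨x', h1, h2⟩ := (hbis n l (le_max_left _ _)).1 v w _ h (hι v l)
      exact hm x' (hmX m l (Nat.lt_of_lt_of_le (Nat.lt_succ_self m) (le_max_right n (m+1))) _ _ (by rw [h2]; exact (t l).β0 _)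
        (by rw [h2, hι])) h1
  -- E'
  let PJ : ℕ → ℕ → ℕ → Prop := fun n i j => ∃ v v', Q n v v' ∧ P v v' ∧ (t n).β v = i ∧ (t n).β v' = j
  let Jr : ℕ → ℕ → ℕ → Prop := fun n i j => i = j ∨ PJ n i j
  have hhom : ∀ n v w w', (t n).β v = (t n).β w → Q n w w' →
      ∃ v', Q n v v' ∧ (t n).β v' = (t n).β w' ∧ (P w w' → P v v') := by
    intro n v w w' h h'
    obtain ⟨x, hx⟩ := (t n).s1a w
    obtain ⟨x', h1, h2⟩ := (t n).bis.1 w w' x h' hx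
    obtain ⟨v', h3, h4⟩ := (t n).bis.2 v x x' h1 (by rw [hx, h]) (by rw [h2]; exact (t n).β0 _)
    exact ⟨v', h3, by rw [h4, h2], fun hp => (t n).s6 w w' v v' h' h3 h.symm (by rw [h4, h2]) hp⟩
  have hPJt : ∀ n i j l, PJ n i j → PJ n j l → PJ n i l := by
    rintro n i j l ⟨v, v', h1, h2, h3, h4⟩ ⟨w, w', h5, h6, h7, h8⟩
    obtain ⟨v'', e1, e2, e3⟩ := hhom n v' w w' (by rw [h4, h7]) h5
    exact ⟨v, v'', (hQ n).trans h1 e1, hP.trans h2 (e3 h6), h3, by rw [e2, h8]⟩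
  have hPJs : ∀ n i j, PJ n i j → PJ n j i := by
    rintro n i j ⟨v, v', h1, h2, h3, h4⟩
    exact ⟨v', v, (hQ n).symm h1, hP.symm h2, h4, h3⟩
  let E' : ℕ → X → X → Prop := fun n x y => E (k n) x y ∧ Jr n ((t n).l x) ((t n).l y)
  have hce : ∀ n, IsCE (E' n) := by
    intro n
    refine (hE (k n)).color (t n).ll (Jr n) (fun x => Or.inl rfl) ?_ ?_
    · rintro x y - (h | h)
      · exact Or.inl h.symm
      · exact Or.inr (hPJs _ _ _ h)
    · rintro x y z - - (h | h) (h' | h')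
      · exact Or.inl (h.trans h')
      · exact Or.inr (by rw [h]; exact h')
      · exact Or.inr (by rw [← h']; exact h)
      · exact Or.inr (hPJt _ _ _ _ h h')
  have hlι : ∀ n v, (t n).l (ι v) = (t n).β v := fun n v => by
    rw [(t n).l1 _ (hιb n v), hι]
  have hC : ∀ n v w, E' n (ι v) (ι w) ↔ Q n v w ∧ P v w := by
    intro n v w
    constructor
    · rintro ⟨h1, h2⟩
      have hq := (hA n v w).1 h1
      refine ⟨hq, ?_⟩
      rw [hlι, hlι] at h2
      rcases h2 with h2 | ⟨u, u', e1, e2, e3, e4⟩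
      · rw [(t n).s4v _ _ hq h2]; exact hP.refl _
      · exact (t n).s6 u u' v w e1 hq e3 e4 e2
    · rintro ⟨h1, h2⟩
      refine ⟨(hA n v w).2 h1, Or.inr ?_⟩
      rw [hlι, hlι]
      exact ⟨v, w, h1, h2, rfl, rfl⟩
  have hmono1 : ∀ n x y, E' n x y → E' (n + 1) x y := by
    rintro n x y ⟨h1, h2⟩
    refine ⟨hmono _ _ (hkm (Nat.le_succ n)) _ _ h1, ?_⟩
    by_cases hO : ∀ u, E (k n) x u → (t (n + 1)).b u = 0
    · exact Or.inl ((hstp n).lab x y hO h1)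
    · push Not at hO
      obtain ⟨u, hu, hub⟩ := hO
      obtain ⟨w, a1, a2, a3, a4⟩ := (hstp n).coh x u hu hub
      obtain ⟨w', b1, b2, b3, b4⟩ := (hstp n).coh y u ((hE _).trans ((hE _).symm h1) hu) hub
      have hww : E (k n) w w' := (hE _).trans ((hE _).symm a1) ((hE _).trans h1 b1)
      rw [← a3, ← b3]
      rcases h2 with h2 | ⟨v, v', e1, e2, e3, e4⟩
      · left
        rw [(t n).s4x w w' hww (hbz n w a4) (by rw [a2, b2, h2])]
      · right
        obtain ⟨v1, hv1⟩ := (t (n + 1)).s1b w a4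
        have hv1' := (hstp n).R v1 w hv1
        obtain ⟨v2, f1, f2, f3⟩ := hhom n v1 v v' (by rw [hv1', a2, e3]) e1
        obtain ⟨v3, g1, g2⟩ := (hbis n (n + 1) (Nat.le_succ n)).2 v1 w w' hww hv1.symm b4
        have hv3 := (hstp n).R v3 w' g2
        have : v3 = v2 := (t n).s4v _ _ ((hQ n).trans ((hQ n).symm g1) f1)
          (by rw [hv3, b2, f2, e4])
        subst this
        exact ⟨v1, v3, hQmono _ _ (Nat.le_succ n) _ _ f1, f3 e2, hv1, g2⟩
  have hmono' : ∀ m n, m ≤ n → ∀ x y, E' m x y → E' n x y := by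
    intro m n hmn x y
    induction n, hmn using Nat.le_induction with
    | base => exact id
    | succ n hmn ih => exact fun h => hmono1 _ _ _ (ih h)
  have hD : ∀ n x y, E n x y → ∃ m, E' m x y ∨ ∃ v w, E' m x (ι v) ∧ Q m v w ∧ E' m (ι w) y := by
    intro n x y hxy
    have hxy' : ∀ m, n ≤ m → E (k m) x y := fun m hm => hmono _ _ (hm.trans (hk m)) _ _ hxy
    by_cases hex : ∃ m, n ≤ m ∧ ∀ u, E (k m) x u → (t (m + 1)).b u = 0
    · obtain ⟨m, hm, h⟩ := hex
      exact ⟨m + 1, Or.inl ⟨hxy' _ (by omega), Or.inl ((hstp m).lab x y h (hxy' m hm))⟩⟩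
    · push Not at hex
      have key : ∀ u, E (k n) x u → (t n).b u ≠ 0 → ∃ v, u = ι v := by
        intro u hu hub
        have h1 : ∀ m, n ≤ m → (t m).b u ≠ 0 := by
          intro m hm
          induction m, hm using Nat.le_induction with
          | base => exact hub
          | succ m hm ih =>
            obtain ⟨u', h2, h3⟩ := hex m hm
            refine (hstp m).inv u' u ((hE _).trans ((hE _).symm h2) (hmono _ _ (hkm hm) _ _ hu)) h3 ih
        refine hιO u fun m => ?_
        rcases le_total n m with h | h
        · exact h1 m h
        · exact hbz' m n h u hub
      have key2 : ∀ z, E (k n) x z → ∃ v, E' n z (ι v) := by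
        intro z hz
        obtain ⟨u0, h1, h2⟩ := hex n le_rfl
        have h3 : (t n).l z ≠ 0 := (t n).l3 z u0 ((hE _).trans ((hE _).symm hz) h1) (hbz n u0 h2)
        obtain ⟨u, h4, h5⟩ := (t n).l2 z h3
        have hub : (t n).b u ≠ 0 := by rw [h5]; exact h3
        obtain ⟨v, rfl⟩ := key u ((hE _).trans hz h4) hub
        exact ⟨v, h4, Or.inl (by rw [(t n).l1 _ hub, h5])⟩
      obtain ⟨v, hv⟩ := key2 x ((hE _).refl x)
      obtain ⟨w, hw⟩ := key2 y (hxy' n le_rfl)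
      refine ⟨n, Or.inr ⟨v, w, hv, (hA n v w).1 ?_, (hce n).symm hw⟩⟩
      exact (hE _).trans ((hE _).symm hv.1) ((hE _).trans (hxy' n le_rfl) hw.1)
  have hYl : ∀ n, ∀ y ∈ Y, ∀ x, E (k (n + 1)) y x → (t (n + 1)).l x = 0 := by
    intro n y hy x h
    by_contra hne
    obtain ⟨u, h1, h2⟩ := (t (n + 1)).l2 x hne
    have := (hstp n).Yz y hy u ((hE _).trans h h1)
    rw [h2] at this
    exact hne this
  have hk0 : k 0 = 0 := by show (t 0).k = 0; rw [ht0]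
  refine ⟨k, ι, E', hk, hkm, hιc, hιi, hce, hmono', fun n x y h => h.1, hA, hC, hD, ?_, ?_, ?_, ?_⟩
  · intro n x y hy h
    cases n with
    | zero =>
      rw [hk0] at h
      rw [hE0 _ _ h]; exact (hce 0).refl _
    | succ n =>
      refine ⟨h, Or.inl ?_⟩
      rw [hYl n y hy x h, hYl n y hy y ((hE _).refl y)]
  · intro n v y hy h
    exact hιb (n + 1) v ((hstp n).Yz y hy (ι v) (hmono _ _ ((Nat.le_succ n).trans (hk _)) _ _ h))
  · intro N
    refine ⟨k (N + 1), {x | (t (N + 1)).b x ≠ 0}, lc_clopen (t (N + 1)).bl {0}ᶜ, ?_, ?_⟩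
    · rintro _ ⟨v, rfl⟩; exact hιb _ v
    · intro x
      obtain ⟨M, C, D, h1, h2, h3, h4⟩ := (hstp N).cnt
      have h2' : ({y | E (k (N + 1)) x y} ∩ {y | (t (N + 1)).b y ≠ 0}).ncard ≤ C := h2 x
      by_cases hne : ({y | E (k (N + 1)) x y} ∩ {y | (t (N + 1)).b y ≠ 0}).Nonempty
      · obtain ⟨u, hu1, hu2⟩ := hne
        obtain ⟨f, hf1, hf2⟩ := h4 u hu2
        have hfi : Function.Injective f := by
          intro i j hij
          by_contra hne
          exact hf2 i j hne (by rw [hij]; exact (hE _).refl _)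
        have h5 : M ≤ {y | E (k (N + 1)) x y}.ncard := by
          have h6 : (range f).ncard = M := by
            rw [← image_univ, ncard_image_of_injective _ hfi, ncard_univ, Nat.card_fin]
          rw [← h6]
          refine ncard_le_ncard ?_ ((hE _).fin x)
          rintro _ ⟨i, rfl⟩
          exact (hE _).trans hu1 (hf1 i).1
        have h7 : 1 ≤ D := by
          refine le_trans ?_ (h1 x)
          rw [Nat.one_le_iff_ne_zero, ← Nat.pos_iff_ne_zero, ncard_pos ((hE _).fin x)]
          exact ⟨x, (hE _).refl x⟩
        calc N * ({y | E (k (N + 1)) x y} ∩ {y | (t (N + 1)).b y ≠ 0}).ncard ≤ N * C :=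
              Nat.mul_le_mul_left _ h2'
          _ ≤ (N + 2) * (C * D + 1) := by
              refine Nat.mul_le_mul (by omega) ?_
              have := Nat.le_mul_of_pos_right C h7
              omega
          _ ≤ M := h3
          _ ≤ _ := h5
      · rw [not_nonempty_iff_eq_empty.1 hne, ncard_empty, mul_zero]
        exact Nat.zero_le _
  · intro B hB hBn
    obtain ⟨UY, hUY, hYUY, n0, hcn⟩ := hth B hB hBn 2
    obtain ⟨n1, hn1⟩ := hmin B hB hBn
    let n := max n0 n1
    have hn0 : n0 ≤ k n := (le_max_left _ _).trans (hk n)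
    have hn1k : n1 ≤ k n := (le_max_right _ _).trans (hk n)
    refine ⟨n + 1, UY ∪ {x | (t (n + 1)).b x ≠ 0}, hUY.union (lc_clopen (t (n + 1)).bl {0}ᶜ),
      hYUY.trans subset_union_left, ?_, ?_⟩
    · rintro _ ⟨v, rfl⟩; exact Or.inr (hιb _ v)
    intro x
    obtain ⟨M, C, D, h1, h2, h3, h4⟩ := (hstp n).cnt
    let S : Set X := {y | E' (n + 1) x y}
    have hSf : S.Finite := (hce (n + 1)).fin x
    let W : Set X := {y | E' (n + 1) x y ∧ ∀ u, E (k n) y u → (t (n + 1)).b u = 0}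
    have hWS : W ⊆ S := fun y hy => hy.1
    have hWf : W.Finite := hSf.subset hWS
    have hWinv : ∀ y ∈ W, ∀ z, E (k n) y z → z ∈ W := by
      rintro y ⟨hy1, hy2⟩ z hz
      refine ⟨(hce (n + 1)).trans hy1 ⟨hmono _ _ (hkm (Nat.le_succ n)) _ _ hz,
        Or.inl ((hstp n).lab y z hy2 hz)⟩, fun u hu => hy2 u ((hE _).trans hz hu)⟩
    have hEk : Equivalence (E (k n)) := ⟨(hE _).refl, (hE _).symm, (hE _).trans⟩
    have hW2 : 2 * (W ∩ UY).ncard ≤ (W ∩ B).ncard :=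
      sum_classes hEk hWf hWinv (fun y _ => hcn (k n) hn0 y)
    show (S ∩ (UY ∪ {x | (t (n + 1)).b x ≠ 0})).ncard ≤ (S ∩ B).ncard
    have hsub : S ∩ (UY ∪ {x | (t (n + 1)).b x ≠ 0}) ⊆ (W ∩ UY) ∪ (S \ W) := by
      rintro y ⟨hy1, hy2⟩
      by_cases hyW : y ∈ W
      · left
        refine ⟨hyW, ?_⟩
        rcases hy2 with h | h
        · exact h
        · exact absurd (hyW.2 y ((hE _).refl y)) h
      · exact Or.inr ⟨hy1, hyW⟩
    have hc1 : (S ∩ (UY ∪ {x | (t (n + 1)).b x ≠ 0})).ncard ≤ (W ∩ UY).ncard + (S \ W).ncard :=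
      (ncard_le_ncard hsub ((hWf.inter_of_left _).union (hSf.subset diff_subset))).trans
        (ncard_union_le _ _)
    have hc2 : (W ∩ B).ncard ≤ (S ∩ B).ncard :=
      ncard_le_ncard (inter_subset_inter_left _ hWS) (hSf.inter_of_left _)
    by_cases hne : (S \ W).Nonempty
    · obtain ⟨z, hz1, hz2⟩ := hne
      have hc3 : (S \ W).ncard ≤ C * D := by
        let O : Set X := {y | E (k (n + 1)) x y} ∩ {y | (t (n + 1)).b y ≠ 0}
        have hOf : O.Finite := ((hE _).fin x).inter_of_left _
        have hex : ∀ y ∈ S \ W, ∃ u ∈ O, E (k n) u y := by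
          rintro y ⟨hy1, hy2⟩
          have : ¬ ∀ u, E (k n) y u → (t (n + 1)).b u = 0 := fun h => hy2 ⟨hy1, h⟩
          push Not at this
          obtain ⟨u, hu1, hu2⟩ := this
          exact ⟨u, ⟨(hE _).trans hy1.1 (hmono _ _ (hkm (Nat.le_succ n)) _ _ hu1), hu2⟩,
            (hE _).symm hu1⟩
        have hsub2 : S \ W ⊆ ⋃ u ∈ hOf.toFinset, {y | E (k n) u y} := by
          intro y hy
          obtain ⟨u, hu1, hu2⟩ := hex y hy
          simp only [mem_iUnion]
          exact ⟨u, hOf.mem_toFinset.2 hu1, hu2⟩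
        have hfin : (⋃ u ∈ hOf.toFinset, {y | E (k n) u y}).Finite :=
          hOf.toFinset.finite_toSet.biUnion fun u _ => (hE _).fin u
        refine (ncard_le_ncard hsub2 hfin).trans ?_
        refine (Finset.set_ncard_biUnion_le _ _).trans ?_
        refine (Finset.sum_le_card_nsmul _ _ D fun u _ => h1 u).trans ?_
        rw [smul_eq_mul, ← ncard_eq_toFinset_card _ hOf]
        exact Nat.mul_le_mul_right _ (h2 x)
      have : ¬ ∀ u, E (k n) z u → (t (n + 1)).b u = 0 := fun h => hz2 ⟨hz1, h⟩
      push Not at this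
      obtain ⟨u, hu1, hu2⟩ := this
      obtain ⟨w, a1, a2, a3, a4⟩ := (hstp n).coh z u hu1 hu2
      obtain ⟨f, hf1, hf2⟩ := h4 w a4
      have hfW : ∀ i, f i ∈ W := by
        intro i
        refine ⟨(hce _).trans hz1 ⟨?_, Or.inl ?_⟩, (hf1 i).2.2⟩
        · exact (hE _).trans (hmono _ _ (hkm (Nat.le_succ n)) _ _ a1) (hf1 i).1
        · rw [(hf1 i).2.1, a3]
      have : ∀ i, ∃ y ∈ B, E (k n) (f i) y := by
        intro i
        obtain ⟨y, e1, e2⟩ := hn1 (f i)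
        exact ⟨y, e1, hmono _ _ hn1k _ _ e2⟩
      choose g hg1 hg2 using this
      have hgi : Function.Injective g := by
        intro i j hij
        by_contra hne
        refine hf2 i j hne ((hE _).trans (hg2 i) ?_)
        rw [hij]; exact (hE _).symm (hg2 j)
      have hM : M ≤ (W ∩ B).ncard := by
        have h6 : (range g).ncard = M := by
          rw [← image_univ, ncard_image_of_injective _ hgi, ncard_univ, Nat.card_fin]
        rw [← h6]
        refine ncard_le_ncard ?_ (hWf.inter_of_left _)
        rintro _ ⟨i, rfl⟩
        exact ⟨hWinv _ (hfW i) _ (hg2 i), hg1 i⟩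
      have h7 : 2 * (C * D) ≤ M := by
        refine le_trans ?_ h3
        exact Nat.mul_le_mul (by omega) (by omega)
      omega
    · rw [not_nonempty_iff_eq_empty.1 hne, ncard_empty] at hc1
      omega

end Emb
end Absorb

open Set Topology MeasureTheory

namespace Absorb
open Filter
set_option linter.all false
set_option linter.deprecated false

section NT0
variable {Z : Type*} [TopologicalSpace Z] {S : Type*} [TopologicalSpace S]
variable {F : ℕ → Z → Z → Prop} {e : S → Z × Z}

/-- The topology of `S` is the inductive limit topology of the relations `F n`. -/
structure NT (F : ℕ → Z → Z → Prop) (e : S → Z × Z) : Prop where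
  inj : Function.Injective e
  rng : ∀ z, (∃ p, e p = z) ↔ ∃ n, F n z.1 z.2
  nh : ∀ n p, F n (e p).1 (e p).2 → 𝓝 p = comap e (𝓝 (e p)) ⊓ 𝓟 {q | F n (e q).1 (e q).2}

theorem NT.lvl (h : NT F e) (p : S) : ∃ n, F n (e p).1 (e p).2 := (h.rng _).1 ⟨p, rfl⟩

end NT0

section NTs
variable {Z : Type*} [TopologicalSpace Z] [CompactSpace Z] [T2Space Z] [TotallyDisconnectedSpace Z]
variable {S : Type*} [TopologicalSpace S]
variable {F : ℕ → Z → Z → Prop} {e : S → Z × Z}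

/-- A compact étale subrelation is relatively open. -/
theorem IsCE.rel_open {E F : Z → Z → Prop} (hE : IsCE E) (hF : IsCE F)
    (hsub : ∀ x y, E x y → F x y) {x y : Z} (h : E x y) :
    ∀ᶠ p : Z × Z in 𝓝 (x, y), F p.1 p.2 → E p.1 p.2 := by
  obtain ⟨U, hU, hi⟩ := hF.inj y
  have h1 := hE.opn h hU
  have h2 : ∀ᶠ p : Z × Z in 𝓝 (x, y), ∃ y' ∈ U, E p.1 y' :=
    (continuous_fst.tendsto (x, y)).eventually h1
  have h3 : ∀ᶠ p : Z × Z in 𝓝 (x, y), p.2 ∈ U := continuous_snd.continuousAt.eventually hU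
  filter_upwards [h2, h3] with p hp1 hp2 hp3
  obtain ⟨y', hy', hy2⟩ := hp1
  have := hi y' hy' p.2 hp2 (hF.trans (hF.symm (hsub _ _ hy2)) hp3)
  rw [← this]; exact hy2

theorem NT.cont (h : NT F e) : Continuous e := by
  rw [continuous_iff_continuousAt]
  intro p
  obtain ⟨n, hn⟩ := h.lvl p
  unfold ContinuousAt
  rw [h.nh n p hn]
  exact tendsto_comap.mono_left inf_le_left

theorem NT.open (h : NT F e) (n : ℕ) : IsOpen {q | F n (e q).1 (e q).2} := by
  rw [isOpen_iff_mem_nhds]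
  intro p hp
  rw [h.nh n p hp]
  exact mem_inf_of_right (mem_principal_self _)

theorem NT.tend (h : NT F e) {A : Type*} {l : Filter A} {f : A → S} {p : S} (n : ℕ)
    (hp : F n (e p).1 (e p).2) (h1 : Tendsto (fun a => e (f a)) l (𝓝 (e p)))
    (h2 : ∀ᶠ a in l, F n (e (f a)).1 (e (f a)).2) : Tendsto f l (𝓝 p) := by
  rw [h.nh n p hp, tendsto_inf, tendsto_comap_iff, tendsto_principal]
  exact ⟨h1, h2⟩

theorem NT.compact (h : NT F e) (hF : ∀ n, IsCE (F n)) (n : ℕ) :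
    IsCompact {q | F n (e q).1 (e q).2} := by
  have hc : IsCompact {p : Z × Z | F n p.1 p.2} := (hF n).clo.isCompact
  haveI := isCompact_iff_compactSpace.1 hc
  have hex : ∀ z : {p : Z × Z | F n p.1 p.2}, ∃ p, e p = z := fun z => (h.rng _).2 ⟨n, z.2⟩
  choose f hf using hex
  have hcont : Continuous f := by
    rw [continuous_iff_continuousAt]
    intro z
    refine h.tend n (by rw [hf]; exact z.2) ?_ ?_
    · simp only [hf]; exact continuous_subtype_val.continuousAt
    · exact Eventually.of_forall fun a => by rw [hf]; exact a.2
  have : {q | F n (e q).1 (e q).2} = range f := by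
    ext q
    constructor
    · intro hq
      exact ⟨⟨e q, hq⟩, h.inj (hf _)⟩
    · rintro ⟨z, rfl⟩
      show F n _ _
      rw [hf]; exact z.2
  rw [this]
  exact isCompact_range hcont

theorem NT.t2 (h : NT F e) : T2Space S := T2Space.of_injective_continuous h.inj h.cont

theorem NT.lc (h : NT F e) (hF : ∀ n, IsCE (F n)) : LocallyCompactSpace S := by
  haveI := h.t2
  haveI : WeaklyLocallyCompactSpace S := ⟨fun p => by
    obtain ⟨n, hn⟩ := h.lvl p
    exact ⟨_, h.compact hF n, (h.open n).mem_nhds hn⟩⟩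
  infer_instance

theorem NT.sc [SecondCountableTopology Z] (h : NT F e) : SecondCountableTopology S := by
  have hU : ∀ n, SecondCountableTopology ({q | F n (e q).1 (e q).2} : Set S) := by
    intro n
    have : IsInducing (fun q : ({q | F n (e q).1 (e q).2} : Set S) => e q) := by
      rw [isInducing_iff_nhds]
      intro q
      rw [nhds_subtype, h.nh n q q.2, comap_inf, comap_comap, comap_principal]
      have : (Subtype.val : ({q | F n (e q).1 (e q).2} : Set S) → S) ⁻¹'
        {q | F n (e q).1 (e q).2} = univ := by
          ext z; exact ⟨fun _ => trivial, fun _ => z.2⟩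
      rw [this, principal_univ, inf_top_eq]
      rfl
    exact this.secondCountableTopology
  exact TopologicalSpace.secondCountableTopology_of_countable_cover (fun n => h.open n)
    (by ext p; simpa using h.lvl p)

theorem NT.lh (h : NT F e) (hF : ∀ n, IsCE (F n)) : IsLocalHomeomorph (fun p => (e p).1) := by
  have hcont : Continuous (fun p => (e p).1) := continuous_fst.comp h.cont
  have hopen : IsOpenMap (fun p => (e p).1) := by
    rw [isOpenMap_iff_nhds_le]
    intro p U hU
    obtain ⟨n, hn⟩ := h.lvl p
    rw [mem_map, h.nh n p hn, mem_inf_principal, mem_comap] at hU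
    obtain ⟨W, hW, hWU⟩ := hU
    rw [nhds_prod_eq, mem_prod_iff] at hW
    obtain ⟨A, hA, B, hB, hAB⟩ := hW
    filter_upwards [hA, (hF n).opn hn hB] with x hx1 hx2
    obtain ⟨y, hy, hxy⟩ := hx2
    obtain ⟨q, hq⟩ := (h.rng (x, y)).2 ⟨n, hxy⟩
    have := hWU (show q ∈ e ⁻¹' W by
      show e q ∈ W
      rw [hq]; exact hAB ⟨hx1, hy⟩) (by show F n _ _; rw [hq]; exact hxy)
    simpa [hq] using this
  rw [isLocalHomeomorph_iff_isOpenEmbedding_restrict]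
  intro p
  obtain ⟨n, hn⟩ := h.lvl p
  obtain ⟨U, hU, hi⟩ := (hF n).inj (e p).2
  obtain ⟨O, hO1, hO2, hO3⟩ := mem_nhds_iff.1 hU
  let W : Set S := {q | F n (e q).1 (e q).2} ∩ (fun q => (e q).2) ⁻¹' O
  have hW : IsOpen W := (h.open n).inter (hO2.preimage (continuous_snd.comp h.cont))
  refine ⟨W, hW.mem_nhds ⟨hn, hO3⟩, ?_⟩
  refine .of_continuous_injective_isOpenMap (hcont.comp continuous_subtype_val) ?_ ?_
  · rintro ⟨a, ha1, ha2⟩ ⟨b, hb1, hb2⟩ hab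
    have hab : (e a).1 = (e b).1 := hab
    apply Subtype.ext
    apply h.inj
    apply Prod.ext hab
    apply hi _ (hO1 ha2) _ (hO1 hb2)
    refine (hF n).trans ((hF n).symm ha1) ?_
    rw [hab]; exact hb1
  · exact hopen.comp hW.isOpenMap_subtype_val

end NTs

/-- The inductive limit topology makes an increasing union étale. -/
theorem etale_of_NT {Z : Type*} [TopologicalSpace Z] [CompactSpace Z] [T2Space Z]
    [TotallyDisconnectedSpace Z] [SecondCountableTopology Z] {F : ℕ → Z → Z → Prop}
    (hF : ∀ n, IsCE (F n)) (hmono : ∀ m n, m ≤ n → ∀ x y, F m x y → F n x y)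
    (R : Set (Z × Z)) (T : TopologicalSpace ↥R) (h : @NT Z _ ↥R T F Subtype.val) :
    IsEtaleEquivRel R T := by
  have hm : ∀ x y, (x, y) ∈ R ↔ ∃ n, F n x y := fun x y =>
    ⟨fun hp => h.lvl ⟨(x, y), hp⟩, fun hp => by
      obtain ⟨p, hp⟩ := (h.rng (x, y)).2 hp
      rw [← hp]; exact p.2⟩
  have tr : ∀ ⦃x y z : Z⦄, (x, y) ∈ R → (y, z) ∈ R → (x, z) ∈ R := by
    intro x y z h1 h2
    rw [hm] at *
    obtain ⟨n, hn⟩ := h1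
    obtain ⟨m, hm⟩ := h2
    exact ⟨max n m, (hF _).trans (hmono _ _ (le_max_left _ _) _ _ hn)
      (hmono _ _ (le_max_right _ _) _ _ hm)⟩
  have sy : ∀ ⦃x y : Z⦄, (x, y) ∈ R → (y, x) ∈ R := by
    intro x y h1
    rw [hm] at *
    obtain ⟨n, hn⟩ := h1
    exact ⟨n, (hF n).symm hn⟩
  refine ⟨fun x => (hm _ _).2 ⟨0, (hF 0).refl x⟩, sy, tr, ?_, h.t2, h.lc hF, h.sc, ?_, ?_, h.lh hF⟩
  · intro x
    have : {y | (x, y) ∈ R} = ⋃ n, {y | F n x y} := by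
      ext y; simp [hm]
    rw [this]
    exact countable_iUnion fun n => ((hF n).fin x).countable
  · letI := T
    show Continuous (compMap R tr)
    rw [continuous_iff_continuousAt]
    intro q
    obtain ⟨n, hn⟩ := h.lvl q.1.1
    obtain ⟨m, hm⟩ := h.lvl q.1.2
    have hn' := hmono _ _ (le_max_left n m) _ _ hn
    have hm' := hmono _ _ (le_max_right n m) _ _ hm
    have c1 : Continuous (fun q : CompPairs R => q.1.1) := continuous_fst.comp continuous_subtype_val
    have c2 : Continuous (fun q : CompPairs R => q.1.2) := continuous_snd.comp continuous_subtype_val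
    have key : ∀ q : CompPairs R, F (max n m) q.1.1.1.1 q.1.1.1.2 →
        F (max n m) q.1.2.1.1 q.1.2.1.2 → F (max n m) q.1.1.1.1 q.1.2.1.2 := by
      intro q h1 h2
      rw [show q.1.1.1.2 = q.1.2.1.1 from q.2] at h1
      exact (hF _).trans h1 h2
    refine h.tend (max n m) (key q hn' hm') ?_ ?_
    · exact ((continuous_fst.comp (h.cont.comp c1)).prodMk
        (continuous_snd.comp (h.cont.comp c2))).continuousAt
    · filter_upwards [c1.continuousAt.eventually ((h.open _).mem_nhds hn'),
        c2.continuousAt.eventually ((h.open _).mem_nhds hm')] with q h1 h2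
      exact key q h1 h2
  · letI := T
    have hc : Continuous (invMap R sy) := by
      rw [continuous_iff_continuousAt]
      intro q
      obtain ⟨n, hn⟩ := h.lvl q
      refine h.tend n ((hF n).symm hn) ?_ ?_
      · exact ((continuous_snd.comp h.cont).prodMk (continuous_fst.comp h.cont)).continuousAt
      · filter_upwards [(h.open n).mem_nhds hn] with q h1
        exact (hF n).symm h1
    have hinv : Function.Involutive (invMap R sy) := fun q => rfl
    exact (Homeomorph.mk hinv.toPerm hc hc).isHomeomorph

/-- A bijection matching the exhaustions is a homeomorphism. -/
theorem NT.homeo {Z Z' S S' : Type*} [TopologicalSpace Z] [TopologicalSpace Z'] [TopologicalSpace S]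
    [TopologicalSpace S'] {F : ℕ → Z → Z → Prop} {F' : ℕ → Z' → Z' → Prop} {e : S → Z × Z}
    {e' : S' → Z' × Z'} (h : NT F e) (h' : NT F' e') (g : Z ≃ₜ Z')
    (hg : ∀ n x y, F n x y ↔ F' n (g x) (g y)) (G : S → S')
    (hG : ∀ p, e' (G p) = (g (e p).1, g (e p).2)) : IsHomeomorph G := by
  have hcomp : e' ∘ G = (g.prodCongr g) ∘ e := by
    funext p; exact hG p
  rw [isHomeomorph_iff_isEmbedding_surjective]
  refine ⟨⟨?_, ?_⟩, ?_⟩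
  · rw [isInducing_iff_nhds]
    intro p
    obtain ⟨n, hn⟩ := h.lvl p
    rw [h.nh n p hn, h'.nh n (G p) (by rw [hG]; exact (hg n _ _).1 hn), comap_inf, comap_principal,
      comap_comap, hcomp, ← comap_comap]
    congr 2
    · rw [show e' (G p) = (g.prodCongr g) (e p) from hG p, (g.prodCongr g).comap_nhds_eq,
        Homeomorph.symm_apply_apply]
    · ext q
      simp only [mem_preimage, mem_setOf_eq, hG]
      exact hg n _ _
  · intro p q hpq
    apply h.inj
    have := congrArg e' hpq
    rw [hG, hG, Prod.mk.injEq] at this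
    exact Prod.ext (g.injective this.1) (g.injective this.2)
  · intro q
    obtain ⟨n, hn⟩ := h'.lvl q
    obtain ⟨p, hp⟩ := (h.rng (g.symm (e' q).1, g.symm (e' q).2)).2
      ⟨n, (hg n _ _).2 (by simpa using hn)⟩
    refine ⟨p, h'.inj ?_⟩
    rw [hG, hp]; simp

section Start
variable {Z : Type*} [TopologicalSpace Z] [CompactSpace Z] [T2Space Z]

/-- A CEER is a closed relation with relative topology. -/
theorem ceer_isCE (S : Set (Z × Z)) (TS : TopologicalSpace ↥S) (h : IsCEER S TS) :
    IsCE (fun x y => (x, y) ∈ S) ∧ ∀ p : S, @nhds _ TS p = comap Subtype.val (𝓝 p.1) := by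
  obtain ⟨he, hc⟩ := h
  letI := TS
  have c1 : Continuous (fun p : S => p.1.1) := he.localHomeo_range.continuous
  have c2 : Continuous (fun p : S => p.1.2) := by
    have := c1.comp he.homeo_inv.continuous
    exact this
  have c : Continuous (Subtype.val : S → Z × Z) := c1.prodMk c2
  have hemb : IsClosedEmbedding (Subtype.val : S → Z × Z) :=
    c.isClosedEmbedding Subtype.val_injective
  have hn : ∀ p : S, 𝓝 p = comap Subtype.val (𝓝 p.1) := hemb.isInducing.nhds_eq_comap
  refine ⟨⟨he.refl, fun {x y} h => he.symm h, fun {x y z} h h' => he.trans h h', ?_, ?_, ?_⟩, hn⟩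
  · have := hemb.isClosed_range
    rwa [Subtype.range_coe] at this
  · intro x y U hxy hU
    have h1 : (fun p : S => p.1.2) ⁻¹' U ∈ 𝓝 (⟨(x, y), hxy⟩ : S) := c2.continuousAt hU
    have h2 := he.localHomeo_range.isOpenMap.image_mem_nhds h1
    filter_upwards [h2] with x' hx'
    obtain ⟨p, hp, rfl⟩ := hx'
    exact ⟨_, hp, p.2⟩
  · intro x
    obtain ⟨f, hf, hfe⟩ := he.localHomeo_range ⟨(x, x), he.refl x⟩
    have h1 : f.source ∈ 𝓝 (⟨(x, x), he.refl x⟩ : S) := f.open_source.mem_nhds hf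
    rw [hn, mem_comap, ] at h1
    obtain ⟨W, hW, hWf⟩ := h1
    rw [nhds_prod_eq, mem_prod_iff] at hW
    obtain ⟨A, hA, B, hB, hAB⟩ := hW
    refine ⟨A ∩ B, inter_mem hA hB, fun y hy z hz hyz => ?_⟩
    have h3 : (⟨(y, z), hyz⟩ : S) ∈ f.source := hWf (hAB ⟨hy.1, hz.2⟩)
    have h4 : (⟨(y, y), he.refl y⟩ : S) ∈ f.source := hWf (hAB ⟨hy.1, hy.2⟩)
    have := f.injOn h4 h3 (by rw [← hfe])
    exact congrArg (fun p : S => p.1.2) this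

end Start

/-- Unpacking the definition of AF relations. -/
theorem af_unpack {X : Type*} [TopologicalSpace X] [CompactSpace X] [T2Space X]
    [TotallyDisconnectedSpace X]
    (R : Set (X × X)) (T : TopologicalSpace ↥R) (h : IsAFEquivRel R T) :
    ∃ E : ℕ → X → X → Prop, (∀ n, IsCE (E n)) ∧ (∀ m n, m ≤ n → ∀ x y, E m x y → E n x y) ∧
      (∀ x y, E 0 x y → x = y) ∧ (∀ x y, (x, y) ∈ R ↔ ∃ n, E n x y) ∧
      @NT X _ ↥R T E Subtype.val := by
  obtain ⟨Rs, hsub, h0, hm, hce, -, hU, hT⟩ := h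
  have hmono : Monotone Rs := monotone_nat_of_le_succ hm
  have hCE := fun n => (ceer_isCE (Rs n) _ (hce n)).1
  have hR : ∀ x y, (x, y) ∈ R ↔ ∃ n, (x, y) ∈ Rs n := by
    intro x y; rw [← hU]; simp
  refine ⟨fun n x y => (x, y) ∈ Rs n, hCE, fun m n hmn x y h => hmono hmn h, ?_, hR, ?_⟩
  · intro x y h
    rw [h0] at h; exact h
  · have hop : ∀ U : Set R, IsOpen[T] U ↔ ∀ n, IsOpen[relTop (Rs n)]
        ((fun p : ↥(Rs n) => (⟨(p : X × X), hsub n p.2⟩ : ↥R)) ⁻¹' U) := by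
      intro U
      rw [hT, inductiveLimitTop, isOpen_iSup_iff]
      rfl
    have hco : ∀ n, @Continuous _ _ (relTop (Rs n)) T
        (fun p : ↥(Rs n) => (⟨(p : X × X), hsub n p.2⟩ : ↥R)) := by
      intro n
      rw [continuous_def]
      intro U hU
      exact (hop U).1 hU n
    have hval : @Continuous _ _ T _ (Subtype.val : R → X × X) := by
      rw [continuous_def]
      intro U hU
      rw [hop]
      intro n
      exact hU.preimage continuous_subtype_val
    have hopE : ∀ n, IsOpen[T] {q : R | (q.1.1, q.1.2) ∈ Rs n} := by
      intro n
      rw [hop]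
      intro m
      show IsOpen ((Subtype.val : Rs m → X × X) ⁻¹' {q | (q.1, q.2) ∈ Rs n})
      rw [isOpen_iff_mem_nhds]
      intro p hp
      rcases le_total m n with hmn | hmn
      · exact Eventually.of_forall fun q => hmono hmn q.2
      · have := (hCE n).rel_open (hCE m) (fun x y h => hmono hmn h) hp
        filter_upwards [continuous_subtype_val.continuousAt.eventually this] with q hq
        exact hq q.2
    refine @NT.mk X _ ↥R T _ _ Subtype.val_injective ?_ ?_
    · rintro ⟨x, y⟩
      rw [← hR]
      exact ⟨fun ⟨p, hp⟩ => hp ▸ p.2, fun h => ⟨⟨_, h⟩, rfl⟩⟩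
    · intro n p hp
      refine le_antisymm (le_inf ?_ ?_) ?_
      · exact (@Continuous.tendsto _ _ T _ _ hval p).le_comap
      · rw [le_principal_iff]
        exact @IsOpen.mem_nhds ↥R T p _ (hopE n) hp
      · intro U hU
        have h1 := (@Continuous.tendsto _ _ (relTop (Rs n)) T _ (hco n) ⟨p.1, hp⟩) hU
        rw [mem_map] at h1
        have h2 : @nhds _ (relTop (Rs n)) (⟨p.1, hp⟩ : Rs n) = comap Subtype.val (𝓝 p.1) :=
          nhds_subtype _ _
        rw [h2, mem_comap] at h1
        obtain ⟨W, hW, hWU⟩ := h1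
        rw [mem_inf_principal, mem_comap]
        refine ⟨W, hW, fun q hq hqn => ?_⟩
        exact hWU (show (⟨q.1, hqn⟩ : Rs n) ∈ Subtype.val ⁻¹' W from hq)

/-- Restriction of the inductive limit topology. -/
theorem NT.restrict {X : Type*} [TopologicalSpace X] {E : ℕ → X → X → Prop}
    (R : Set (X × X)) (T : TopologicalSpace ↥R) (h : @NT X _ ↥R T E Subtype.val) (Y : Set X) :
    @NT ↥Y _ ↥(restrictRel R Y) (restrictTop R T Y) (fun n x y => E n x y) Subtype.val := by
  have hR : ∀ x y, (x, y) ∈ R ↔ ∃ n, E n x y := fun x y =>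
    ⟨fun hp => h.lvl ⟨(x, y), hp⟩, fun hp => by
      obtain ⟨p, hp⟩ := (h.rng (x, y)).2 hp
      rw [← hp]; exact p.2⟩
  refine @NT.mk _ _ _ (restrictTop R T Y) _ _ Subtype.val_injective ?_ ?_
  · rintro ⟨x, y⟩
    rw [← hR]
    exact ⟨fun ⟨p, hp⟩ => by have := p.2; rw [hp] at this; exact this, fun h => ⟨⟨(x, y), h⟩, rfl⟩⟩
  · intro n p hp
    unfold restrictTop
    rw [nhds_induced, h.nh n _ hp, comap_inf, comap_comap, comap_principal]
    congr 1
    · have : (Subtype.val ∘ fun p : ↥(restrictRel R Y) => (⟨((p.1.1 : X), (p.1.2 : X)), p.2⟩ : ↥R))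
        = (Prod.map (Subtype.val : Y → X) (Subtype.val : Y → X)) ∘ Subtype.val := rfl
      rw [this, ← comap_comap]
      congr 1
      have hi : IsInducing (Prod.map (Subtype.val : Y → X) (Subtype.val : Y → X)) :=
        IsInducing.subtypeVal.prodMap IsInducing.subtypeVal
      exact (hi.nhds_eq_comap p.1).symm

theorem NT.subseq {Z S : Type*} [TopologicalSpace Z] [TopologicalSpace S] {F : ℕ → Z → Z → Prop}
    {e : S → Z × Z} (h : NT F e) (hmono : ∀ m n, m ≤ n → ∀ x y, F m x y → F n x y)
    {k : ℕ → ℕ} (hk : ∀ n, n ≤ k n) : NT (fun n => F (k n)) e where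
  inj := h.inj
  rng z := by
    rw [h.rng]
    exact ⟨fun ⟨n, hn⟩ => ⟨n, hmono _ _ (hk n) _ _ hn⟩, fun ⟨n, hn⟩ => ⟨k n, hn⟩⟩
  nh n p hp := h.nh _ p hp

end Absorb

open Set Topology MeasureTheory

namespace Absorb
open Filter
set_option linter.all false
set_option linter.deprecated false

section Meas
variable {X : Type*} [TopologicalSpace X] [CompactSpace X] [T2Space X] [TotallyDisconnectedSpace X]
variable {E : ℕ → X → X → Prop}

theorem graph_count (hE : ∀ n, IsCE (E n)) (hmono : ∀ m n, m ≤ n → ∀ x y, E m x y → E n x y)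
    (R : Set (X × X)) (T : TopologicalSpace ↥R) (h : @NT X _ ↥R T E Subtype.val)
    (U : Set R) (hU : IsGraph R T U) :
    ∃ n, ∀ m, n ≤ m → ∀ x, ({y | E m x y} ∩ ((fun p : ↥R => (p : X × X).1) '' U)).ncard
      = ({y | E m x y} ∩ ((fun p : ↥R => (p : X × X).2) '' U)).ncard := by
  letI := T
  obtain ⟨h1, h2, h3, h4, h5⟩ := hU
  have hc : IsCompact U := by
    have : IsCompact (univ : Set U) := by
      rw [h4.isInducing.isCompact_iff, image_univ]
      have e1 : range (fun p : ↥U => ((p : ↥R) : X × X).1) = (fun p : ↥R => (p : X × X).1) '' U := by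
        ext x; simp
      rw [e1]
      exact h2.isClosed.isCompact
    have := this.image (continuous_subtype_val (p := fun x => x ∈ U))
    rwa [image_univ, Subtype.range_coe] at this
  obtain ⟨n, hn⟩ := hc.elim_directed_cover (fun n => {q : R | E n q.1.1 q.1.2}) (fun n => h.open n)
    (fun p _ => mem_iUnion.2 (h.lvl p))
    (directed_of_isDirected_le fun m n hmn q hq => hmono m n hmn _ _ hq)
  refine ⟨n, fun m hm x => ?_⟩
  let S : Set R := {p | p ∈ U ∧ E m x p.1.1}
  have hr : ∀ p ∈ U, E m p.1.1 p.1.2 := fun p hp => hmono _ _ hm _ _ (hn hp)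
  have i1 : InjOn (fun p : ↥R => (p : X × X).1) S := fun p hp q hq hpq =>
    congrArg Subtype.val (h4.injective (a₁ := ⟨p, hp.1⟩) (a₂ := ⟨q, hq.1⟩) hpq)
  have i2 : InjOn (fun p : ↥R => (p : X × X).2) S := fun p hp q hq hpq =>
    congrArg Subtype.val (h5.injective (a₁ := ⟨p, hp.1⟩) (a₂ := ⟨q, hq.1⟩) hpq)
  have e1 : {y | E m x y} ∩ ((fun p : ↥R => (p : X × X).1) '' U) =
      (fun p : ↥R => (p : X × X).1) '' S := by
    ext y
    constructor
    · rintro ⟨hy, p, hp, rfl⟩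
      exact ⟨p, ⟨hp, hy⟩, rfl⟩
    · rintro ⟨p, hp, rfl⟩
      exact ⟨hp.2, p, hp.1, rfl⟩
  have e2 : {y | E m x y} ∩ ((fun p : ↥R => (p : X × X).2) '' U) =
      (fun p : ↥R => (p : X × X).2) '' S := by
    ext y
    constructor
    · rintro ⟨hy, p, hp, rfl⟩
      exact ⟨p, ⟨hp, (hE m).trans hy ((hE m).symm (hr p hp))⟩, rfl⟩
    · rintro ⟨p, hp, rfl⟩
      exact ⟨(hE m).trans hp.2 (hr p hp.1), p, hp.1, rfl⟩
  rw [e1, e2, ncard_image_of_injOn i1, ncard_image_of_injOn i2]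

/-- The graph of a continuous injective selection is a graph. -/
theorem graph_of_map (hE : ∀ n, IsCE (E n))
    (R : Set (X × X)) (T : TopologicalSpace ↥R) (h : @NT X _ ↥R T E Subtype.val)
    (n : ℕ) {O : Set X} (hO : IsClopen O) {φ : X → X} (hc : ContinuousOn φ O) (hi : InjOn φ O)
    (hφ : ∀ x ∈ O, E n x (φ x)) :
    IsClopen (φ '' O) ∧ ∃ U : Set R, IsGraph R T U ∧ (fun p : ↥R => (p : X × X).1) '' U = O ∧
      (fun p : ↥R => (p : X × X).2) '' U = φ '' O := by
  have hcl : IsClopen (φ '' O) := by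
    refine ⟨(hO.isClosed.isCompact.image_of_continuousOn hc).isClosed, ?_⟩
    rw [isOpen_iff_mem_nhds]
    rintro _ ⟨x, hx, rfl⟩
    obtain ⟨W, hW, hWi⟩ := (hE n).inj (φ x)
    have h1 : φ ⁻¹' W ∩ O ∈ 𝓝 x :=
      inter_mem ((hc.continuousAt (hO.isOpen.mem_nhds hx)) hW) (hO.isOpen.mem_nhds hx)
    filter_upwards [hW, (hE n).opn ((hE n).symm (hφ x hx)) h1] with y hy1 hy2
    obtain ⟨x', hx', hyx⟩ := hy2
    refine ⟨x', hx'.2, ?_⟩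
    exact (hWi _ hy1 _ hx'.1 ((hE n).trans hyx (hφ x' hx'.2))).symm
  refine ⟨hcl, ?_⟩
  letI := T
  have hex : ∀ x ∈ O, ∃ p : R, p.1 = (x, φ x) := fun x hx => (h.rng _).2 ⟨n, hφ x hx⟩
  let U : Set R := {p | p.1.1 ∈ O ∧ p.1.2 = φ p.1.1}
  have c1 : Continuous (fun p : R => p.1.1) := continuous_fst.comp h.cont
  have c2 : Continuous (fun p : R => p.1.2) := continuous_snd.comp h.cont
  have hUE : U ⊆ {q : R | E n q.1.1 q.1.2} := by
    intro p hp
    show E n p.1.1 p.1.2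
    rw [hp.2]; exact hφ _ hp.1
  have hop : IsOpen U := by
    rw [isOpen_iff_mem_nhds]
    intro p hp
    obtain ⟨W, hW, hWi⟩ := (hE n).inj (φ p.1.1)
    have h0 : ∀ᶠ q in 𝓝 p, q.1.1 ∈ O := c1.continuousAt.eventually (hO.isOpen.mem_nhds hp.1)
    have h1 : ∀ᶠ q in 𝓝 p, φ q.1.1 ∈ W :=
      c1.continuousAt.eventually ((hc.continuousAt (hO.isOpen.mem_nhds hp.1)) hW)
    have h2 : ∀ᶠ q in 𝓝 p, q.1.2 ∈ W := c2.continuousAt.eventually (by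
      show W ∈ 𝓝 p.1.2
      rw [hp.2]; exact hW)
    have h3 : ∀ᶠ q in 𝓝 p, E n q.1.1 q.1.2 := (h.open n).mem_nhds (hUE hp)
    filter_upwards [h0, h1, h2, h3] with q a0 a1 a2 a3
    exact ⟨a0, hWi _ a2 _ a1 ((hE n).trans ((hE n).symm a3) (hφ _ a0))⟩
  have hclo : IsClosed U := by
    rw [← isOpen_compl_iff, isOpen_iff_mem_nhds]
    intro p hp
    by_cases hpO : p.1.1 ∈ O
    · have hne : p.1.2 ≠ φ p.1.1 := fun h => hp ⟨hpO, h⟩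
      obtain ⟨A, B, hA, hB, hpA, hpB, hAB⟩ := t2_separation hne
      have h1 : ∀ᶠ q in 𝓝 p, φ q.1.1 ∈ B :=
        c1.continuousAt.eventually ((hc.continuousAt (hO.isOpen.mem_nhds hpO)) (hB.mem_nhds hpB))
      have h2 : ∀ᶠ q in 𝓝 p, q.1.2 ∈ A := c2.continuousAt.eventually (hA.mem_nhds hpA)
      filter_upwards [h1, h2] with q a1 a2 hq
      rw [← hq.2] at a1
      exact disjoint_left.1 hAB a2 a1
    · filter_upwards [c1.continuousAt.eventually (hO.compl.isOpen.mem_nhds hpO)] with q hq hq'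
      exact hq hq'.1
  have hUc : IsCompact U := (h.compact hE n).of_isClosed_subset hclo hUE
  haveI := isCompact_iff_compactSpace.1 hUc
  have e1 : (fun p : ↥R => (p : X × X).1) '' U = O := by
    ext x
    constructor
    · rintro ⟨p, hp, rfl⟩; exact hp.1
    · intro hx
      obtain ⟨p, hp⟩ := hex x hx
      exact ⟨p, ⟨by rw [hp]; exact hx, by rw [hp]⟩, by show p.1.1 = x; rw [hp]⟩
  have e2 : (fun p : ↥R => (p : X × X).2) '' U = φ '' O := by
    ext x
    constructor
    · rintro ⟨p, hp, rfl⟩; exact ⟨_, hp.1, hp.2.symm⟩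
    · rintro ⟨x, hx, rfl⟩
      obtain ⟨p, hp⟩ := hex x hx
      exact ⟨p, ⟨by rw [hp]; exact hx, by rw [hp]⟩, by show p.1.2 = φ x; rw [hp]⟩
  refine ⟨U, ⟨⟨hclo, hop⟩, by rw [e1]; exact hO, by rw [e2]; exact hcl, ?_, ?_⟩, e1, e2⟩
  · refine ((c1.comp continuous_subtype_val).isClosedEmbedding ?_).isEmbedding
    rintro ⟨p, hp⟩ ⟨q, hq⟩ hpq
    have hpq : p.1.1 = q.1.1 := hpq
    apply Subtype.ext; apply Subtype.ext
    exact Prod.ext hpq (by rw [hp.2, hq.2, hpq])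
  · refine ((c2.comp continuous_subtype_val).isClosedEmbedding ?_).isEmbedding
    rintro ⟨p, hp⟩ ⟨q, hq⟩ hpq
    have hpq : p.1.2 = q.1.2 := hpq
    apply Subtype.ext; apply Subtype.ext
    exact Prod.ext (hi hp.1 hq.1 (by rw [← hp.2, ← hq.2, hpq])) hpq

theorem thin_of_count [MeasurableSpace X] [BorelSpace X] (hE : ∀ n, IsCE (E n))
    (R : Set (X × X)) (T : TopologicalSpace ↥R) (h : @NT X _ ↥R T E Subtype.val) (A : Set X)
    (hth : ∀ N, ∃ n O, IsClopen O ∧ A ⊆ O ∧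
      ∀ x, N * ({y | E n x y} ∩ O).ncard ≤ {y | E n x y}.ncard) : IsThin R T A := by
  intro μ hμ hinv
  have key : ∀ N : ℕ, (N : ENNReal) * μ A ≤ 1 := by
    intro N
    obtain ⟨n, O, hO, hAO, hcnt⟩ := hth N
    have step : ∀ j, j ≤ N → ∃ W, IsClopen W ∧
        (∀ x, ({y | E n x y} ∩ W).ncard = j * ({y | E n x y} ∩ O).ncard) ∧ μ W = j * μ O := by
      intro j
      induction j with
      | zero => exact fun _ => ⟨∅, isClopen_empty, by simp, by simp⟩
      | succ j ih =>
        intro hj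
        obtain ⟨W, hW, hWc, hWμ⟩ := ih (by omega)
        obtain ⟨φ, p1, p2, p3, p4⟩ := (hE n).match' hO hW.compl (by
          intro x
          have h1 : ({y | E n x y} ∩ W).ncard + ({y | E n x y} ∩ Wᶜ).ncard
              = {y | E n x y}.ncard := by
            have := ncard_inter_add_ncard_diff_eq_ncard {y | E n x y} W ((hE n).fin x)
            rwa [diff_eq] at this
          have h2 := hcnt x
          have h3 : (j + 1) * ({y | E n x y} ∩ O).ncard ≤ N * ({y | E n x y} ∩ O).ncard :=
            Nat.mul_le_mul_right _ hj
          rw [hWc x] at h1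
          rw [add_mul, one_mul] at h3
          omega)
        obtain ⟨q1, U, q2, q3, q4⟩ := graph_of_map hE R T h n hO p1 p2 p4
        have hdis : Disjoint W (φ '' O) := by
          rw [disjoint_right]
          rintro _ ⟨x, hx, rfl⟩
          exact p3 hx
        have hμ' : μ (φ '' O) = μ O := by
          have := hinv U q2
          rw [q3, q4] at this
          exact this.symm
        refine ⟨W ∪ φ '' O, hW.union q1, ?_, ?_⟩
        · intro x
          rw [inter_union_distrib_left, ncard_union_eq (hdis.mono inter_subset_right inter_subset_right)
            (((hE n).fin x).inter_of_left _) (((hE n).fin x).inter_of_left _), hWc x, add_mul, one_mul]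
          congr 1
          have : {y | E n x y} ∩ φ '' O = φ '' ({y | E n x y} ∩ O) := by
            ext y
            constructor
            · rintro ⟨hy, z, hz, rfl⟩
              exact ⟨z, ⟨(hE n).trans hy ((hE n).symm (p4 z hz)), hz⟩, rfl⟩
            · rintro ⟨z, ⟨hz1, hz2⟩, rfl⟩
              exact ⟨(hE n).trans hz1 (p4 z hz2), z, hz2, rfl⟩
          rw [this, ncard_image_of_injOn (p2.mono inter_subset_right)]
        · rw [measure_union hdis q1.isOpen.measurableSet, hWμ, hμ']
          push_cast
          rw [add_mul, one_mul]
    obtain ⟨W, -, -, hW⟩ := step N le_rfl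
    calc (N : ENNReal) * μ A ≤ N * μ O := by gcongr
      _ = μ W := hW.symm
      _ ≤ 1 := prob_le_one
  by_contra hne
  obtain ⟨N, hN⟩ := ENNReal.exists_nat_mul_gt hne (by simp : (1 : ENNReal) ≠ ⊤)
  exact absurd (key N) (not_le.2 hN)

theorem uniform_apply [MeasurableSpace X] [BorelSpace X] {S : Set X} (hS : S.Finite) (A : Set X)
    (hA : MeasurableSet A) :
    ProbabilityTheory.uniformOn S A = ((S ∩ A).ncard : ENNReal) / (S.ncard : ENNReal) := by
  rw [ProbabilityTheory.uniformOn, ProbabilityTheory.cond_apply hS.measurableSet,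
    Measure.count_apply_finite _ hS, Measure.count_apply_finite _ (hS.inter_of_left A),
    ← ncard_eq_toFinset_card _ hS, ← ncard_eq_toFinset_card _ (hS.inter_of_left A), mul_comm]
  rfl

theorem thinCount_of_thin [TopologicalSpace.MetrizableSpace X] [MeasurableSpace X] [BorelSpace X]
    (hE : ∀ n, IsCE (E n)) (hmono : ∀ m n, m ≤ n → ∀ x y, E m x y → E n x y)
    (hmin : ∀ B : Set X, IsClopen B → B.Nonempty → ∃ n, ∀ x, ∃ y ∈ B, E n x y)
    (R : Set (X × X)) (T : TopologicalSpace ↥R) (h : @NT X _ ↥R T E Subtype.val)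
    {Y : Set X} (hY : IsClosed Y) (hth : IsThin R T Y) : ThinCount E Y := by
  classical
  letI := TopologicalSpace.metrizableSpaceMetric X
  by_contra hcon
  unfold ThinCount at hcon
  push Not at hcon
  obtain ⟨B, hB, hBn, N, hbad⟩ := hcon
  have hne : ∀ n x, {y | E n x y}.Nonempty := fun n x => ⟨x, (hE n).refl x⟩
  let m : ℕ → X → ProbabilityMeasure X := fun n x =>
    ⟨ProbabilityTheory.uniformOn {y | E n x y},
      ProbabilityTheory.isProbabilityMeasure_uniformOn ((hE n).fin x) (hne n x)⟩
  have hm : ∀ n x (A : Set X), IsClopen A → (m n x : Measure X) A =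
      (({y | E n x y} ∩ A).ncard : ENNReal) / ({y | E n x y}.ncard : ENNReal) :=
    fun n x A hA => uniform_apply ((hE n).fin x) A hA.isOpen.measurableSet
  have hpos : ∀ n x, ({y | E n x y}.ncard : ENNReal) ≠ 0 := by
    intro n x
    have := (ncard_pos ((hE n).fin x)).2 (hne n x)
    exact_mod_cast this.ne'
  have hcont : ∀ A : Set X, IsClopen A →
      Continuous (fun ν : ProbabilityMeasure X => (ν : Measure X) A) := by
    intro A hA
    rw [continuous_iff_continuousAt]
    intro ν
    exact ProbabilityMeasure.tendsto_measure_of_null_frontier_of_tendsto' tendsto_id (by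
      rw [hA.frontier_eq]; simp)
  let I := {U : Set X // IsClopen U ∧ Y ⊆ U} × ℕ
  let C : I → Set (ProbabilityMeasure X) := fun i => closure {ν | ∃ n x, i.2 ≤ n ∧
    ({y | E n x y} ∩ B).ncard < N * ({y | E n x y} ∩ i.1.1).ncard ∧ ν = m n x}
  haveI : Nonempty I := ⟨⟨⟨univ, isClopen_univ, subset_univ _⟩, 0⟩⟩
  have hCne : (⋂ i, C i).Nonempty := by
    refine IsCompact.nonempty_iInter_of_directed_nonempty_isCompact_isClosed C ?_ ?_ ?_ ?_
    · rintro ⟨⟨U, hU⟩, n⟩ ⟨⟨U', hU'⟩, n'⟩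
      refine ⟨⟨⟨U ∩ U', hU.1.inter hU'.1, subset_inter hU.2 hU'.2⟩, max n n'⟩, ?_, ?_⟩
      · apply closure_mono
        rintro ν ⟨k, x, h1, h2, h3⟩
        refine ⟨k, x, (le_max_left _ _).trans h1, h2.trans_le ?_, h3⟩
        gcongr
        · exact ((hE k).fin x).inter_of_left _
        · exact inter_subset_left
      · apply closure_mono
        rintro ν ⟨k, x, h1, h2, h3⟩
        refine ⟨k, x, (le_max_right _ _).trans h1, h2.trans_le ?_, h3⟩
        gcongr
        · exact ((hE k).fin x).inter_of_left _
        · exact inter_subset_right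
    · rintro ⟨⟨U, hU⟩, n⟩
      obtain ⟨k, hk, x, hx⟩ := hbad U hU.1 hU.2 n
      exact ⟨_, subset_closure ⟨k, x, hk, hx, rfl⟩⟩
    · exact fun i => isClosed_closure.isCompact
    · exact fun i => isClosed_closure
  obtain ⟨ν, hν⟩ := hCne
  rw [mem_iInter] at hν
  -- closed conditions
  have hcl : ∀ (i : I) (f g : ProbabilityMeasure X → ENNReal), Continuous f → Continuous g →
      (∀ n x, i.2 ≤ n → ({y | E n x y} ∩ B).ncard < N * ({y | E n x y} ∩ i.1.1).ncard →
        f (m n x) ≤ g (m n x)) → f ν ≤ g ν := by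
    intro i f g hf hg hfg
    have : C i ⊆ {ν | f ν ≤ g ν} := by
      refine closure_minimal ?_ (isClosed_le hf hg)
      rintro _ ⟨n, x, h1, h2, rfl⟩
      exact hfg n x h1 h2
    exact this (hν i)
  let i0 : ℕ → I := fun n => ⟨⟨univ, isClopen_univ, subset_univ _⟩, n⟩
  have hinv : IsInvariantMeasure R T (ν : Measure X) := by
    intro U hU
    obtain ⟨n, hn⟩ := graph_count hE hmono R T h U hU
    have hA := hU.2.1
    have hB' := hU.2.2.1
    have e : ∀ k x, n ≤ k → (m k x : Measure X) ((fun p : ↥R => (p : X × X).1) '' U) =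
        (m k x : Measure X) ((fun p : ↥R => (p : X × X).2) '' U) := by
      intro k x hk
      rw [hm _ _ _ hA, hm _ _ _ hB', hn k hk x]
    exact le_antisymm (hcl (i0 n) _ _ (hcont _ hA) (hcont _ hB') fun k x hk _ => (e k x hk).le)
      (hcl (i0 n) _ _ (hcont _ hB') (hcont _ hA) fun k x hk _ => (e k x hk).ge)
  have hνY := hth ν inferInstance hinv
  have hUB : ∀ U, IsClopen U → Y ⊆ U → (ν : Measure X) B ≤ N * (ν : Measure X) U := by
    intro U hU hYU
    refine hcl ⟨⟨U, hU, hYU⟩, 0⟩ _ _ (hcont _ hB)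
      (ENNReal.continuous_const_mul (ENNReal.natCast_ne_top N) |>.comp (hcont _ hU)) ?_
    intro n x _ hx
    show (m n x : Measure X) B ≤ N * (m n x : Measure X) U
    rw [hm _ _ _ hB, hm _ _ _ hU, ← mul_div_assoc]
    gcongr
    exact_mod_cast hx.le
  obtain ⟨n0, hn0⟩ := hmin B hB hBn
  obtain ⟨D, hD⟩ := (hE n0).finite
  have h1B : 1 ≤ D * (ν : Measure X) B := by
    refine hcl (i0 n0) (fun _ => 1) _ continuous_const
      (ENNReal.continuous_const_mul (ENNReal.natCast_ne_top D) |>.comp (hcont _ hB)) ?_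
    intro n x hn _
    show 1 ≤ D * (m n x : Measure X) B
    rw [hm _ _ _ hB, ← mul_div_assoc, ENNReal.le_div_iff_mul_le (Or.inl (hpos n x))
      (Or.inl (ENNReal.natCast_ne_top _)), one_mul]
    choose f hfB hf using hn0
    have hfin := (hE n).fin x
    have hfU : ({y | E n x y} ∩ B).Finite := hfin.inter_of_left B
    have h2 : hfin.toFinset.card ≤ D * hfU.toFinset.card := by
      refine Finset.card_le_mul_card_image_of_maps_to (f := f) ?_ D ?_
      · intro y hy
        simp only [Finite.mem_toFinset, mem_setOf_eq, mem_inter_iff] at hy ⊢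
        exact ⟨(hE n).trans hy (hmono _ _ hn _ _ (hf y)), hfB y⟩
      · intro b hb
        rw [← ncard_coe_finset]
        refine (ncard_le_ncard ?_ (hD b).1).trans (hD b).2
        intro z hz
        simp only [Finset.coe_filter, mem_setOf_eq] at hz
        show E n0 b z
        rw [← hz.2]; exact (hE n0).symm (hf z)
    rw [← ncard_eq_toFinset_card _ hfin, ← ncard_eq_toFinset_card _ hfU] at h2
    exact_mod_cast h2
  have hlt : ∃ U, IsClopen U ∧ Y ⊆ U ∧ (D * N : ENNReal) * (ν : Measure X) U < 1 := by
    obtain ⟨ε, hε, hεl⟩ : ∃ ε : ENNReal, 0 < ε ∧ (D * N : ENNReal) * ε < 1 := by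
      refine ⟨((D * N + 1 : ℕ) : ENNReal)⁻¹, 
        ENNReal.inv_pos.2 (ENNReal.natCast_ne_top _), ?_⟩
      rw [← div_eq_mul_inv, ENNReal.div_lt_iff
        (Or.inl (Nat.cast_ne_zero.2 (Nat.succ_ne_zero _))) (Or.inl (ENNReal.natCast_ne_top _)), one_mul]
      exact_mod_cast Nat.lt_succ_self (D * N)
    obtain ⟨V, hYV, hV, hVl⟩ := Y.exists_isOpen_lt_of_lt (μ := (ν : Measure X)) ε (by rwa [hνY])
    obtain ⟨W, hW, hYW, hWV⟩ := clopen_between hY hV hYV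
    refine ⟨W, hW, hYW, lt_of_le_of_lt ?_ hεl⟩
    gcongr
    exact (measure_mono hWV).trans hVl.le
  obtain ⟨U, hU, hYU, hUl⟩ := hlt
  have : (1 : ENNReal) ≤ D * (N * (ν : Measure X) U) := h1B.trans (by gcongr; exact hUB U hU hYU)
  rw [← mul_assoc] at this
  exact absurd this (not_le.2 hUl)

end Meas
end Absorb

open Set Topology MeasureTheory

namespace Absorb
open Filter
set_option linter.all false
set_option linter.deprecated false

section Tran
variable {Z : Type*} [TopologicalSpace Z]

/-- Transversality of `⋃ P n` and `K`. -/
structure Tr (P : ℕ → Z → Z → Prop) (K : Z → Z → Prop) : Prop where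
  hP : ∀ n, IsCE (P n)
  mono : ∀ m n, m ≤ n → ∀ x y, P m x y → P n x y
  hK : IsCE K
  dis : ∀ n x y, P n x y → K x y → x = y
  comm : ∀ n x y z, P n x y → K y z → ∃ w m, K x w ∧ P m w z
  ct : ∀ n x y z w, P n x y → K y z → K x w → P n w z → ∀ W ∈ 𝓝 w,
    ∀ᶠ p : Z × Z × Z in 𝓝 (x, y, z), P n p.1 p.2.1 → K p.2.1 p.2.2 →
      ∃ w' ∈ W, K p.1 w' ∧ P n w' p.2.2

/-- The exhaustion of the join. -/
def QQ (P : ℕ → Z → Z → Prop) (K : Z → Z → Prop) (n : ℕ) (x z : Z) : Prop :=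
  ∀ x', K x x' → ∃ z', K z z' ∧ P n x' z'

variable {P : ℕ → Z → Z → Prop} {K : Z → Z → Prop}

theorem Tr.comm' (h : Tr P K) {n : ℕ} {x y z : Z} (h1 : K x y) (h2 : P n y z) :
    ∃ w m, P m x w ∧ K w z := by
  obtain ⟨w, m, a, b⟩ := h.comm n z y x ((h.hP n).symm h2) (h.hK.symm h1)
  exact ⟨w, m, (h.hP m).symm b, h.hK.symm a⟩

/-- uniqueness of the middle point -/
theorem Tr.uniq (h : Tr P K) {n m : ℕ} {x y y' z : Z} (h1 : P n x y) (h2 : K y z) (h3 : P m x y')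
    (h4 : K y' z) : y = y' := by
  refine h.dis (max n m) _ _ ?_ (h.hK.trans h2 (h.hK.symm h4))
  exact (h.hP _).trans ((h.hP _).symm (h.mono _ _ (le_max_left _ _) _ _ h1))
    (h.mono _ _ (le_max_right _ _) _ _ h3)

theorem Tr.Qmono (h : Tr P K) {m n : ℕ} (hmn : m ≤ n) {x z : Z} (hq : QQ P K m x z) :
    QQ P K n x z := fun x' hx' => by
  obtain ⟨z', a, b⟩ := hq x' hx'
  exact ⟨z', a, h.mono _ _ hmn _ _ b⟩

theorem Tr.Qsymm (h : Tr P K) {n : ℕ} {x z : Z} (hq : QQ P K n x z) : QQ P K n z x := by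
  intro z' hz'
  obtain ⟨z1, a1, b1⟩ := hq x (h.hK.refl x)
  -- K z' z1, P z1 x
  obtain ⟨x', m, a, b⟩ := h.comm' (h.hK.trans (h.hK.symm hz') a1) ((h.hP n).symm b1)
  refine ⟨x', h.hK.symm b, ?_⟩
  obtain ⟨z2, a2, b2⟩ := hq x' (h.hK.symm b)
  have : z' = z2 := h.uniq ((h.hP m).symm a) (h.hK.symm hz') b2 (h.hK.symm a2)
  rw [this]; exact (h.hP n).symm b2

variable [CompactSpace Z] [T2Space Z]

theorem Tr.mid (h : Tr P K) {n : ℕ} {x y z : Z} (h1 : P n x y) (h2 : K y z) {V : Set Z}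
    (hV : V ∈ 𝓝 y) :
    ∀ᶠ p : Z × Z in 𝓝 (x, z), ∀ w, P n p.1 w → K w p.2 → w ∈ V := by
  obtain ⟨O, hO1, hO2, hO3⟩ := mem_nhds_iff.1 hV
  have hc : IsClosed {p : Z × Z | ∃ w, w ∉ O ∧ P n p.1 w ∧ K w p.2} := by
    have e : {p : Z × Z | ∃ w, w ∉ O ∧ P n p.1 w ∧ K w p.2} =
        (Prod.fst : (Z × Z) × Z → Z × Z) '' {q | q.2 ∉ O ∧ P n q.1.1 q.2 ∧ K q.2 q.1.2} := by
      ext p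
      constructor
      · rintro ⟨w, hw⟩; exact ⟨(p, w), hw, rfl⟩
      · rintro ⟨⟨p, w⟩, hw, rfl⟩; exact ⟨w, hw⟩
    rw [e]
    refine (IsCompact.image ?_ continuous_fst).isClosed
    refine IsClosed.isCompact ?_
    refine (hO2.isClosed_compl.preimage continuous_snd).inter (IsClosed.inter ?_ ?_)
    · exact (h.hP n).clo.preimage
        ((continuous_fst.comp continuous_fst).prodMk continuous_snd)
    · exact h.hK.clo.preimage
        (continuous_snd.prodMk (continuous_snd.comp continuous_fst))
  have hn : (x, z) ∉ {p : Z × Z | ∃ w, w ∉ O ∧ P n p.1 w ∧ K w p.2} := by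
    rintro ⟨w, hw, a, b⟩
    apply hw
    rw [← h.uniq h1 h2 a b]; exact hO3
  filter_upwards [hc.isOpen_compl.mem_nhds hn] with p hp w a b
  by_contra hw
  exact hp ⟨w, fun h => hw (hO1 h), a, b⟩

variable [TotallyDisconnectedSpace Z]

theorem Tr.Qopn (h : Tr P K) {n : ℕ} {x z : Z} {U : Set Z} (hq : QQ P K n x z) (hU : U ∈ 𝓝 z) :
    ∀ᶠ x' in 𝓝 x, ∃ z' ∈ U, QQ P K n x' z' := by
  obtain ⟨x0, hx0, hP0⟩ := h.Qsymm hq z (h.hK.refl z)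
  have hN : ∀ x', K x x' → ∃ A ∈ 𝓝 z, ∃ B ∈ 𝓝 x0, ∃ C, IsOpen C ∧ x' ∈ C ∧ ∀ a ∈ A, ∀ b ∈ B,
      ∀ c ∈ C, P n a b → K b c → ∃ w', K a w' ∧ P n w' c := by
    intro x' hx'
    obtain ⟨z', hz', hp'⟩ := hq x' hx'
    have := h.ct n z x0 x' z' hP0 (h.hK.trans (h.hK.symm hx0) hx') hz' ((h.hP n).symm hp')
      univ univ_mem
    rw [nhds_prod_eq, nhds_prod_eq, eventually_prod_iff] at this
    obtain ⟨pa, ha, pb, hb, hab⟩ := this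
    rw [eventually_prod_iff] at hb
    obtain ⟨pb1, hb1, pb2, hb2, hbb⟩ := hb
    obtain ⟨C, hC1, hC2, hC3⟩ := mem_nhds_iff.1 hb2
    refine ⟨_, ha, _, hb1, C, hC2, hC3, fun a haa b hbb' c hc h1 h2 => ?_⟩
    obtain ⟨w', -, w1, w2⟩ := hab haa (hbb hbb' (hC1 hc)) h1 h2
    exact ⟨w', w1, w2⟩
  choose! A hA B hB C hC1 hC2 hC using hN
  have hfin := h.hK.fin x
  have hAi : (⋂ x' ∈ {y | K x y}, A x') ∈ 𝓝 z := (biInter_mem hfin).2 fun x' hx' => hA x' hx'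
  have hBi : (⋂ x' ∈ {y | K x y}, B x') ∈ 𝓝 x0 := (biInter_mem hfin).2 fun x' hx' => hB x' hx'
  -- classes of nearby points are nearby
  have hcl : ∀ᶠ xt in 𝓝 x, ∀ y, K xt y → ∃ x', K x x' ∧ y ∈ C x' := by
    let O : Set Z := ⋃ x' ∈ {y | K x y}, C x'
    have hO : IsOpen O := isOpen_biUnion fun x' hx' => hC1 x' hx'
    have hcl := h.hK.satClosed hO.isClosed_compl
    have hn : x ∉ {x | ∃ y ∈ Oᶜ, K x y} := by
      rintro ⟨y, hy, hxy⟩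
      exact hy (mem_biUnion hxy (hC2 y hxy))
    filter_upwards [hcl.isOpen_compl.mem_nhds hn] with xt hxt y hy
    by_contra hcon
    refine hxt ⟨y, fun hyO => hcon ?_, hy⟩
    simp only [O, mem_iUnion] at hyO
    obtain ⟨x', hx', hyC⟩ := hyO
    exact ⟨x', hx', hyC⟩
  have h1 := (h.hP n).opn ((h.hP n).symm hP0) (inter_mem hU hAi)
  have h2 := h.hK.opn hx0 (inter_mem hBi h1)
  filter_upwards [hcl, h2] with xt hxt hxt2
  obtain ⟨xt0, ⟨hb, zt, ⟨hzU, hzA⟩, hPz⟩, hK0⟩ := hxt2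
  refine ⟨zt, hzU, ?_⟩
  intro y hy
  obtain ⟨x', hx', hyC⟩ := hxt y hy
  rw [mem_iInter₂] at hb hzA
  obtain ⟨w', w1, w2⟩ := hC x' hx' zt (hzA x' hx') xt0 (hb x' hx') y hyC ((h.hP n).symm hPz)
    (h.hK.trans (h.hK.symm hK0) hy)
  exact ⟨w', w1, (h.hP n).symm w2⟩

theorem Tr.Qce (h : Tr P K) (n : ℕ) : IsCE (QQ P K n) where
  refl x x' hx' := ⟨x', hx', (h.hP n).refl x'⟩
  symm hq := h.Qsymm hq
  trans := by
    intro x y z h1 h2 x' hx'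
    obtain ⟨y', a, b⟩ := h1 x' hx'
    obtain ⟨z', c, d⟩ := h2 y' a
    exact ⟨z', c, (h.hP n).trans b d⟩
  clo := by
    have hc : IsClosed {p : Z × Z | ∃ w, K p.2 w ∧ P n p.1 w} := by
      have e : {p : Z × Z | ∃ w, K p.2 w ∧ P n p.1 w} =
          (Prod.fst : (Z × Z) × Z → Z × Z) '' {q | K q.1.2 q.2 ∧ P n q.1.1 q.2} := by
        ext p
        constructor
        · rintro ⟨w, hw⟩; exact ⟨(p, w), hw, rfl⟩
        · rintro ⟨⟨p, w⟩, hw, rfl⟩; exact ⟨w, hw⟩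
      rw [e]
      refine (IsCompact.image ?_ continuous_fst).isClosed
      refine IsClosed.isCompact (IsClosed.inter ?_ ?_)
      · exact h.hK.clo.preimage ((continuous_snd.comp continuous_fst).prodMk continuous_snd)
      · exact (h.hP n).clo.preimage
          ((continuous_fst.comp continuous_fst).prodMk continuous_snd)
    rw [← isOpen_compl_iff, isOpen_iff_mem_nhds]
    rintro ⟨x, z⟩ hxz
    have : ∃ x', K x x' ∧ (x', z) ∉ {p : Z × Z | ∃ w, K p.2 w ∧ P n p.1 w} := by
      by_contra hcon
      push Not at hcon
      exact hxz fun x' hx' => hcon x' hx'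
    obtain ⟨x', hx', hn⟩ := this
    have hn' := hc.isOpen_compl.mem_nhds hn
    rw [nhds_prod_eq, mem_prod_iff] at hn'
    obtain ⟨A, hA, B, hB, hAB⟩ := hn'
    have h1 := h.hK.opn hx' hA
    rw [nhds_prod_eq]
    filter_upwards [prod_mem_prod h1 hB] with p hp hq
    obtain ⟨y, hy, hpy⟩ := hp.1
    exact hAB (show (y, p.2) ∈ A ×ˢ B from ⟨hy, hp.2⟩) (hq y hpy)
  opn := h.Qopn
  inj := by
    intro x
    obtain ⟨U, hU, hUi⟩ := (h.hP n).inj x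
    obtain ⟨V, hV, hVi⟩ := h.hK.inj x
    have := h.mid ((h.hP n).refl x) (h.hK.refl x) (inter_mem hU hV)
    rw [nhds_prod_eq, eventually_prod_iff] at this
    obtain ⟨pa, ha, pb, hb, hab⟩ := this
    refine ⟨(U ∩ V) ∩ ({a | pa a} ∩ {b | pb b}), inter_mem (inter_mem hU hV) (inter_mem ha hb), ?_⟩
    intro y hy z hz hq
    obtain ⟨w, hw1, hw2⟩ := hq y (h.hK.refl y)
    have hw := hab hy.2.1 hz.2.2 w hw2 (h.hK.symm hw1)
    rw [hUi y hy.1.1 w hw.1 hw2, hVi w hw.2 z hz.1.2 (h.hK.symm hw1)]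

theorem Tr.PQ (h : Tr P K) {n m : ℕ} {x z : Z} (hp : P m x z) (hq : QQ P K n x z) : P n x z := by
  obtain ⟨w, a, b⟩ := hq x (h.hK.refl x)
  rw [h.uniq hp (h.hK.refl z) b (h.hK.symm a)]; exact b

theorem Tr.PQce (h : Tr P K) (n : ℕ) : IsCE (fun x y => (∃ m, P m x y) ∧ QQ P K n x y) := by
  have e : (fun x y => (∃ m, P m x y) ∧ QQ P K n x y) = fun x y => P n x y ∧ QQ P K n x y := by
    funext x y
    exact propext ⟨fun ⟨⟨m, hm⟩, hq⟩ => ⟨h.PQ hm hq, hq⟩, fun ⟨hp, hq⟩ => ⟨⟨n, hp⟩, hq⟩⟩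
  rw [e]
  have hQ := h.Qce n
  refine ⟨fun x => ⟨(h.hP n).refl x, hQ.refl x⟩, fun a => ⟨(h.hP n).symm a.1, hQ.symm a.2⟩,
    fun a b => ⟨(h.hP n).trans a.1 b.1, hQ.trans a.2 b.2⟩, (h.hP n).clo.inter hQ.clo, ?_, ?_⟩
  · intro x z U hxz hU
    obtain ⟨V, hV, hVi⟩ := h.hK.inj z
    have := h.mid hxz.1 (h.hK.refl z) hV
    rw [nhds_prod_eq, eventually_prod_iff] at this
    obtain ⟨pa, ha, pb, hb, hab⟩ := this
    filter_upwards [ha, hQ.opn hxz.2 (inter_mem hU (inter_mem hV hb))] with x' hx1 hx2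
    obtain ⟨z', hz', hq⟩ := hx2
    obtain ⟨w, hw1, hw2⟩ := hq x' (h.hK.refl x')
    have hw := hab hx1 hz'.2.2 w hw2 (h.hK.symm hw1)
    have : w = z' := hVi w hw z' hz'.2.1 (h.hK.symm hw1)
    refine ⟨z', hz'.1, ?_, hq⟩
    rw [← this]; exact hw2
  · intro x
    obtain ⟨U, hU, hUi⟩ := hQ.inj x
    exact ⟨U, hU, fun y hy z hz hyz => hUi y hy z hz hyz.2⟩

theorem Tr.exists_Q (h : Tr P K) {n : ℕ} {x y z : Z} (h1 : P n x y) (h2 : K y z) :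
    ∃ m, QQ P K m x z := by
  have : ∀ x', K x x' → ∃ m, ∃ z', K z z' ∧ P m x' z' := by
    intro x' hx'
    obtain ⟨w, m, a, b⟩ := h.comm' (h.hK.symm hx') h1
    exact ⟨m, w, h.hK.symm (h.hK.trans b h2), a⟩
  choose! m hm using this
  obtain ⟨M, hM⟩ := ((h.hK.fin x).image m).bddAbove
  refine ⟨M, fun x' hx' => ?_⟩
  obtain ⟨z', a, b⟩ := hm x' hx'
  exact ⟨z', a, h.mono _ _ (hM ⟨x', hx', rfl⟩) _ _ b⟩

theorem Tr.ev (h : Tr P K) {n : ℕ} {x y z : Z} (h1 : P n x y) (h2 : K y z) (h3 : QQ P K n x z) :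
    ∀ᶠ p : Z × Z × Z in 𝓝 (x, y, z), P n p.1 p.2.1 → K p.2.1 p.2.2 → QQ P K n p.1 p.2.2 := by
  obtain ⟨U, hU, hUi⟩ := (h.hP n).inj y
  obtain ⟨V, hV, hVi⟩ := h.hK.inj z
  have := h.mid h1 h2 hU
  rw [nhds_prod_eq, eventually_prod_iff] at this
  obtain ⟨pa, ha, pb, hb, hab⟩ := this
  have ho := h.Qopn h3 (inter_mem hV hb)
  rw [nhds_prod_eq, nhds_prod_eq]
  filter_upwards [prod_mem_prod (inter_mem ha ho) (prod_mem_prod hU hV)] with p hp q1 q2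
  obtain ⟨⟨hpa, z', hz', hq⟩, hpU, hpV⟩ := hp
  obtain ⟨w, hw1, hw2⟩ := hq p.1 (h.hK.refl _)
  have hw := hab hpa hz'.2 w hw2 (h.hK.symm hw1)
  have e1 : p.2.1 = w := hUi _ hpU _ hw ((h.hP n).trans ((h.hP n).symm q1) hw2)
  have e2 : p.2.2 = z' := hVi _ hpV _ hz'.1 (h.hK.trans (h.hK.symm q2) (by
    rw [e1]; exact h.hK.symm hw1))
  rw [e2]; exact hq

/-- Each `P n` lies in some `QQ m`. -/
theorem Tr.P_sub_Q (h : Tr P K) (n : ℕ) : ∃ m, ∀ x y, P n x y → QQ P K m x y := by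
  have hc : IsCompact {p : Z × Z | P n p.1 p.2} := (h.hP n).clo.isCompact
  have key := hc.induction_on
    (p := fun s => ∃ m, ∀ p ∈ s, P n p.1 p.2 → QQ P K m p.1 p.2) ?_ ?_ ?_ ?_
  · obtain ⟨m, hm⟩ := key
    exact ⟨m, fun x y hxy => hm (x, y) hxy hxy⟩
  · exact ⟨0, by simp⟩
  · rintro s t hst ⟨m, hm⟩
    exact ⟨m, fun p hp => hm p (hst hp)⟩
  · rintro s t ⟨m, hm⟩ ⟨m', hm'⟩
    refine ⟨max m m', fun p hp hpp => ?_⟩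
    rcases hp with hp | hp
    · exact h.Qmono (le_max_left _ _) (hm p hp hpp)
    · exact h.Qmono (le_max_right _ _) (hm' p hp hpp)
  · rintro ⟨x, y⟩ hxy
    obtain ⟨m, hm⟩ := h.exists_Q hxy (h.hK.refl y)
    let M := max n m
    have hev := h.ev (h.mono _ _ (le_max_left n m) _ _ hxy) (h.hK.refl y)
      (h.Qmono (le_max_right n m) hm)
    have hcont : Continuous (fun p : Z × Z => (p.1, p.2, p.2)) := by fun_prop
    have h2 := (hcont.tendsto (x, y)).eventually hev
    refine ⟨_, mem_nhdsWithin_of_mem_nhds h2, M, fun p hp hpp => ?_⟩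
    exact hp (h.mono _ _ (le_max_left n m) _ _ hpp) (h.hK.refl _)

end Tran

end Absorb

open Set Topology MeasureTheory

namespace Absorb
open Filter
set_option linter.all false
set_option linter.deprecated false

section Tran2

theorem restrict_CE {X : Type*} [TopologicalSpace X] [CompactSpace X] [T2Space X]
    [TotallyDisconnectedSpace X] {E : ℕ → X → X → Prop} (hE : ∀ n, IsCE (E n))
    (R : Set (X × X)) (T : TopologicalSpace ↥R) (h : @NT X _ ↥R T E Subtype.val) (Y : Set X) [CompactSpace ↥Y]
    (hYe : IsEtaleEquivRel (restrictRel R Y) (restrictTop R T Y)) (n : ℕ) :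
    IsCE (fun x y : ↥Y => E n x y) := by
  refine isCE_pull (hE n) continuous_subtype_val Subtype.val_injective ?_
  intro v w W hvw hW
  have hN := NT.restrict R T h Y
  letI := restrictTop R T Y
  obtain ⟨p, hp⟩ := (hN.rng (v, w)).2 ⟨n, hvw⟩
  have h1 : {q : ↥(restrictRel R Y) | E n q.1.1 q.1.2} ∈ 𝓝 p :=
    (hN.open n).mem_nhds (by show E n p.1.1 p.1.2; rw [hp]; exact hvw)
  have h2 : {q : ↥(restrictRel R Y) | q.1.2 ∈ W} ∈ 𝓝 p := by
    have c : Continuous (fun q : ↥(restrictRel R Y) => q.1.2) := continuous_snd.comp hN.cont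
    refine c.continuousAt (x := p) ?_
    rw [hp]; exact hW
  have h3 := hYe.localHomeo_range.isOpenMap.image_mem_nhds (inter_mem h1 h2)
  have e : ((p : ↥Y × ↥Y).1) = v := by rw [hp]
  simp only [e] at h3
  filter_upwards [h3] with v' hv'
  obtain ⟨q, hq, rfl⟩ := hv'
  exact ⟨q.1.2, hq.2, hq.1⟩

variable {Z : Type*} [TopologicalSpace Z] {P : ℕ → Z → Z → Prop}
  {R K : Set (Z × Z)} {T : TopologicalSpace ↥R} {TK : TopologicalSpace ↥K}

theorem fib_nhds (h : @NT Z _ ↥R T P Subtype.val)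
    (hTK : ∀ p : K, @nhds _ TK p = comap Subtype.val (𝓝 p.1)) (n : ℕ) (q : Fib R K)
    (hq : P n q.1.1.1.1 q.1.1.1.2) :
    @nhds _ (fibTop T TK) q = comap (fun q : Fib R K => (q.1.1.1, q.1.2.1)) (𝓝 (q.1.1.1, q.1.2.1)) ⊓
      𝓟 {q | P n q.1.1.1.1 q.1.1.1.2} := by
  letI := T
  letI := TK
  have : @nhds _ (fibTop T TK) q = comap Subtype.val (𝓝 q.1.1 ×ˢ 𝓝 q.1.2) := by
    rw [← nhds_prod_eq]; exact nhds_subtype_eq_comap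
  rw [this, h.nh n _ hq, hTK, nhds_prod_eq (x := q.1.1.1) (y := q.1.2.1), Filter.prod_eq_inf,
    Filter.prod_eq_inf]
  simp only [comap_inf, comap_comap, comap_principal]
  rw [inf_right_comm]
  rfl

theorem fib_nhds' (h : @NT Z _ ↥R T P Subtype.val)
    (hTK : ∀ p : K, @nhds _ TK p = comap Subtype.val (𝓝 p.1)) (n : ℕ) (q : Fib K R)
    (hq : P n q.1.2.1.1 q.1.2.1.2) :
    @nhds _ (fibTop TK T) q = comap (fun q : Fib K R => (q.1.1.1, q.1.2.1)) (𝓝 (q.1.1.1, q.1.2.1)) ⊓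
      𝓟 {q | P n q.1.2.1.1 q.1.2.1.2} := by
  letI := T
  letI := TK
  have : @nhds _ (fibTop TK T) q = comap Subtype.val (𝓝 q.1.1 ×ˢ 𝓝 q.1.2) := by
    rw [← nhds_prod_eq]; exact nhds_subtype_eq_comap
  rw [this, h.nh n _ hq, hTK, nhds_prod_eq (x := q.1.1.1) (y := q.1.2.1), Filter.prod_eq_inf,
    Filter.prod_eq_inf]
  simp only [comap_inf, comap_comap, comap_principal]
  rw [inf_assoc]
  rfl

theorem NT.mem {Z : Type*} [TopologicalSpace Z] {P : ℕ → Z → Z → Prop} {R : Set (Z × Z)}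
    {T : TopologicalSpace ↥R} (h : @NT Z _ ↥R T P Subtype.val) (x y : Z) :
    (x, y) ∈ R ↔ ∃ n, P n x y :=
  ⟨fun hp => h.lvl ⟨(x, y), hp⟩, fun hp => by
      obtain ⟨p, hp⟩ := (h.rng (x, y)).2 hp
      rw [← hp]; exact p.2⟩

theorem tr_of_transverse (hP : ∀ n, IsCE (P n))
    (mono : ∀ m n, m ≤ n → ∀ x y, P m x y → P n x y)
    (h : @NT Z _ ↥R T P Subtype.val) (hK : IsCE (fun x y => (x, y) ∈ K))
    (hTK : ∀ p : K, @nhds _ TK p = comap Subtype.val (𝓝 p.1))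
    (htr : AreTransverse K TK R T) : Tr P (fun x y => (x, y) ∈ K) := by
  obtain ⟨hd, f, hf, hfR, hfS⟩ := htr
  have hR := h.mem
  have dis : ∀ n x y, P n x y → (x, y) ∈ K → x = y := by
    intro n x y h1 h2
    have : (x, y) ∈ K ∩ R := ⟨h2, (hR x y).2 ⟨n, h1⟩⟩
    rw [hd] at this; exact this
  obtain ⟨g, hg, hgR, hgS⟩ : ∃ g : Fib R K → Fib K R,
      @Continuous _ _ (fibTop T TK) (fibTop TK T) g ∧ (∀ q, fibR (g q) = fibR q) ∧
        ∀ q, fibS (g q) = fibS q := by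
    letI := fibTop T TK
    letI := fibTop TK T
    let H := hf.homeomorph
    have e : ∀ q, f (H.symm q) = q := fun q => H.apply_symm_apply q
    refine ⟨H.symm, H.symm.continuous, fun q => ?_, fun q => ?_⟩
    · rw [← hfR, e]
    · rw [← hfS, e]
  have gm : ∀ (x y z : Z) (h1 : (x, y) ∈ R) (h2 : (y, z) ∈ K),
      ((g ⟨(⟨(x, y), h1⟩, ⟨(y, z), h2⟩), rfl⟩).1.1.1 = (x, (g ⟨(⟨(x, y), h1⟩, ⟨(y, z), h2⟩), rfl⟩).1.2.1.1))
       ∧ ((g ⟨(⟨(x, y), h1⟩, ⟨(y, z), h2⟩), rfl⟩).1.2.1 = ((g ⟨(⟨(x, y), h1⟩, ⟨(y, z), h2⟩), rfl⟩).1.2.1.1, z)) := by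
    intro x y z h1 h2
    refine ⟨Prod.ext (hgR _) (g _).2, Prod.ext rfl (hgS _)⟩
  refine ⟨hP, mono, hK, dis, ?_, ?_⟩
  · intro n x y z h1 h2
    have h1' := (hR x y).2 ⟨n, h1⟩
    obtain ⟨a, b⟩ := gm x y z h1' h2
    generalize hq : g ⟨(⟨(x, y), h1'⟩, ⟨(y, z), h2⟩), rfl⟩ = q at a b
    have c1 := q.1.1.2
    have c2 := q.1.2.2
    rw [a] at c1
    rw [b, hR] at c2
    obtain ⟨m, hm⟩ := c2
    exact ⟨_, m, c1, hm⟩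
  · intro n x y z w h1 h2 h3 h4 W hW
    have h1' := (hR x y).2 ⟨n, h1⟩
    obtain ⟨a, b⟩ := gm x y z h1' h2
    set q0 : Fib R K := ⟨(⟨(x, y), h1'⟩, ⟨(y, z), h2⟩), rfl⟩ with hq0
    have c1 := (g q0).1.1.2
    have c2 := (g q0).1.2.2
    rw [a] at c1
    rw [b, hR] at c2
    obtain ⟨m, hm⟩ := c2
    have hw : (g q0).1.2.1.1 = w := by
      refine dis (max m n) _ _ ((hP _).trans (mono _ _ (le_max_left _ _) _ _ hm)
        ((hP _).symm (mono _ _ (le_max_right _ _) _ _ h4))) (hK.trans (hK.symm c1) h3)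
    rw [hw] at a b
    have ev : {r : Fib K R | r.1.2.1.1 ∈ W ∧ P n r.1.2.1.1 r.1.2.1.2} ∈ @nhds _ (fibTop TK T) (g q0) := by
      rw [fib_nhds' h hTK n (g q0) (by rw [b]; exact h4)]
      refine inter_mem_inf (preimage_mem_comap (m := fun q : Fib K R => (q.1.1.1, q.1.2.1))
        (t := {r | r.2.1 ∈ W}) ?_) (mem_principal_self _)
      have : Continuous (fun r : (Z × Z) × (Z × Z) => r.2.1) := by fun_prop
      refine this.continuousAt (x := ((g q0).1.1.1, (g q0).1.2.1)) ?_
      show W ∈ 𝓝 (g q0).1.2.1.1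
      rw [hw]; exact hW
    have ev2 := (@Continuous.continuousAt _ _ (fibTop T TK) (fibTop TK T) g q0 hg) ev
    rw [mem_map, fib_nhds h hTK n q0 h1, mem_inf_principal, mem_comap] at ev2
    obtain ⟨U, hU, hUs⟩ := ev2
    have cc : Continuous (fun p : Z × Z × Z => ((p.1, p.2.1), (p.2.1, p.2.2))) := by fun_prop
    have := cc.continuousAt (x := (x, y, z)) hU
    filter_upwards [this] with p hp k1 k2
    have k1' := (hR p.1 p.2.1).2 ⟨n, k1⟩
    obtain ⟨a', b'⟩ := gm p.1 p.2.1 p.2.2 k1' k2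
    set q1 : Fib R K := ⟨(⟨(p.1, p.2.1), k1'⟩, ⟨(p.2.1, p.2.2), k2⟩), rfl⟩ with hq1
    obtain ⟨u1, u2⟩ := hUs (show q1 ∈ _ from hp) k1
    have c1 := (g q1).1.1.2
    rw [a'] at c1
    rw [b'] at u2
    exact ⟨_, u1, c1, u2⟩

theorem nt_join [CompactSpace Z] [T2Space Z] [TotallyDisconnectedSpace Z] (h : @NT Z _ ↥R T P Subtype.val)
    (hTK : ∀ p : K, @nhds _ TK p = comap Subtype.val (𝓝 p.1))
    (ht : Tr P (fun x y => (x, y) ∈ K)) :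
    @NT Z _ ↥(joinRel R K) (joinTop R K T TK) (QQ P (fun x y => (x, y) ∈ K)) Subtype.val := by
  have hR := h.mem
  have hj : ∀ x z, (x, z) ∈ joinRel R K ↔ ∃ n, QQ P (fun x y => (x, y) ∈ K) n x z := by
    intro x z
    constructor
    · intro hx
      have hx : Relation.EqvGen (fun a b => (a, b) ∈ R ∨ (a, b) ∈ K) x z := hx
      clear * - hx ht hR
      induction hx with
      | rel x y hxy =>
        rcases hxy with h1 | h1
        · obtain ⟨n, hn⟩ := (hR x y).1 h1
          exact ht.exists_Q hn (ht.hK.refl y)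
        · exact ht.exists_Q ((ht.hP 0).refl x) h1
      | refl x => exact ⟨0, (ht.Qce 0).refl x⟩
      | symm x y _ ih => exact ih.imp fun n hn => (ht.Qce n).symm hn
      | trans x y z _ _ ih1 ih2 =>
        obtain ⟨n, hn⟩ := ih1
        obtain ⟨m, hm⟩ := ih2
        exact ⟨max n m, (ht.Qce _).trans (ht.Qmono (le_max_left _ _) hn)
          (ht.Qmono (le_max_right _ _) hm)⟩
    · rintro ⟨n, hn⟩
      obtain ⟨z', h1, h2⟩ := hn x (ht.hK.refl x)
      exact Relation.EqvGen.trans _ z' _ (Relation.EqvGen.rel _ _ (Or.inl ((hR _ _).2 ⟨n, h2⟩)))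
        (Relation.EqvGen.rel _ _ (Or.inr (ht.hK.symm h1)))
  have mf : ∀ q : Fib R K, (∃ n, P n q.1.1.1.1 q.1.1.1.2) ∧ (q.1.1.1.2, q.1.2.1.2) ∈ K := by
    intro q
    refine ⟨(hR _ _).1 q.1.1.2, ?_⟩
    rw [q.2]; exact q.1.2.2
  have hbij : Function.Bijective (rsFun R K) := by
    constructor
    · intro q q' hqq
      have hqq := congrArg Subtype.val hqq
      have e1 : q.1.1.1.1 = q'.1.1.1.1 := by
        have := congrArg (fun p : Z × Z => p.1) hqq
        exact this
      have e2 : q.1.2.1.2 = q'.1.2.1.2 := by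
        have := congrArg (fun p : Z × Z => p.2) hqq
        exact this
      obtain ⟨⟨n, a⟩, b⟩ := mf q
      obtain ⟨⟨n', a'⟩, b'⟩ := mf q'
      rw [← e1] at a'
      rw [← e2] at b'
      have e3 := ht.uniq a b a' b'
      refine Subtype.ext (Prod.ext (Subtype.ext (Prod.ext e1 e3)) (Subtype.ext (Prod.ext ?_ e2)))
      rw [← q.2, ← q'.2, e3]
    · rintro ⟨⟨x, z⟩, hp⟩
      obtain ⟨n, hn⟩ := (hj x z).1 hp
      obtain ⟨z', h1, h2⟩ := hn x (ht.hK.refl x)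
      exact ⟨⟨(⟨(x, z'), (hR _ _).2 ⟨n, h2⟩⟩, ⟨(z', z), ht.hK.symm h1⟩), rfl⟩, rfl⟩
  let e := Equiv.ofBijective _ hbij
  have ec : ∀ q, e q = rsFun R K q := fun q => rfl
  have e1 : ∀ p, (e.symm p).1.1.1.1 = p.1.1 := fun p => by
    conv_rhs => rw [← e.apply_symm_apply p]
    rfl
  have e2 : ∀ p, (e.symm p).1.2.1.2 = p.1.2 := fun p => by
    conv_rhs => rw [← e.apply_symm_apply p]
    rfl
  have hm : ∀ n p, QQ P (fun x y => (x, y) ∈ K) n p.1.1 p.1.2 →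
      P n (e.symm p).1.1.1.1 (e.symm p).1.1.1.2 := by
    intro n p hq
    obtain ⟨z', h1, h2⟩ := hq p.1.1 (ht.hK.refl _)
    obtain ⟨⟨m, a⟩, b⟩ := mf (e.symm p)
    rw [e1] at a
    rw [e2] at b
    rw [e1, ht.uniq a b h2 (ht.hK.symm h1)]
    exact h2
  refine @NT.mk _ _ _ (joinTop R K T TK) _ _ Subtype.val_injective ?_ ?_
  · rintro ⟨x, z⟩
    rw [← hj]
    exact ⟨fun ⟨p, hp⟩ => by have := p.2; rw [hp] at this; exact this, fun h => ⟨⟨(x, z), h⟩, rfl⟩⟩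
  · intro n p hp
    have hT : @nhds _ (joinTop R K T TK) p = comap e.symm (@nhds _ (fibTop T TK) (e.symm p)) := by
      have : joinTop R K T TK = TopologicalSpace.induced e.symm (fibTop T TK) := by
        rw [Equiv.induced_symm]; rfl
      rw [this, nhds_induced]
    rw [hT, fib_nhds h hTK n _ (hm n p hp)]
    have hb0 := (mf (e.symm p)).2
    have ha0 := hm n p hp
    have k1 : p.1.1 = (e.symm p).1.1.1.1 := (e1 p).symm
    have k2 : p.1.2 = (e.symm p).1.2.1.2 := (e2 p).symm
    apply le_antisymm
    · refine le_inf ?_ ?_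
      · refine tendsto_iff_comap.1 ?_
        have t1 : Tendsto (fun q : Fib R K => (q.1.1.1, q.1.2.1))
          (comap (fun q : Fib R K => (q.1.1.1, q.1.2.1)) (𝓝 ((e.symm p).1.1.1, (e.symm p).1.2.1)) ⊓
            𝓟 {q | P n q.1.1.1.1 q.1.1.1.2}) (𝓝 ((e.symm p).1.1.1, (e.symm p).1.2.1)) :=
          tendsto_comap.mono_left inf_le_left
        have c : Continuous (fun r : (Z × Z) × (Z × Z) => (r.1.1, r.2.2)) := by fun_prop
        have t2 := (c.tendsto ((e.symm p).1.1.1, (e.symm p).1.2.1)).comp (t1.comp (tendsto_comap (f := e.symm)))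
        have : p.1 = ((e.symm p).1.1.1.1, (e.symm p).1.2.1.2) := Prod.ext k1 k2
        rw [this]
        refine (tendsto_congr ?_).1 t2
        intro p'
        exact Prod.ext (e1 p') (e2 p')
      · rw [le_principal_iff]
        have ev := ht.ev ha0 hb0 (by rw [e1, e2]; exact hp)
        have c : Continuous (fun r : (Z × Z) × (Z × Z) => (r.1.1, r.1.2, r.2.2)) := by fun_prop
        have ev' := (c.tendsto ((e.symm p).1.1.1, (e.symm p).1.2.1)).eventually ev
        have ev2 := (inter_mem_inf (preimage_mem_comap (m := fun q : Fib R K => (q.1.1.1, q.1.2.1)) ev')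
          (mem_principal_self {q : Fib R K | P n q.1.1.1.1 q.1.1.1.2}))
        refine mem_of_superset (preimage_mem_comap (m := e.symm) ev2) ?_
        rintro p' ⟨hp1, hp2⟩
        have := hp1 hp2 (mf _).2
        simp only [e1, e2] at this
        exact this
    · refine tendsto_iff_comap.1 ?_
      rw [tendsto_inf]
      constructor
      · rw [tendsto_comap_iff]
        have tv : Tendsto (Subtype.val : ↥(joinRel R K) → Z × Z) (comap Subtype.val (𝓝 p.1) ⊓
          𝓟 {q | QQ P (fun x y => (x, y) ∈ K) n q.1.1 q.1.2}) (𝓝 p.1) :=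
          tendsto_comap.mono_left inf_le_left
        have t1 : Tendsto (fun p' => (e.symm p').1.1.1.1) (comap Subtype.val (𝓝 p.1) ⊓
          𝓟 {q | QQ P (fun x y => (x, y) ∈ K) n q.1.1 q.1.2}) (𝓝 (e.symm p).1.1.1.1) := by
          simp only [e1]
          exact (continuous_fst.tendsto _).comp tv
        have t2 : Tendsto (fun p' => (e.symm p').1.2.1.2) (comap Subtype.val (𝓝 p.1) ⊓
          𝓟 {q | QQ P (fun x y => (x, y) ∈ K) n q.1.1 q.1.2}) (𝓝 (e.symm p).1.2.1.2) := by
          simp only [e2]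
          exact (continuous_snd.tendsto _).comp tv
        have t3 : Tendsto (fun p' => (e.symm p').1.1.1.2) (comap Subtype.val (𝓝 p.1) ⊓
          𝓟 {q | QQ P (fun x y => (x, y) ∈ K) n q.1.1 q.1.2}) (𝓝 (e.symm p).1.1.1.2) := by
          intro V hV
          rw [mem_map]
          have ev := ht.mid ha0 hb0 hV
          have hpp : ((e.symm p).1.1.1.1, (e.symm p).1.2.1.2) = p.1 := Prod.ext k1.symm k2.symm
          rw [hpp] at ev
          refine mem_of_superset (inter_mem_inf (preimage_mem_comap (m := Subtype.val) ev)
            (mem_principal_self _)) ?_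
          rintro p' ⟨h1, h2⟩
          refine h1 _ ?_ ?_
          · rw [← e1]; exact hm n p' h2
          · rw [← e2]; exact (mf _).2
        have t4 : Tendsto (fun p' => (e.symm p').1.2.1.1) (comap Subtype.val (𝓝 p.1) ⊓
          𝓟 {q | QQ P (fun x y => (x, y) ∈ K) n q.1.1 q.1.2}) (𝓝 (e.symm p).1.2.1.1) := by
          have : ∀ p', (e.symm p').1.2.1.1 = (e.symm p').1.1.1.2 := fun p' => (e.symm p').2.symm
          simp only [this]; exact t3
        exact (t1.prodMk_nhds t3).prodMk_nhds (t4.prodMk_nhds t2)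
      · rw [tendsto_principal]
        refine mem_of_superset (mem_inf_of_right (mem_principal_self _)) ?_
        intro p' hp'
        exact hm n p' hp'

end Tran2
end Absorb

open Set Topology MeasureTheory

namespace Absorb
open Filter
set_option linter.all false
set_option linter.deprecated false

section NN

/-- One-point compactification of the naturals, as monotone binary sequences. -/
abbrev NN : Type := {a : ℕ → Bool // ∀ i, a i = true → a (i + 1) = true}

instance : CompactSpace NN := by
  refine (isCompact_iff_compactSpace
    (s := {a : ℕ → Bool | ∀ i, a i = true → a (i + 1) = true})).1 ?_
  refine IsClosed.isCompact ?_
  have : {a : ℕ → Bool | ∀ i, a i = true → a (i + 1) = true} =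
      ⋂ i, {a : ℕ → Bool | a i = true → a (i + 1) = true} := by
    ext a; simp
  rw [this]
  refine isClosed_iInter fun i => ?_
  have c : Continuous (fun a : ℕ → Bool => (a i, a (i + 1))) := by fun_prop
  exact (isClosed_discrete {p : Bool × Bool | p.1 = true → p.2 = true}).preimage c

instance : SecondCountableTopology NN :=
  TopologicalSpace.Subtype.secondCountableTopology
    {a : ℕ → Bool | ∀ i, a i = true → a (i + 1) = true}

def NN.s (a : NN) : NN := ⟨fun n => match n with | 0 => false | n + 1 => a.1 n, by
  intro i hi
  cases i with
  | zero => simp at hi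
  | succ i => exact a.2 i hi⟩

def NN.pt : NN := ⟨fun _ => true, fun _ _ => rfl⟩

def NN.t (a : NN) : NN := ⟨fun n => a.1 (n + 1), fun i hi => a.2 _ hi⟩

theorem NN.t_s (a : NN) : a.s.t = a := rfl
theorem NN.s0 (a : NN) : a.s.1 0 = false := rfl

theorem NN.t_cont : Continuous NN.t := by
  refine Continuous.subtype_mk ?_ _
  refine continuous_pi fun n => ?_
  exact (continuous_apply (n + 1)).comp continuous_subtype_val

theorem NN.eq_pt {a : NN} (h : a.1 0 = true) : a = NN.pt := by
  apply Subtype.ext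
  funext n
  show a.1 n = true
  induction n with
  | zero => exact h
  | succ n ih => exact a.2 n ih

theorem NN.ext_t {a b : NN} (ha : a.1 0 = false) (hb : b.1 0 = false) (h : a.t = b.t) : a = b := by
  apply Subtype.ext
  funext n
  cases n with
  | zero => rw [ha, hb]
  | succ n => exact congrFun (congrArg Subtype.val h) n

theorem NN.clopen0 : IsClopen {a : NN | a.1 0 = true} := by
  have c : Continuous (fun a : NN => a.1 0) := (continuous_apply 0).comp continuous_subtype_val
  exact (isClopen_discrete {true}).preimage c

end NN

section Prd
variable {Z N : Type*} [TopologicalSpace Z] [CompactSpace Z] [T2Space Z] [TotallyDisconnectedSpace Z]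
  [TopologicalSpace N] [CompactSpace N] [T2Space N] [TotallyDisconnectedSpace N]

theorem isCE_prod {F : Z → Z → Prop} (hF : IsCE F) :
    IsCE (fun v w : Z × N => F v.1 w.1 ∧ v.2 = w.2) where
  refl v := ⟨hF.refl _, rfl⟩
  symm h := ⟨hF.symm h.1, h.2.symm⟩
  trans h h' := ⟨hF.trans h.1 h'.1, h.2.trans h'.2⟩
  clo := by
    refine IsClosed.inter (hF.clo.preimage (f := fun p : (Z × N) × (Z × N) => (p.1.1, p.2.1)) (by fun_prop)) ?_
    exact isClosed_eq (by fun_prop) (by fun_prop)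
  opn := by
    rintro ⟨x, a⟩ ⟨y, b⟩ U ⟨h, hab⟩ hU
    simp only at h hab
    subst hab
    rw [nhds_prod_eq] at hU
    obtain ⟨U1, h1, U2, h2, h3⟩ := mem_prod_iff.1 hU
    rw [nhds_prod_eq]
    filter_upwards [prod_mem_prod (hF.opn h h1) h2] with p hp
    obtain ⟨⟨y', hy', hf⟩, hp2⟩ := hp
    exact ⟨(y', p.2), h3 ⟨hy', hp2⟩, hf, rfl⟩
  inj := by
    rintro ⟨x, a⟩
    obtain ⟨U, hU, h⟩ := hF.inj x
    refine ⟨U ×ˢ univ, prod_mem_nhds hU univ_mem, ?_⟩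
    rintro ⟨y, b⟩ hy ⟨z, c⟩ hz ⟨h1, h2⟩
    exact Prod.ext (h _ hy.1 _ hz.1 h1) h2

theorem isCE_conj {Z' : Type*} [TopologicalSpace Z'] {F : Z → Z → Prop} (hF : IsCE F) (g : Z' ≃ₜ Z) :
    IsCE (fun v w => F (g v) (g w)) where
  refl v := hF.refl _
  symm h := hF.symm h
  trans h h' := hF.trans h h'
  clo := hF.clo.preimage (f := fun p : Z' × Z' => (g p.1, g p.2)) (by fun_prop)
  opn := by
    intro x y U h hU
    have h1 : g.symm ⁻¹' U ∈ 𝓝 (g y) := by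
      refine g.symm.continuous.continuousAt ?_
      rw [g.symm_apply_apply]; exact hU
    filter_upwards [g.continuous.continuousAt (hF.opn h h1)] with x' hx'
    obtain ⟨y', hy', hf⟩ := hx'
    exact ⟨g.symm y', hy', by rw [g.apply_symm_apply]; exact hf⟩
  inj x := by
    obtain ⟨U, hU, h⟩ := hF.inj (g x)
    exact ⟨g ⁻¹' U, g.continuous.continuousAt hU, fun y hy z hz hyz => g.injective (h _ hy _ hz hyz)⟩

end Prd

/-- The shifted exhaustion, starting from equality. -/
def QS {Z : Type*} (P : ℕ → Z → Z → Prop) (K : Z → Z → Prop) : ℕ → Z → Z → Prop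
  | 0 => fun x y => x = y
  | n + 1 => QQ P K n

section QSs
variable {Z : Type*} [TopologicalSpace Z] [CompactSpace Z] [T2Space Z] [TotallyDisconnectedSpace Z]
  {P : ℕ → Z → Z → Prop} {K : Z → Z → Prop}

theorem Tr.QSce (h : Tr P K) (n : ℕ) : IsCE (QS P K n) := by
  cases n with
  | zero => exact isCE_eq
  | succ n => exact h.Qce n

theorem Tr.QSmono (h : Tr P K) : ∀ m n, m ≤ n → ∀ x y, QS P K m x y → QS P K n x y := by
  intro m n hmn x y hq
  cases n with
  | zero => obtain rfl : m = 0 := by omega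
            exact hq
  | succ n =>
    cases m with
    | zero => obtain rfl : x = y := hq
              exact (h.Qce n).refl x
    | succ m => exact h.Qmono (by omega) hq

theorem Tr.QSP (h : Tr P K) {n : ℕ} {x y : Z} (hq : QS P K n x y) (hp : ∃ m, P m x y) : P n x y := by
  cases n with
  | zero => obtain rfl : x = y := hq
            exact (h.hP 0).refl x
  | succ n =>
    obtain ⟨m, hm⟩ := hp
    exact h.mono _ _ (Nat.le_succ n) _ _ (h.PQ hm hq)

theorem Tr.QSPce (h : Tr P K) (n : ℕ) : IsCE (fun x y => (∃ m, P m x y) ∧ QS P K n x y) := by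
  cases n with
  | zero =>
    have e : (fun x y => (∃ m, P m x y) ∧ QS P K 0 x y) = fun x y => x = y := by
      funext x y
      refine propext ⟨fun h => h.2, fun e => ⟨⟨0, ?_⟩, e⟩⟩
      rw [e]; exact (h.hP 0).refl y
    rw [e]; exact isCE_eq
  | succ n => exact h.PQce n

theorem Tr.QSmid (h : Tr P K) {n : ℕ} {x y : Z} (hq : QS P K n x y) :
    ∃ w m, P m x w ∧ K w y := by
  cases n with
  | zero => obtain rfl : x = y := hq
            exact ⟨x, 0, (h.hP 0).refl x, h.hK.refl x⟩
  | succ n =>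
    obtain ⟨w, h1, h2⟩ := hq x (h.hK.refl x)
    exact ⟨w, n, h2, h.hK.symm h1⟩

end QSs

theorem hmin_of {X : Type*} [TopologicalSpace X] [CompactSpace X] [T2Space X]
    [TotallyDisconnectedSpace X] {E : ℕ → X → X → Prop} (hE : ∀ n, IsCE (E n))
    (hmono : ∀ m n, m ≤ n → ∀ x y, E m x y → E n x y) (R : Set (X × X))
    (hR : ∀ x y, (x, y) ∈ R ↔ ∃ n, E n x y) (hmin : IsMinimalRel R) :
    ∀ B : Set X, IsClopen B → B.Nonempty → ∃ n, ∀ x, ∃ y ∈ B, E n x y := by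
  intro B hB hne
  have := (isCompact_univ (X := X)).elim_directed_cover (fun n => {x | ∃ y ∈ B, E n x y}) ?_ ?_ ?_
  · obtain ⟨n, hn⟩ := this
    exact ⟨n, fun x => hn (mem_univ x)⟩
  · intro n
    rw [isOpen_iff_mem_nhds]
    rintro x ⟨y, hy, hxy⟩
    exact (hE n).opn hxy (hB.isOpen.mem_nhds hy)
  · intro x _
    obtain ⟨y, hy, hyB⟩ := (hmin x).exists_mem_open hB.isOpen hne
    obtain ⟨n, hn⟩ := (hR x y).1 hy
    exact mem_iUnion.2 ⟨n, y, hyB, hn⟩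
  · intro m n
    refine ⟨max m n, ?_, ?_⟩
    · rintro x ⟨y, hy, h⟩; exact ⟨y, hy, hmono _ _ (le_max_left _ _) _ _ h⟩
    · rintro x ⟨y, hy, h⟩; exact ⟨y, hy, hmono _ _ (le_max_right _ _) _ _ h⟩

theorem hperf_of {X : Type*} [TopologicalSpace X] [T2Space X]
    (hperf : ∀ x : X, Filter.NeBot (nhdsWithin x {x}ᶜ)) (B : Set X) (hB : IsClopen B)
    (hne : B.Nonempty) : B.Infinite := by
  obtain ⟨x, hx⟩ := hne
  haveI := hperf x
  exact infinite_of_mem_nhds x (hB.isOpen.mem_nhds hx)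

end Absorb

open Set Topology MeasureTheory
set_option linter.all false
set_option linter.deprecated false

/-- **the absorption theorem.** Let `R` be a minimal AF-equivalence
relation on the Cantor set `X`, `Y ⊆ X` closed, `R`-étale and `R`-thin, and `K` a CEER
on `Y` transverse to `R|_Y`. Then there is a homeomorphism `h : X → X` with
(i) `h × h (R ∨ K) = R` (so `R ∨ K` is orbit equivalent to `R`, hence affable);
(ii) `h(Y)` is `R`-étale and `R`-thin;
(iii) `h|_Y × h|_Y : (R|_Y) ∨ K → R|_{h(Y)}` is a homeomorphism. -/
theorem absorption {X : Type} [TopologicalSpace X] [CompactSpace X]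
    [TopologicalSpace.MetrizableSpace X] [TotallyDisconnectedSpace X] [Nonempty X]
    (hperf : ∀ x : X, Filter.NeBot (nhdsWithin x {x}ᶜ))
    (R : Set (X × X)) (T : TopologicalSpace ↥R)
    (hAF : IsAFEquivRel R T) (hmin : IsMinimalRel R)
    (Y : Set X) (hYc : IsClosed Y)
    (hYe : IsEtaleEquivRel (restrictRel R Y) (restrictTop R T Y))
    (hYt : @IsThin X _ (borel X) R T Y)
    (K : Set (↥Y × ↥Y)) (TK : TopologicalSpace ↥K) (hK : IsCEER K TK)
    (htr : AreTransverse K TK (restrictRel R Y) (restrictTop R T Y)) :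
    ∃ h : X → X, IsHomeomorph h ∧
      (fun p : X × X => (h p.1, h p.2)) ''
          joinRel R {p : X × X | ∃ q : ↥Y × ↥Y, q ∈ K ∧ p = ((q.1 : X), (q.2 : X))}
        = R ∧
      IsClosed (h '' Y) ∧
      IsEtaleEquivRel (restrictRel R (h '' Y)) (restrictTop R T (h '' Y)) ∧
      (@IsThin X _ (borel X) R T (h '' Y)) ∧
      ∃ G : ↥(joinRel (restrictRel R Y) K) → ↥(restrictRel R (h '' Y)),
        (∀ p : ↥(joinRel (restrictRel R Y) K),
          (((G p).1.1 : X), ((G p).1.2 : X)) = (h ((p.1.1 : ↥Y) : X), h ((p.1.2 : ↥Y) : X))) ∧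
        @IsHomeomorph _ _ (joinTop (restrictRel R Y) K (restrictTop R T Y) TK)
          (restrictTop R T (h '' Y)) G := by
  letI : MetricSpace X := TopologicalSpace.metrizableSpaceMetric X
  haveI : SecondCountableTopology X := inferInstance
  letI : MeasurableSpace X := borel X
  haveI : BorelSpace X := ⟨rfl⟩
  haveI : CompactSpace ↥Y := isCompact_iff_compactSpace.1 hYc.isCompact
  obtain ⟨E, hE, hmono, hE0, hR, hN⟩ := Absorb.af_unpack R T hAF
  have hmin' := Absorb.hmin_of hE hmono R hR hmin
  have hperf' := Absorb.hperf_of hperf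
  have hth : Absorb.ThinCount E Y := Absorb.thinCount_of_thin hE hmono hmin' R T hN hYc hYt
  obtain ⟨hKce, hTK⟩ := Absorb.ceer_isCE K TK hK
  have hNY := Absorb.NT.restrict R T hN Y
  have hPce := Absorb.restrict_CE hE R T hN Y hYe
  have hPm : ∀ m n, m ≤ n → ∀ x y : ↥Y, E m x y → E n x y := fun m n hmn x y h => hmono m n hmn _ _ h
  have tr := Absorb.tr_of_transverse hPce hPm hNY hKce hTK htr
  have hNJ := Absorb.nt_join hNY hTK tr
  set P : ℕ → ↥Y → ↥Y → Prop := fun n x y => E n x y with hPdef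
  set KK : ↥Y → ↥Y → Prop := fun x y => (x, y) ∈ K with hKK
  let QV : ℕ → (↥Y × Absorb.NN) → (↥Y × Absorb.NN) → Prop :=
    fun n v w => Absorb.QS P KK n v.1 w.1 ∧ v.2 = w.2
  let PV : (↥Y × Absorb.NN) → (↥Y × Absorb.NN) → Prop := fun v w => (∃ m, P m v.1 w.1) ∧ v.2 = w.2
  have hPVe : Equivalence PV := by
    refine ⟨fun v => ⟨⟨0, (hPce 0).refl _⟩, rfl⟩, ?_, ?_⟩
    · rintro v w ⟨⟨m, hm⟩, h⟩
      exact ⟨⟨m, (hPce m).symm hm⟩, h.symm⟩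
    · rintro u v w ⟨⟨m, hm⟩, h⟩ ⟨⟨m', hm'⟩, h'⟩
      exact ⟨⟨max m m', (hPce _).trans (hPm _ _ (le_max_left _ _) _ _ hm)
        (hPm _ _ (le_max_right _ _) _ _ hm')⟩, h.trans h'⟩
  have hPQ : ∀ n, Absorb.IsCE (fun v w => PV v w ∧ QV n v w) := by
    intro n
    have := Absorb.isCE_prod (N := Absorb.NN) (tr.QSPce n)
    have e : (fun v w => PV v w ∧ QV n v w) = fun v w : ↥Y × Absorb.NN =>
        ((∃ m, P m v.1 w.1) ∧ Absorb.QS P KK n v.1 w.1) ∧ v.2 = w.2 := by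
      funext v w
      exact propext ⟨fun h => ⟨⟨h.1.1, h.2.1⟩, h.1.2⟩, fun h => ⟨⟨h.1.1, h.2⟩, h.1.2, h.2⟩⟩
    rw [e]; exact this
  obtain ⟨k, ι, E', D⟩ := Absorb.embed hE hmono hE0 hmin' hperf' hYc hth
    (Q := QV) (P := PV) (fun n => Absorb.isCE_prod (tr.QSce n))
    (fun m n hmn v w h => ⟨tr.QSmono m n hmn _ _ h.1, h.2⟩) (fun v w h => Prod.ext h.1 h.2) hPVe hPQ
  classical
  let j : ↥Y × Absorb.NN → X := fun v => if v.2.1 0 = true then (v.1 : X) else ι (v.1, v.2.t)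
  have j1 : ∀ y a, a.1 0 = true → j (y, a) = y := fun y a h => if_pos h
  have j2 : ∀ y a, a.1 0 = false → j (y, a) = ι (y, a.t) := fun y a h => if_neg (by simp [h])
  have jc : Continuous j := by
    refine Continuous.if ?_ (by fun_prop)
      (D.ιc.comp (continuous_fst.prodMk (Absorb.NN.t_cont.comp continuous_snd)))
    intro v hv
    have : IsClopen {v : ↥Y × Absorb.NN | v.2.1 0 = true} :=
      Absorb.NN.clopen0.preimage continuous_snd
    rw [this.frontier_eq] at hv
    exact hv.elim
  have F2 : ∀ n (y : ↥Y) v, ¬ E' n y (ι v) := fun n y v h => D.F2 _ v y y.2 (D.sub n _ _ h)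
  have jE : ∀ n y a y' a', E' n (j (y, a)) (j (y', a')) ↔ a = a' ∧
      ((a.1 0 = true ∧ P (k n) y y') ∨
        (a.1 0 = false ∧ (∃ m, P m y y') ∧ Absorb.QS P KK n y y')) := by
    intro n y a y' a'
    rcases ha : a.1 0 with _ | _ <;> rcases ha' : a'.1 0 with _ | _
    · rw [j2 _ _ ha, j2 _ _ ha', D.C]
      constructor
      · rintro ⟨h1, h2⟩
        exact ⟨Absorb.NN.ext_t ha ha' h1.2, Or.inr ⟨rfl, h2.1, h1.1⟩⟩
      · rintro ⟨h1, h2⟩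
        subst h1
        rcases h2 with h2 | h2
        · exact absurd h2.1 (by simp)
        · exact ⟨⟨h2.2.2, rfl⟩, h2.2.1, rfl⟩
    · rw [j2 _ _ ha, j1 _ _ ha']
      constructor
      · intro h; exact (F2 n _ _ ((D.ce n).symm h)).elim
      · rintro ⟨h1, h2⟩
        rw [h1, ha'] at ha; exact absurd ha (by simp)
    · rw [j1 _ _ ha, j2 _ _ ha']
      constructor
      · intro h; exact (F2 n _ _ h).elim
      · rintro ⟨h1, h2⟩
        rw [h1, ha'] at ha; exact absurd ha (by simp)
    · rw [j1 _ _ ha, j1 _ _ ha']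
      have e : a = a' := (Absorb.NN.eq_pt ha).trans (Absorb.NN.eq_pt ha').symm
      constructor
      · intro h
        exact ⟨e, Or.inl ⟨rfl, D.sub n _ _ h⟩⟩
      · rintro ⟨h1, h2⟩
        rcases h2 with h2 | h2
        · exact D.F1 n _ _ y.2 h2.2
        · exact absurd h2.1 (by simp)
  have ji : Function.Injective j := by
    rintro ⟨y, a⟩ ⟨y', a'⟩ h
    have h0 : E' 0 (j (y, a)) (j (y', a')) := by rw [h]; exact (D.ce 0).refl _
    obtain ⟨e, -⟩ := (jE 0 _ _ _ _).1 h0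
    subst e
    rcases ha : a.1 0 with _ | _
    · rw [j2 _ _ ha, j2 _ _ ha] at h
      have := D.ιi h
      rw [Prod.ext_iff] at this
      exact Prod.ext this.1 rfl
    · rw [j1 _ _ ha, j1 _ _ ha] at h
      exact Prod.ext (Subtype.ext h) rfl
  have H1 : Absorb.ExtHalf E' j ι := by
    refine ⟨jc, ji, ?_, ?_, ?_⟩
    · rintro n ⟨y, a⟩ ⟨y', a'⟩ W h hW
      obtain ⟨e, h3⟩ := (jE _ _ _ _ _).1 h
      clear h
      subst e
      rw [nhds_prod_eq] at hW ⊢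
      obtain ⟨U1, hU1, U2, hU2, hU⟩ := Filter.mem_prod_iff.1 hW
      have hev : ∀ᶠ b in 𝓝 a, b.1 0 = a.1 0 := by
        have c : Continuous (fun a : Absorb.NN => a.1 0) :=
          (continuous_apply 0).comp continuous_subtype_val
        exact c.continuousAt (show {b | b = a.1 0} ∈ 𝓝 (a.1 0) from by simp)
      rcases h3 with ⟨ha, h⟩ | ⟨ha, h⟩
      · filter_upwards [Filter.prod_mem_prod ((hPce (k n)).opn h hU1) (Filter.inter_mem hU2 hev)]
        rintro ⟨z, b⟩ ⟨⟨z', hz', hzz⟩, hb1, hb2⟩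
        exact ⟨(z', b), hU ⟨hz', hb1⟩, (jE _ _ _ _ _).2 ⟨rfl, Or.inl ⟨hb2.trans ha, hzz⟩⟩⟩
      · filter_upwards [Filter.prod_mem_prod ((tr.QSPce n).opn h hU1) (Filter.inter_mem hU2 hev)]
        rintro ⟨z, b⟩ ⟨⟨z', hz', hzz⟩, hb1, hb2⟩
        exact ⟨(z', b), hU ⟨hz', hb1⟩, (jE _ _ _ _ _).2 ⟨rfl, Or.inr ⟨hb2.trans ha, hzz⟩⟩⟩
    · intro n
      obtain ⟨m, hm⟩ := tr.P_sub_Q (k n)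
      refine ⟨max n (m + 1), ?_⟩
      rintro ⟨y, a⟩ ⟨y', a'⟩ h
      obtain ⟨e, h3⟩ := (jE _ _ _ _ _).1 h
      clear h
      subst e
      rw [D.C]
      rcases h3 with ⟨ha, h⟩ | ⟨ha, h⟩
      · exact ⟨⟨tr.QSmono (m + 1) _ (le_max_right _ _) _ _ (hm _ _ h), rfl⟩, ⟨_, h⟩, rfl⟩
      · exact ⟨⟨tr.QSmono _ _ (le_max_left _ _) _ _ h.2, rfl⟩, h.1, rfl⟩
    · intro B hB hne
      obtain ⟨n, U, hU, hYU, hιU, hc⟩ := D.Comp B hB hne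
      obtain ⟨φ, f1, f2, f3, f4⟩ := (D.ce n).match' hU hB hc
      have hm : ∀ v, ι v ∈ U := fun v => hιU ⟨v, rfl⟩
      exact ⟨n, fun v => φ (ι v), f1.comp_continuous D.ιc hm,
        fun v w h => D.ιi (f2 (hm v) (hm w) h), fun v => ⟨f3 (hm v), f4 _ (hm v)⟩⟩
  have H2 : Absorb.ExtHalf E' ι j := by
    refine ⟨D.ιc, D.ιi, ?_, ?_, ?_⟩
    · intro n v w W h hW
      rw [D.C] at h
      filter_upwards [(hPQ n).opn ⟨h.2, h.1⟩ hW] with v' hv'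
      obtain ⟨w', hw', h'⟩ := hv'
      exact ⟨w', hw', (D.C _ _ _).2 ⟨h'.2, h'.1⟩⟩
    · intro n
      refine ⟨n, ?_⟩
      rintro ⟨y, a⟩ ⟨y', a'⟩ h
      rw [D.C] at h
      obtain ⟨⟨hq, e⟩, hp, -⟩ := h
      simp only at hq e hp
      subst e
      rw [jE]
      refine ⟨rfl, ?_⟩
      rcases ha : a.1 0 with _ | _
      · exact Or.inr ⟨rfl, hp, hq⟩
      · exact Or.inl ⟨rfl, hPm _ _ (D.hk n) _ _ (tr.QSP hq hp)⟩
    · intro B hB hne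
      obtain ⟨n, U, hU, hYU, hιU, hc⟩ := D.Comp B hB hne
      obtain ⟨φ, f1, f2, f3, f4⟩ := (D.ce n).match' hU hB hc
      have hm : ∀ v, j v ∈ U := by
        rintro ⟨y, a⟩
        rcases ha : a.1 0 with _ | _
        · rw [j2 _ _ ha]; exact hιU ⟨_, rfl⟩
        · rw [j1 _ _ ha]; exact hYU y.2
      exact ⟨n, fun v => φ (j v), f1.comp_continuous jc hm,
        fun v w h => ji (f2 (hm v) (hm w) h), fun v => ⟨f3 (hm v), f4 _ (hm v)⟩⟩
  obtain ⟨h, hj, hh⟩ := Absorb.extension D.ce D.mono H1 H2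
  have hY : ∀ y : ↥Y, h y = ι (y, Absorb.NN.pt) := fun y => by
    rw [← hj, j1 _ _ rfl]
  have hι : ∀ y a, h (ι (y, a)) = ι (y, a.s) := fun y a => by
    have := hj (y, a.s)
    rw [j2 y a.s rfl] at this
    exact this
  have E'R : ∀ n x y, E' n x y → (x, y) ∈ R := fun n x y hxy => (hR _ _).2 ⟨_, D.sub n x y hxy⟩
  have QR : ∀ n v w, QV n v w → (ι v, ι w) ∈ R := fun n v w hq => (hR _ _).2 ⟨_, (D.A n v w).2 hq⟩
  have Rrefl : ∀ x, (x, x) ∈ R := fun x => (hR _ _).2 ⟨0, (hE 0).refl x⟩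
  have Rsymm : ∀ x y, (x, y) ∈ R → (y, x) ∈ R := fun x y hxy => by
    rw [hR] at hxy ⊢
    exact hxy.imp fun n hn => (hE n).symm hn
  have Rtrans : ∀ x y z, (x, y) ∈ R → (y, z) ∈ R → (x, z) ∈ R := fun x y z h1 h2 => by
    rw [hR] at h1 h2 ⊢
    obtain ⟨m, hm⟩ := h1
    obtain ⟨n, hn⟩ := h2
    exact ⟨max m n, (hE _).trans (hmono _ _ (le_max_left _ _) _ _ hm)
      (hmono _ _ (le_max_right _ _) _ _ hn)⟩
  have E'h : ∀ n x y, E' n x y → (h x, h y) ∈ R := fun n x y hxy => by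
    obtain ⟨m, hm⟩ := (hh x y).1 ⟨n, hxy⟩
    exact E'R m _ _ hm
  have key1 : ∀ x y, Relation.EqvGen (fun a b => (a, b) ∈ R ∨ (a, b) ∈
        {p : X × X | ∃ q : ↥Y × ↥Y, q ∈ K ∧ p = ((q.1 : X), (q.2 : X))}) x y → (h x, h y) ∈ R := by
    intro x y hxy
    induction hxy with
    | rel x y hxy =>
      rcases hxy with h1 | ⟨⟨y1, y2⟩, hq, hp⟩
      · obtain ⟨n, hn⟩ := (hR x y).1 h1
        obtain ⟨m, hm | ⟨⟨y1, a⟩, ⟨y2, b⟩, m1, m2, m3⟩⟩ := D.D n x y hn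
        · exact E'h m _ _ hm
        · refine Rtrans _ _ _ (E'h m _ _ m1) (Rtrans _ _ _ ?_ (E'h m _ _ m3))
          rw [hι, hι]
          refine QR m _ _ ⟨m2.1, ?_⟩
          have : a = b := m2.2
          rw [this]
      · rw [Prod.ext_iff] at hp
        have hp1 : x = y1 := hp.1
        have hp2 : y = y2 := hp.2
        rw [hp1, hp2]
        rw [hY, hY]
        obtain ⟨m, hm⟩ := tr.exists_Q ((hPce 0).refl y1) hq
        exact QR (m + 1) _ _ ⟨hm, rfl⟩
    | refl x => exact Rrefl _
    | symm x y _ ih => exact Rsymm _ _ ih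
    | trans x y z _ _ ih1 ih2 => exact Rtrans _ _ _ ih1 ih2
  have key : ∀ x y, (x, y) ∈ joinRel R {p : X × X | ∃ q : ↥Y × ↥Y, q ∈ K ∧ p = ((q.1 : X), (q.2 : X))}
      ↔ (h x, h y) ∈ R := by
    intro x y
    constructor
    · exact fun hxy => key1 x y hxy
    · intro hxy
      have E'J : ∀ n x y, E' n (h x) (h y) → Relation.EqvGen (fun a b => (a, b) ∈ R ∨ (a, b) ∈
        {p : X × X | ∃ q : ↥Y × ↥Y, q ∈ K ∧ p = ((q.1 : X), (q.2 : X))}) x y := by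
        intro n x y hxy
        obtain ⟨m, hm⟩ := (hh x y).2 ⟨n, hxy⟩
        exact Relation.EqvGen.rel _ _ (Or.inl (E'R m _ _ hm))
      obtain ⟨n, hn⟩ := (hR _ _).1 hxy
      show Relation.EqvGen _ x y
      obtain ⟨m, hm | ⟨⟨y1, a⟩, ⟨y2, b⟩, m1, m2, m3⟩⟩ := D.D n _ _ hn
      · exact E'J m _ _ hm
      · rw [← hj] at m1 m3
        refine Relation.EqvGen.trans _ _ _ (E'J m _ _ m1)
          (Relation.EqvGen.trans _ _ _ ?_ (E'J m _ _ m3))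
        obtain ⟨hq, e⟩ := m2
        simp only at hq e
        subst e
        rcases ha : a.1 0 with _ | _
        · rw [j2 _ _ ha, j2 _ _ ha]
          exact Relation.EqvGen.rel _ _ (Or.inl (QR m _ _ ⟨hq, rfl⟩))
        · rw [j1 _ _ ha, j1 _ _ ha]
          obtain ⟨w, m', w1, w2⟩ := tr.QSmid hq
          exact Relation.EqvGen.trans _ (w : X) _
            (Relation.EqvGen.rel _ _ (Or.inl ((hR _ _).2 ⟨m', w1⟩)))
            (Relation.EqvGen.rel _ _ (Or.inr ⟨(w, y2), w2, rfl⟩))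
  have hcl : IsClosed (h '' Y) := h.isClosedMap _ hYc
  haveI : CompactSpace ↥(h '' Y) := isCompact_iff_compactSpace.1 hcl.isCompact
  let g : ↥Y ≃ₜ ↥(h '' Y) := h.image Y
  have gv : ∀ y, ((g y : ↥(h '' Y)) : X) = ι (y, Absorb.NN.pt) := fun y => hY y
  have hg : ∀ n (x y : ↥Y), Absorb.QQ P KK n x y ↔ E (k (n + 1)) (g x) (g y) := by
    intro n x y
    rw [gv, gv, D.A]
    exact ⟨fun hq => ⟨hq, rfl⟩, fun hq => hq.1⟩
  have hNI := Absorb.NT.restrict R T hN (h '' Y)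
  have hNS : @Absorb.NT ↥(h '' Y) _ ↥(restrictRel R (h '' Y)) (restrictTop R T (h '' Y))
      (fun n x y => E (k (n + 1)) x y) Subtype.val :=
    @Absorb.NT.subseq _ _ _ (restrictTop R T (h '' Y)) _ _ hNI
      (fun m n hmn x y hxy => hmono m n hmn _ _ hxy) (fun n => k (n + 1))
      (fun n => (Nat.le_succ n).trans (D.hk (n + 1)))
  have hFce : ∀ n, Absorb.IsCE (fun x y : ↥(h '' Y) => E (k (n + 1)) x y) := by
    intro n
    have := Absorb.isCE_conj (tr.Qce n) g.symm
    have e : (fun x y : ↥(h '' Y) => E (k (n + 1)) x y) =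
        fun x y => Absorb.QQ P KK n (g.symm x) (g.symm y) := by
      funext x y
      rw [hg, g.apply_symm_apply, g.apply_symm_apply]
    rw [e]; exact this
  refine ⟨h, h.isHomeomorph, ?_, hcl, ?_, ?_, ?_⟩
  · ext ⟨x, y⟩
    constructor
    · rintro ⟨⟨x', y'⟩, hp, he⟩
      rw [← he]; exact (key _ _).1 hp
    · intro hp
      refine ⟨(h.symm x, h.symm y), (key _ _).2 ?_, ?_⟩
      · rw [h.apply_symm_apply, h.apply_symm_apply]; exact hp
      · show (h (h.symm x), h (h.symm y)) = (x, y)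
        rw [h.apply_symm_apply, h.apply_symm_apply]
  · exact Absorb.etale_of_NT hFce
      (fun m n hmn x y hxy => hmono _ _ (D.hkm (Nat.succ_le_succ hmn)) _ _ hxy) _ _ hNS
  · refine Absorb.thin_of_count hE R T hN _ ?_
    intro N
    obtain ⟨n, O, hO, hιO, hc⟩ := D.Th N
    refine ⟨n, O, hO, ?_, hc⟩
    rintro _ ⟨y, hy, rfl⟩
    rw [hY ⟨y, hy⟩]
    exact hιO ⟨_, rfl⟩
  · have hmemG : ∀ p : ↥(joinRel (restrictRel R Y) K),
        (g p.1.1, g p.1.2) ∈ restrictRel R (h '' Y) := by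
      intro p
      obtain ⟨n, hn⟩ := (Absorb.NT.mem hNJ p.1.1 p.1.2).1 p.2
      exact (hR _ _).2 ⟨_, (hg n _ _).1 hn⟩
    refine ⟨fun p => ⟨(g p.1.1, g p.1.2), hmemG p⟩, fun p => rfl, ?_⟩
    exact @Absorb.NT.homeo _ _ _ _ _ _ (joinTop (restrictRel R Y) K (restrictTop R T Y) TK)
      (restrictTop R T (h '' Y)) _ _ _ _ hNJ hNS g hg _ (fun p => rfl)
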